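/- Fix c0 ∈ (0,1/4) and δ0 ∈ (0,1/2). There exists η ∈ (0,1/4), depending only on δ0, with the following property. For every positive definite integral quadratic form Q in 4 variables, every odd prime p, and every ε > 0 there is a constant κ (depending only on Q, p, ε, c0, δ0) such that: for every primitive, Minkowski reduced (|B| ≤ A ≤ C), positive definite integral binary quadratic form q(x,y) = A·x² + B·x·y + C·y² with discriminant D = A·C − B²/4 ≥ 1 satisfying v_p(D) = 0 and A ≥ c0·D^{δ0}, and for n ∈ ℕ maximal with p^{4n} ≤ D^{1/2−η}, one has #𝒮(n) ≤ κ·D^{1/2+ε−η}. -/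

import Mathlib

open Matrix

noncomputable section

/-- Congruence of rationals modulo `p^k`: `v_p(a − b) ≥ k` (with `v_p(0) = ∞`). -/
def PCong (p k : ℕ) (a b : ℚ) : Prop :=
  a = b ∨ (k : ℤ) ≤ padicValRat p (a - b)

/-- `M` is the Gram matrix of a positive definite integral quadratic form in `n` variables. -/
def IsIntegralPosDefForm {n : ℕ} (M : Matrix (Fin n) (Fin n) ℚ) : Prop :=
  M.IsSymm ∧ (∀ i, ∃ z : ℤ, M i i = z) ∧ (∀ i j, ∃ z : ℤ, 2 * M i j = z) ∧
    ∀ v : Fin n → ℚ, v ≠ 0 → 0 < v ⬝ᵥ M.mulVec v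

/-- Membership conditions for the set `𝒮(n)`. -/
def SMem (MQ : Matrix (Fin 4) (Fin 4) ℚ) (A B C : ℤ) (p n : ℕ)
    (x0 x1 x2 x3 x4 : ℚ) : Prop :=
  -- half-integrality
  (∃ z : ℤ, 2 * x0 = z) ∧ (∃ z : ℤ, 2 * x1 = z) ∧ (∃ z : ℤ, 2 * x2 = z) ∧
    (∃ z : ℤ, 2 * x3 = z) ∧ (∃ z : ℤ, 2 * x4 = z) ∧
  -- (E) the degree four equation
  MQ.det * x0 ^ 2 =
    (x1 * x4 - x2 * x3 - ((A : ℚ) * C - (B : ℚ) ^ 2 / 4)) ^ 2 -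
      ((C : ℚ) * x1 - (A : ℚ) * x4) ^ 2 -
      ((B : ℚ) * x1 - (A : ℚ) * (x2 + x3)) * ((B : ℚ) * x4 - (C : ℚ) * (x2 + x3)) ∧
  -- (S1) archimedean constraints
  |x1| ≤ (A : ℚ) ∧ |x4| ≤ (C : ℚ) ∧ x2 ^ 2 ≤ (A : ℚ) * C ∧ x3 ^ 2 ≤ (A : ℚ) * C ∧
  -- (S2) congruence constraints mod `p^(4n)`
  PCong p (4 * n) (x1 * x4 - x2 * x3) ((A : ℚ) * C - (B : ℚ) ^ 2 / 4) ∧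
  PCong p (4 * n) ((C : ℚ) * x1) ((A : ℚ) * x4) ∧
  PCong p (4 * n) ((C : ℚ) * (x2 + x3)) ((B : ℚ) * x4) ∧
  PCong p (4 * n) ((A : ℚ) * (x2 + x3)) ((B : ℚ) * x1) ∧
  -- (S3) boundary conditions
  ((x1 = (A : ℚ) ∨ x4 = (C : ℚ)) → x0 = 0 ∧ x2 = (B : ℚ) / 2 ∧ x3 = (B : ℚ) / 2) ∧
  ((x1 = -(A : ℚ) ∨ x4 = -(C : ℚ)) → x0 = 0 ∧ x2 = -((B : ℚ) / 2) ∧ x3 = -((B : ℚ) / 2))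

/-- The set `𝒮(n)` of half-integral tuples `(x0, x1, x2, x3, x4)`. -/
def SSetQ (MQ : Matrix (Fin 4) (Fin 4) ℚ) (A B C : ℤ) (p n : ℕ) : Set (Fin 5 → ℚ) :=
  {x | SMem MQ A B C p n (x 0) (x 1) (x 2) (x 3) (x 4)}

open Polynomial in
/-- Newton lifting: on solutions of `δ z² = G(u)` near `y₀`, the ordinate is `ℓ`-adically
approximated by a polynomial in `u`. -/
lemma exists_poly_approx_sqrt {δ y0 ℓ : ℤ} {G : ℤ[X]} (hc : IsCoprime (2 * δ * y0) ℓ) (k : ℕ) :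
    ∃ h : ℤ[X], ∀ u z : ℤ, δ * z ^ 2 = G.eval u → ℓ ∣ z - y0 → ℓ ^ (k + 1) ∣ z - h.eval u := by
  induction k with
  | zero => exact ⟨C y0, fun u z _ hz => by simpa using hz⟩
  | succ k ih =>
    obtain ⟨h, hh⟩ := ih
    obtain ⟨a, b, hab⟩ := hc
    refine ⟨h - C a * (C δ * h ^ 2 - G), fun u z hz hl => ?_⟩
    obtain ⟨t, ht⟩ := hh u z hz hl
    obtain ⟨s, hs⟩ := hl
    have hzh : h.eval u = z - ℓ ^ (k + 1) * t := by linarith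
    simp only [eval_sub, eval_mul, eval_C, eval_pow]
    rw [← hz, hzh]
    have hz' : z = y0 + ℓ * s := by linarith
    refine ⟨t * b - 2 * a * δ * s * t + a * δ * ℓ ^ k * t ^ 2, ?_⟩
    have e : ℓ ^ (k + 1) * t - ℓ ^ (k + 1) * t * (a * (2 * δ * y0) + b * ℓ) = 0 := by
      rw [hab]; ring
    rw [hz']
    linear_combination e

/-- The matrix with rows `(1, w, …, w^(k-1), z)`. -/
def interpMatrix {R : Type*} [CommRing R] (k : ℕ) (w z : Fin (k + 1) → R) :
    Matrix (Fin (k + 1)) (Fin (k + 1)) R :=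
  fun i => Fin.snoc (fun j : Fin k => w i ^ (j : ℕ)) (z i)

lemma pow_dvd_det_interpMatrix (k : ℕ) (ℓ : ℤ) (v t : Fin (k + 1) → ℤ) (h : ℕ → ℤ)
    (w z : Fin (k + 1) → ℤ) (hw : ∀ i, w i = ℓ * v i)
    (hz : ∀ i, z i = (∑ a : Fin k, h a * w i ^ (a : ℕ)) + ℓ ^ k * t i) :
    ℓ ^ (∑ a : Fin (k + 1), (a : ℕ)) ∣ (interpMatrix k w z).det := by
  let U : Matrix (Fin (k + 1)) (Fin (k + 1)) ℤ := fun a =>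
    Fin.snoc (fun b : Fin k => if a = b.castSucc then ℓ ^ (a : ℕ) else 0)
      ((Fin.snoc (fun a : Fin k => h a * ℓ ^ (a : ℕ)) (ℓ ^ k) : Fin (k + 1) → ℤ) a)
  have hM : interpMatrix k w z = interpMatrix k v t * U := by
    ext i j
    rw [Matrix.mul_apply, Fin.sum_univ_castSucc]
    refine Fin.lastCases ?_ (fun j => ?_) j
    · simp only [interpMatrix, U, Fin.snoc_last, Fin.snoc_castSucc]
      rw [hz i, mul_comm (t i)]
      congr 1
      refine Finset.sum_congr rfl fun a _ => ?_
      rw [hw, mul_pow]; ring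
    · simp only [interpMatrix, U, Fin.snoc_last, Fin.snoc_castSucc]
      rw [Finset.sum_eq_single j]
      · simp [hw, mul_pow, mul_comm, (Fin.castSucc_lt_last j).ne']
      · intro b _ hb
        simp [hb]
      · simp
  rw [hM, Matrix.det_mul, Matrix.det_of_isUpperTriangular (M := U)]
  · refine Dvd.dvd.mul_left ?_ _
    rw [← Finset.prod_pow_eq_pow_sum]
    refine (Finset.prod_congr rfl fun a _ => ?_).dvd
    refine Fin.lastCases ?_ (fun a => ?_) a
    · simp [U]
    · simp [U]
  · intro a b hab
    have hb : b ≠ Fin.last k := fun h => by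
      subst h; exact absurd (Fin.le_last a) (not_le.mpr hab)
    obtain ⟨b, rfl⟩ := Fin.exists_castSucc_eq.mpr hb
    simp only [U, Fin.snoc_castSucc]
    rw [if_neg]
    exact fun h => by subst h; exact lt_irrefl _ hab

lemma abs_det_interpMatrix_le (k : ℕ) (w z : Fin (k + 1) → ℤ) (R Z : ℤ)
    (hw : ∀ i, |w i| ≤ R) (hz : ∀ i, |z i| ≤ Z) :
    |(interpMatrix k w z).det| ≤
      ((k + 1).factorial : ℤ) * (R ^ (∑ a : Fin k, (a : ℕ)) * Z) := by
  rw [Matrix.det_apply]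
  refine (Finset.abs_sum_le_sum_abs _ _).trans ?_
  have : ∀ σ ∈ (Finset.univ : Finset (Equiv.Perm (Fin (k + 1)))),
      |Equiv.Perm.sign σ • ∏ i, interpMatrix k w z (σ i) i| ≤ R ^ (∑ a : Fin k, (a : ℕ)) * Z := by
    intro σ _
    have h1 : |Equiv.Perm.sign σ • ∏ i, interpMatrix k w z (σ i) i| =
        |∏ i, interpMatrix k w z (σ i) i| := by
      rcases Int.units_eq_one_or (Equiv.Perm.sign σ) with h | h <;> simp [h]
    rw [h1, Finset.abs_prod, Fin.prod_univ_castSucc]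
    have hZ : 0 ≤ Z := (abs_nonneg _).trans (hz 0)
    have hR : 0 ≤ R := (abs_nonneg _).trans (hw 0)
    refine mul_le_mul ?_ ?_ (abs_nonneg _) (by positivity)
    · rw [← Finset.prod_pow_eq_pow_sum]
      refine Finset.prod_le_prod (fun _ _ => abs_nonneg _) fun i _ => ?_
      simp only [interpMatrix, Fin.snoc_castSucc, abs_pow]
      exact pow_le_pow_left₀ (abs_nonneg _) (hw _) _
    · simpa [interpMatrix] using hz _
  refine (Finset.sum_le_card_nsmul _ _ _ this).trans (le_of_eq ?_)
  simp [Finset.card_univ, Fintype.card_perm]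

open Polynomial in
/-- A degenerate interpolation matrix at distinct nodes comes from a polynomial of degree `< k`. -/
lemma exists_poly_of_det_interpMatrix_eq_zero (k : ℕ) (w z : Fin (k + 1) → ℚ)
    (hinj : Function.Injective w) (hdet : (interpMatrix k w z).det = 0) :
    ∃ I : ℚ[X], I.degree < k ∧ ∀ i, I.eval (w i) = z i := by
  obtain ⟨c, hc0, hc⟩ := Matrix.exists_mulVec_eq_zero_iff.mpr hdet
  have key : ∀ i, (∑ j : Fin k, w i ^ (j : ℕ) * c j.castSucc) + z i * c (Fin.last k) = 0 := by
    intro i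
    have := congrFun hc i
    rw [Matrix.mulVec, dotProduct, Fin.sum_univ_castSucc] at this
    simpa [interpMatrix] using this
  let J : ℚ[X] := ∑ j : Fin k, C (c j.castSucc) * X ^ (j : ℕ)
  have hJd : J.degree < k := by
    refine (Polynomial.degree_sum_le _ _).trans_lt ?_
    rw [Finset.sup_lt_iff (by exact WithBot.bot_lt_coe k)]
    intro j _
    refine (degree_C_mul_X_pow_le _ _).trans_lt ?_
    exact_mod_cast j.2
  have hJe : ∀ i, J.eval (w i) = - (z i * c (Fin.last k)) := by
    intro i
    have := key i
    simp only [J, eval_finsetSum, eval_mul, eval_C, eval_pow, eval_X]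
    rw [← add_eq_zero_iff_eq_neg, ← this]
    congr 1
    exact Finset.sum_congr rfl fun j _ => mul_comm _ _
  have hlast : c (Fin.last k) ≠ 0 := by
    intro h0
    have hJ0 : J = 0 := by
      refine Polynomial.eq_zero_of_degree_lt_of_eval_index_eq_zero Finset.univ
        hinj.injOn ?_ fun i _ => by simp [hJe, h0]
      refine hJd.trans ?_
      simp only [Finset.card_univ, Fintype.card_fin]
      exact_mod_cast Nat.lt_succ_self k
    apply hc0
    ext j
    refine Fin.lastCases h0 (fun j => ?_) j
    have := congrArg (fun q : ℚ[X] => q.coeff j) hJ0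
    simpa [J, Polynomial.finsetSum_coeff, Polynomial.coeff_C_mul, Polynomial.coeff_X_pow,
      Fin.val_inj, eq_comm] using this
  refine ⟨C (-(c (Fin.last k))⁻¹) * J, ?_, fun i => ?_⟩
  · rw [degree_C_mul (by simpa using hlast)]
    exact hJd
  · rw [eval_mul, eval_C, hJe]
    field_simp

lemma interpMatrix_map (k : ℕ) (w z : Fin (k + 1) → ℤ) :
    (interpMatrix k w z).map (Int.castRingHom ℚ) =
      interpMatrix k (fun i => (w i : ℚ)) (fun i => (z i : ℚ)) := by
  ext i j
  refine Fin.lastCases ?_ (fun j => ?_) j <;> simp [interpMatrix]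

open Polynomial in
/-- A residue class modulo `ℓ` contains at most `2k` solutions of `δ z² = G(u)` with `z` in a
fixed nonzero class, unless the curve is degenerate. -/
lemma card_le_of_residue_class {k : ℕ} (hk : 2 ≤ k) {δ y0 ℓ u0 R Z : ℤ} {G : ℤ[X]}
    (hG : G.natDegree ≤ 4) (hc : IsCoprime (2 * δ * y0) ℓ)
    (hbig : ((k + 1).factorial : ℤ) * (R ^ (∑ a : Fin k, (a : ℕ)) * Z) <
      ℓ ^ (∑ a : Fin (k + 1), (a : ℕ)))
    (hnd : ¬ ∃ I : ℚ[X], C (δ : ℚ) * I ^ 2 = G.map (Int.castRingHom ℚ))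
    (U : Finset ℤ) (zf : ℤ → ℤ)
    (hU : ∀ u ∈ U, ℓ ∣ u - u0 ∧ |u - u0| ≤ R ∧ |zf u| ≤ Z ∧ δ * zf u ^ 2 = G.eval u ∧
      ℓ ∣ zf u - y0) :
    U.card ≤ 2 * k := by
  by_contra! hcard
  obtain ⟨k', rfl⟩ : ∃ k', k = k' + 1 := ⟨k - 1, by omega⟩
  set k := k' + 1 with hkdef
  obtain ⟨h, hh⟩ := exists_poly_approx_sqrt (G := G) hc k'
  have hdet : ∀ e : Fin (k + 1) → ℤ, (∀ i, e i ∈ U) →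
      (interpMatrix k (fun i => ((e i - u0 : ℤ) : ℚ)) (fun i => ((zf (e i) : ℤ) : ℚ))).det = 0 := by
    intro e he
    have h0 : (interpMatrix k (fun i => e i - u0) (fun i => zf (e i))).det = 0 := by
      set h' := h.comp (X + C u0) with hh'
      have hmon : (X ^ k : ℤ[X]).Monic := monic_X_pow k
      have hdiv : ℓ ^ (∑ a : Fin (k + 1), (a : ℕ)) ∣
          (interpMatrix k (fun i => e i - u0) (fun i => zf (e i))).det := by
        have hv : ∀ i, ∃ v, e i - u0 = ℓ * v := fun i => (hU _ (he i)).1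
        choose v hv using hv
        have ht : ∀ i, ∃ t, zf (e i) - h.eval (e i) = ℓ ^ k * t := fun i =>
          hh _ _ (hU _ (he i)).2.2.2.1 (hU _ (he i)).2.2.2.2
        choose t ht using ht
        refine pow_dvd_det_interpMatrix k ℓ v
          (fun i => t i + v i ^ k * (h' /ₘ X ^ k).eval (e i - u0))
          (fun a => (h' %ₘ X ^ k).coeff a) _ _ hv fun i => ?_
        have e1 : h.eval (e i) = h'.eval (e i - u0) := by simp [hh']
        have e2 : h'.eval (e i - u0) = (h' %ₘ X ^ k).eval (e i - u0) +
            (e i - u0) ^ k * (h' /ₘ X ^ k).eval (e i - u0) := by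
          conv_lhs => rw [← modByMonic_add_div h' (X ^ k)]
          simp
        have e3 : (h' %ₘ X ^ k).eval (e i - u0) =
            ∑ a : Fin k, (h' %ₘ X ^ k).coeff a * (e i - u0) ^ (a : ℕ) := by
          rw [eval_eq_sum_range' (n := k), Finset.sum_range]
          have hne : (X ^ k : ℤ[X]) ≠ 1 := fun h1 => by
            have := congrArg natDegree h1
            simp [hkdef] at this
          have := natDegree_modByMonic_lt h' hmon hne
          simpa using this
        have := ht i
        rw [← e3]
        have e4 : (e i - u0) ^ k = ℓ ^ k * v i ^ k := by rw [hv i, mul_pow]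
        rw [e1, e2, e4] at this
        linear_combination this
      refine Int.eq_zero_of_abs_lt_dvd hdiv ?_
      refine (abs_det_interpMatrix_le k _ _ R Z (fun i => (hU _ (he i)).2.1)
        fun i => (hU _ (he i)).2.2.1).trans_lt hbig
    have := congrArg (Int.castRingHom ℚ) h0
    rw [RingHom.map_det, RingHom.mapMatrix_apply, interpMatrix_map, map_zero] at this
    exact this
  obtain ⟨U0, hU0, hU0c⟩ := Finset.exists_subset_card_eq (s := U) (n := k) (by omega)
  let e0 := U0.equivFinOfCardEq hU0c
  have hext : ∀ u ∈ U \ U0, ∃ I : ℚ[X], I.degree < k ∧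
      (∀ a ∈ U0, I.eval ((a - u0 : ℤ) : ℚ) = zf a) ∧ I.eval ((u - u0 : ℤ) : ℚ) = zf u := by
    intro u hu
    rw [Finset.mem_sdiff] at hu
    let e : Fin (k + 1) → ℤ := Fin.snoc (fun i => (e0.symm i : ℤ)) u
    have heU : ∀ i, e i ∈ U := by
      intro i
      refine Fin.lastCases ?_ (fun i => ?_) i
      · simpa [e] using hu.1
      · simpa [e] using hU0 (e0.symm i).2
    have hinj : Function.Injective e := by
      refine Fin.snoc_injective_iff.mpr ⟨?_, ?_⟩
      · intro i j hij
        exact e0.symm.injective (Subtype.ext hij)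
      · rintro ⟨i, hi⟩
        exact hu.2 (hi ▸ (e0.symm i).2)
    obtain ⟨I, hI, hIe⟩ := exists_poly_of_det_interpMatrix_eq_zero k _ _
      (fun i j hij => by
        have : (e i - u0 : ℤ) = e j - u0 := by exact_mod_cast hij
        exact hinj (by linarith)) (hdet e heU)
    refine ⟨I, hI, fun a ha => ?_, ?_⟩
    · have := hIe (e0 ⟨a, ha⟩).castSucc
      simpa [e] using this
    · have := hIe (Fin.last k)
      simpa [e] using this
  have hne : (U \ U0).Nonempty := by
    rw [← Finset.card_pos, Finset.card_sdiff_of_subset hU0]; omega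
  obtain ⟨us, hus⟩ := hne
  obtain ⟨I, hI, hI0, hIs⟩ := hext us hus
  have hIall : ∀ u ∈ U, I.eval ((u - u0 : ℤ) : ℚ) = zf u := by
    intro u hu
    by_cases hu0 : u ∈ U0
    · exact hI0 u hu0
    · obtain ⟨J, hJ, hJ0, hJu⟩ := hext u (by simp [hu, hu0])
      have : I = J := by
        refine Polynomial.eq_of_degrees_lt_of_eval_index_eq U0 (v := fun a => ((a - u0 : ℤ) : ℚ))
          ?_ (by rwa [hU0c]) (by rwa [hU0c]) fun a ha => by rw [hI0 a ha, hJ0 a ha]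
        intro a _ b _ hab
        have hab : ((a - u0 : ℤ) : ℚ) = ((b - u0 : ℤ) : ℚ) := hab
        have : (a - u0 : ℤ) = b - u0 := by exact_mod_cast hab
        linarith
      rw [this, hJu]
  apply hnd
  have hF : C (δ : ℚ) * I ^ 2 - (G.map (Int.castRingHom ℚ)).comp (X + C (u0 : ℚ)) = 0 := by
    refine Polynomial.eq_zero_of_degree_lt_of_eval_index_eq_zero U
      (v := fun a => ((a - u0 : ℤ) : ℚ)) ?_ ?_ fun a ha => ?_
    · intro a _ b _ hab
      have hab : ((a - u0 : ℤ) : ℚ) = ((b - u0 : ℤ) : ℚ) := hab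
      have : (a - u0 : ℤ) = b - u0 := by exact_mod_cast hab
      linarith
    · have hdI : I.natDegree ≤ k - 1 := by
        rcases eq_or_ne I 0 with h0 | h0
        · simp [h0]
        · have := (Polynomial.natDegree_lt_iff_degree_lt h0).mpr hI
          omega
      have : (C (δ : ℚ) * I ^ 2 - (G.map (Int.castRingHom ℚ)).comp (X + C (u0 : ℚ))).natDegree
          ≤ 2 * k := by
        refine (natDegree_sub_le _ _).trans (max_le ?_ ?_)
        · refine (natDegree_C_mul_le _ _).trans (natDegree_pow_le.trans ?_)
          omega
        · refine natDegree_comp_le.trans ?_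
          have h1 : (G.map (Int.castRingHom ℚ)).natDegree ≤ 4 := natDegree_map_le.trans hG
          have h2 : (X + C (u0 : ℚ)).natDegree = 1 := natDegree_X_add_C _
          rw [h2]; omega
      refine degree_le_natDegree.trans_lt ?_
      exact_mod_cast this.trans_lt hcard
    · have h1 : (G.map (Int.castRingHom ℚ)).eval (a : ℚ) = ((G.eval a : ℤ) : ℚ) := by
        simp
      simp only [eval_sub, eval_mul, eval_C, eval_pow, hIall a ha, eval_comp, eval_add, eval_X]
      rw [Int.cast_sub, sub_add_cancel, h1, ← (hU a ha).2.2.2.1]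
      push_cast; ring
  refine ⟨I.comp (X - C (u0 : ℚ)), ?_⟩
  have := congrArg (fun q => q.comp (X - C (u0 : ℚ))) (sub_eq_zero.mp hF)
  simpa [comp_assoc] using this

/-- A variant of Bertrand's postulate avoiding the prime divisors of a given number. -/
lemma exists_prime_not_dvd (r : ℕ) : ∀ M Z : ℕ, 0 < Z → 0 < M → M < Z ^ r →
    ∃ ℓ : ℕ, ℓ.Prime ∧ Z < ℓ ∧ ℓ ≤ 2 ^ r * Z ∧ ¬ ℓ ∣ M := by
  induction r with
  | zero => intro M Z _ hM h; simp at h; omega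
  | succ r ih =>
    intro M Z hZ hM h
    obtain ⟨ℓ, hℓ, h1, h2⟩ := Nat.exists_prime_lt_and_le_two_mul Z hZ.ne'
    have h2r : 1 ≤ 2 ^ r := Nat.one_le_two_pow
    by_cases hd : ℓ ∣ M
    · obtain ⟨M', rfl⟩ := hd
      have hM' : M' < Z ^ r := by
        by_contra! hcon
        have : Z ^ (r + 1) ≤ ℓ * M' := by
          rw [pow_succ, mul_comm]; exact Nat.mul_le_mul h1.le hcon
        omega
      obtain ⟨m, hm, h3, h4, h5⟩ := ih M' (2 * Z) (by omega) (Nat.pos_of_mul_pos_left hM)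
        (hM'.trans_le (Nat.pow_le_pow_left (by omega) r))
      refine ⟨m, hm, by omega, by rw [pow_succ, mul_assoc]; exact h4, fun hdm => ?_⟩
      rcases (Nat.Prime.dvd_mul hm).mp hdm with h6 | h6
      · have := (Nat.prime_dvd_prime_iff_eq hm hℓ).mp h6
        omega
      · exact h5 h6
    · refine ⟨ℓ, hℓ, h1, h2.trans ?_, hd⟩
      rw [pow_succ]; nlinarith

lemma card_filter_residue_le {N ℓ : ℕ} (hℓ : 0 < ℓ) (U : Finset ℤ)
    (hU : ∀ u ∈ U, 0 ≤ u ∧ u < N) (hUU : ∀ u ∈ U, ∀ v ∈ U, (ℓ : ℤ) ∣ u - v) :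
    U.card ≤ N / ℓ + 1 := by
  rw [← Finset.card_range (N / ℓ + 1)]
  have hℓ' : (0 : ℤ) < ℓ := by exact_mod_cast hℓ
  refine Finset.card_le_card_of_injOn (fun u => (u / ℓ).toNat) (fun u hu => ?_) ?_
  · obtain ⟨h0, h1⟩ := hU u hu
    simp only [Finset.coe_range, Set.mem_Iio]
    have h2 : u / ℓ ≤ N / ℓ := Int.ediv_le_ediv hℓ' h1.le
    have h3 : 0 ≤ u / ℓ := Int.ediv_nonneg h0 hℓ'.le
    rw [Nat.lt_add_one_iff]
    have : ((u / ℓ).toNat : ℤ) ≤ ((N / ℓ : ℕ) : ℤ) := by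
      rw [Int.toNat_of_nonneg h3]; exact_mod_cast h2
    exact_mod_cast this
  · intro u hu v hv huv
    have h3 : 0 ≤ u / ℓ := Int.ediv_nonneg (hU u hu).1 hℓ'.le
    have h4 : 0 ≤ v / ℓ := Int.ediv_nonneg (hU v hv).1 hℓ'.le
    have h5 : u / ℓ = v / ℓ := by
      have : (u / ℓ).toNat = (v / ℓ).toNat := huv
      omega
    have h6 : u % ℓ = v % ℓ := Int.emod_eq_emod_iff_emod_sub_eq_zero.mpr
      (Int.emod_eq_zero_of_dvd (hUU u hu v hv))
    rw [← Int.emod_add_mul_ediv u ℓ, ← Int.emod_add_mul_ediv v ℓ, h5, h6]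

open Polynomial in
lemma card_solutions_le {k : ℕ} (hk : 2 ≤ k) {δ Z : ℤ} {N ℓ : ℕ} {G : ℤ[X]}
    (hG : G.natDegree ≤ 4) (hℓ : ℓ.Prime) (hδ : ¬ (ℓ : ℤ) ∣ 2 * δ)
    (hcoef : ∃ i, ¬ (ℓ : ℤ) ∣ G.coeff i)
    (hbig : ((k + 1).factorial : ℤ) * ((N : ℤ) ^ (∑ a : Fin k, (a : ℕ)) * Z) <
      (ℓ : ℤ) ^ (∑ a : Fin (k + 1), (a : ℕ)))
    (hnd : ¬ ∃ I : ℚ[X], C (δ : ℚ) * I ^ 2 = G.map (Int.castRingHom ℚ))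
    (U : Finset ℤ) (hUN : ∀ u ∈ U, 0 ≤ u ∧ u < N)
    (hU : ∀ u ∈ U, ∃ z : ℤ, |z| ≤ Z ∧ δ * z ^ 2 = G.eval u) :
    U.card ≤ 2 * k * ℓ + (N / ℓ + 1) * 4 := by
  classical
  have : Fact ℓ.Prime := ⟨hℓ⟩
  choose! zf hz1 hz2 using hU
  have hres : ∀ u v : ℤ, ((u : ZMod ℓ) = v) ↔ (ℓ : ℤ) ∣ u - v := fun u v => by
    rw [← sub_eq_zero, ← Int.cast_sub, ZMod.intCast_zmod_eq_zero_iff_dvd]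
  have hpi : Prime (ℓ : ℤ) := Nat.prime_iff_prime_int.mp hℓ
  rw [← Finset.card_filter_add_card_filter_not (s := U) (fun u => ¬ (ℓ : ℤ) ∣ zf u)]
  refine add_le_add ?_ ?_
  · refine (Finset.card_le_mul_card_image (f := fun u : ℤ => (u : ZMod ℓ)) _ (2 * k) ?_).trans ?_
    · intro a ha
      obtain ⟨u0, hu0, rfl⟩ := Finset.mem_image.mp ha
      rw [Finset.mem_filter] at hu0
      have hflip : ∀ u ∈ U, (ℓ : ℤ) ∣ u - u0 → (ℓ : ℤ) ∣ zf u - zf u0 ∨ (ℓ : ℤ) ∣ zf u + zf u0 := by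
        intro u hu hd
        have h1 : (ℓ : ℤ) ∣ G.eval u - G.eval u0 := hd.trans (sub_dvd_eval_sub u u0 G)
        rw [← hz2 u hu, ← hz2 u0 hu0.1] at h1
        have h2 : (ℓ : ℤ) ∣ δ * ((zf u - zf u0) * (zf u + zf u0)) := by
          convert h1 using 1; ring
        rcases hpi.dvd_or_dvd h2 with h3 | h3
        · exact absurd (h3.mul_left 2) hδ
        · exact hpi.dvd_or_dvd h3
      refine card_le_of_residue_class (δ := δ) (y0 := zf u0) (ℓ := ℓ) (u0 := u0) (R := N) (Z := Z)
        hk hG ?_ hbig hnd _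
        (fun u => if (ℓ : ℤ) ∣ zf u - zf u0 then zf u else - zf u) ?_
      · rw [isCoprime_comm, Prime.coprime_iff_not_dvd hpi]
        intro hd
        rcases hpi.dvd_or_dvd hd with h | h
        · exact hδ h
        · exact hu0.2 h
      · intro u hu
        simp only [Finset.mem_filter] at hu
        obtain ⟨⟨hu1, hu2⟩, hu3⟩ := hu
        have hd := (hres u u0).mp hu3
        refine ⟨hd, ?_, ?_, ?_, ?_⟩
        · have := hUN u hu1; have := hUN u0 hu0.1
          rw [abs_le]; constructor <;> linarith
        · split_ifs
          · exact hz1 u hu1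
          · rw [abs_neg]; exact hz1 u hu1
        · split_ifs
          · exact hz2 u hu1
          · rw [neg_sq]; exact hz2 u hu1
        · split_ifs with h
          · exact h
          · have := ((hflip u hu1 hd).resolve_left h).neg_right
            rwa [neg_add'] at this
    · refine Nat.mul_le_mul_left _ ((Finset.card_le_univ _).trans ?_)
      rw [ZMod.card]
  · refine (Finset.card_le_mul_card_image (f := fun u : ℤ => (u : ZMod ℓ)) _ (N / ℓ + 1) ?_).trans
      (Nat.mul_le_mul_left _ ?_)
    · intro a ha
      refine card_filter_residue_le hℓ.pos _ (fun u hu => ?_) fun u hu v hv => ?_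
      · simp only [Finset.mem_filter] at hu
        exact hUN u hu.1.1
      · simp only [Finset.mem_filter] at hu hv
        rw [← hres, hu.2, hv.2]
    · have hG0 : G.map (Int.castRingHom (ZMod ℓ)) ≠ 0 := by
        obtain ⟨i, hi⟩ := hcoef
        intro h0
        apply hi
        have := congrArg (fun q => q.coeff i) h0
        simpa [ZMod.intCast_zmod_eq_zero_iff_dvd] using this
      refine (Finset.card_le_card (t := (G.map (Int.castRingHom (ZMod ℓ))).roots.toFinset) ?_).trans
        ((Multiset.toFinset_card_le _).trans ((card_roots' _).trans (natDegree_map_le.trans hG)))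
      intro a ha
      obtain ⟨u, hu, rfl⟩ := Finset.mem_image.mp ha
      simp only [Finset.mem_filter, not_not] at hu
      rw [Multiset.mem_toFinset, mem_roots hG0, IsRoot.def]
      have h1 : (G.map (Int.castRingHom (ZMod ℓ))).eval (u : ZMod ℓ) = ((G.eval u : ℤ) : ZMod ℓ) := by
        simp
      rw [h1, ← hz2 u hu.1, ZMod.intCast_zmod_eq_zero_iff_dvd]
      exact (hu.2.pow two_ne_zero).mul_left δ

open Polynomial in
/-- A Bombieri–Pila type bound: outside of degenerate curves, `δ z² = G(u)` has at most
`O(N^(k/(k+1)))` solutions with `0 ≤ u < N`, uniformly for coefficients of polynomial size. -/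
lemma card_solutions_rpow_le (K : ℕ) (δ : ℤ) (hδ : 0 < δ) :
    ∃ Cst : ℝ, 0 < Cst ∧ ∀ N : ℕ, 1 ≤ N → ∀ G : ℤ[X], G.natDegree ≤ 4 →
      (∀ i, |G.coeff i| ≤ (N : ℤ) ^ K) →
      (¬ ∃ I : ℚ[X], C (δ : ℚ) * I ^ 2 = G.map (Int.castRingHom ℚ)) →
      ∀ U : Finset ℤ, (∀ u ∈ U, 0 ≤ u ∧ u < N) →
        (∀ u ∈ U, ∃ z : ℤ, |z| ≤ (N : ℤ) ^ K ∧ δ * z ^ 2 = G.eval u) →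
        (U.card : ℝ) ≤ Cst * (N : ℝ) ^ (((2 * K + 2 : ℕ) : ℝ) / ((2 * K + 2 : ℕ) + 1)) := by
  set k := 2 * K + 2 with hk
  set θ : ℝ := (k : ℝ) / (k + 1) with hθ
  have hθ0 : 0 ≤ θ := by positivity
  set N0 : ℕ := (k + 1).factorial + (2 * δ).toNat + 2 with hN0
  refine ⟨N0 + (4 * k * 2 ^ (2 * k) + 8), by positivity, ?_⟩
  intro N hN G hG hcoef hnd U hUN hU
  have hNθ : (1 : ℝ) ≤ (N : ℝ) ^ θ := Real.one_le_rpow (by exact_mod_cast hN) hθ0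
  have hN' : (0 : ℝ) < N := by exact_mod_cast hN
  by_cases hsmall : N < N0
  · have h1 : U.card ≤ N := by
      have : U ⊆ Finset.Ico (0 : ℤ) N := fun u hu => Finset.mem_Ico.mpr (hUN u hu)
      simpa using Finset.card_le_card this
    have h2 : (U.card : ℝ) ≤ N0 := by exact_mod_cast h1.trans hsmall.le
    refine h2.trans ?_
    have h3 : (N0 : ℝ) ≤ N0 * (N : ℝ) ^ θ := le_mul_of_one_le_right (by positivity) hNθ
    refine h3.trans ?_
    gcongr
    exact le_add_of_nonneg_right (by positivity)
  rw [not_lt] at hsmall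
  have hG0 : G ≠ 0 := fun h => hnd ⟨0, by simp [h]⟩
  have hlead : G.leadingCoeff ≠ 0 := leadingCoeff_ne_zero.mpr hG0
  set Z := ⌈(N : ℝ) ^ θ⌉₊ with hZ
  have hZ1 : (N : ℝ) ^ θ ≤ Z := Nat.le_ceil _
  have hZ2 : (Z : ℝ) ≤ 2 * (N : ℝ) ^ θ := by
    have := Nat.ceil_lt_add_one (a := (N : ℝ) ^ θ) (by positivity)
    linarith
  have hZpow : N ^ k ≤ Z ^ (k + 1) := by
    have h1 : ((N : ℝ) ^ θ) ^ (k + 1) ≤ (Z : ℝ) ^ (k + 1) := by gcongr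
    rw [← Real.rpow_natCast, ← Real.rpow_mul hN'.le] at h1
    have h2 : θ * ((k + 1 : ℕ) : ℝ) = (k : ℕ) := by
      rw [hθ]; push_cast; field_simp
    rw [h2, Real.rpow_natCast] at h1
    exact_mod_cast h1
  have hZpos : 0 < Z := by
    have : (0 : ℝ) < Z := by linarith
    exact_mod_cast this
  set M : ℕ := (2 * δ * G.leadingCoeff).natAbs with hM
  have hMpos : 0 < M := Int.natAbs_pos.mpr (by positivity)
  have hMlt : M < Z ^ (2 * k) := by
    have h1 : (M : ℤ) ≤ 2 * δ * (N : ℤ) ^ K := by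
      rw [hM, Int.natCast_natAbs, abs_mul, abs_of_pos (by positivity : 0 < 2 * δ)]
      exact mul_le_mul_of_nonneg_left (hcoef _) (by positivity)
    have h2 : 2 * δ < (N : ℤ) := by
      have : ((2 * δ).toNat : ℤ) = 2 * δ := Int.toNat_of_nonneg (by positivity)
      have : (N0 : ℤ) ≤ N := by exact_mod_cast hsmall
      omega
    have h3 : (M : ℤ) < (N : ℤ) ^ (K + 1) := by
      refine h1.trans_lt ?_
      rw [pow_succ']
      exact mul_lt_mul_of_pos_right h2 (by positivity)
    have h4 : M < N ^ (K + 1) := by exact_mod_cast h3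
    calc M < N ^ (K + 1) := h4
      _ ≤ N ^ k := Nat.pow_le_pow_right hN (by omega)
      _ ≤ Z ^ (k + 1) := hZpow
      _ ≤ Z ^ (2 * k) := Nat.pow_le_pow_right hZpos (by omega)
  obtain ⟨ℓ, hℓ, hℓ1, hℓ2, hℓ3⟩ := exists_prime_not_dvd (2 * k) M Z hZpos hMpos hMlt
  have hℓM : ¬ (ℓ : ℤ) ∣ 2 * δ * G.leadingCoeff := by
    rwa [Int.natCast_dvd]
  have hbig : ((k + 1).factorial : ℤ) * ((N : ℤ) ^ (∑ a : Fin k, (a : ℕ)) * (N : ℤ) ^ K) <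
      (ℓ : ℤ) ^ (∑ a : Fin (k + 1), (a : ℕ)) := by
    have s1 : ∑ a : Fin k, (a : ℕ) = (K + 1) * (2 * K + 1) := by
      rw [← Finset.sum_range (fun a => a), Finset.sum_range_id, hk]
      exact Nat.div_eq_of_eq_mul_left two_pos (by rw [show 2 * K + 2 - 1 = 2 * K + 1 by omega]; ring)
    have s2 : ∑ a : Fin (k + 1), (a : ℕ) = (k + 1) * (K + 1) := by
      rw [← Finset.sum_range (fun a => a), Finset.sum_range_id, hk]
      exact Nat.div_eq_of_eq_mul_left two_pos
        (by rw [show 2 * K + 2 + 1 - 1 = 2 * K + 2 by omega]; ring)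
    rw [s1, s2]
    have h1 : (k + 1).factorial * (N ^ ((K + 1) * (2 * K + 1)) * N ^ K) <
        ℓ ^ ((k + 1) * (K + 1)) := by
      calc (k + 1).factorial * (N ^ ((K + 1) * (2 * K + 1)) * N ^ K)
          < N * (N ^ ((K + 1) * (2 * K + 1)) * N ^ K) :=
            Nat.mul_lt_mul_of_pos_right (by omega) (by positivity)
        _ = (N ^ k) ^ (K + 1) := by rw [hk]; ring
        _ ≤ (Z ^ (k + 1)) ^ (K + 1) := Nat.pow_le_pow_left hZpow _
        _ ≤ (ℓ ^ (k + 1)) ^ (K + 1) :=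
            Nat.pow_le_pow_left (Nat.pow_le_pow_left hℓ1.le _) _
        _ = ℓ ^ ((k + 1) * (K + 1)) := (pow_mul _ _ _).symm
    exact_mod_cast h1
  have hmain := card_solutions_le (k := k) (by omega) hG hℓ (fun h => hℓM (h.mul_right _))
    ⟨G.natDegree, fun h => hℓM (h.mul_left _)⟩ hbig hnd U hUN hU
  have hℓr : (ℓ : ℝ) ≤ 2 ^ (2 * k) * (2 * (N : ℝ) ^ θ) := by
    have : (ℓ : ℝ) ≤ 2 ^ (2 * k) * (Z : ℝ) := by exact_mod_cast hℓ2
    refine this.trans ?_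
    gcongr
  have hNℓ : ((N / ℓ : ℕ) : ℝ) ≤ (N : ℝ) ^ θ := by
    have hℓpos : (0 : ℝ) < ℓ := by exact_mod_cast hℓ.pos
    refine Nat.cast_div_le.trans ?_
    rw [div_le_iff₀ hℓpos]
    have h1 : (N : ℝ) ^ θ ≤ ℓ := hZ1.trans (by exact_mod_cast hℓ1.le)
    have h2 : (N : ℝ) ≤ (N : ℝ) ^ θ * (N : ℝ) ^ θ := by
      rw [← Real.rpow_add hN']
      conv_lhs => rw [← Real.rpow_one (N : ℝ)]
      refine Real.rpow_le_rpow_of_exponent_le (by exact_mod_cast hN) ?_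
      rw [hθ, ← add_div, le_div_iff₀ (by positivity)]
      have : (2 : ℝ) ≤ k := by rw [hk]; push_cast; linarith [Nat.cast_nonneg (α := ℝ) K]
      linarith
    exact h2.trans (mul_le_mul_of_nonneg_left h1 (by positivity))
  have h3 : (U.card : ℝ) ≤ 2 * k * ℓ + ((N / ℓ : ℕ) + 1) * 4 := by exact_mod_cast hmain
  have h4 : (2 * k * ℓ : ℝ) ≤ 2 * k * (2 ^ (2 * k) * (2 * (N : ℝ) ^ θ)) := by gcongr
  have h5 : (0 : ℝ) ≤ N0 * (N : ℝ) ^ θ := by positivity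
  rw [add_mul]
  nlinarith

/-- Averaging over progressions `x - i • V x`. -/
lemma card_mul_le_of_progressions {α : Type*} [AddCommGroup α] [DecidableEq α]
    {S S' : Finset α} (V : α → α) (N T : ℕ)
    (h1 : ∀ x ∈ S, ∀ i < N, x - i • V x ∈ S' ∧ V (x - i • V x) = V x)
    (h2 : ∀ y ∈ S', ((Finset.range N).filter fun i => y + i • V y ∈ S).card ≤ T) :
    S.card * N ≤ S'.card * T := by
  calc S.card * N = (S ×ˢ Finset.range N).card := by simp
    _ ≤ (S'.sigma fun y => (Finset.range N).filter fun i => y + i • V y ∈ S).card := by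
      refine Finset.card_le_card_of_injOn (fun a => ⟨a.1 - a.2 • V a.1, a.2⟩) ?_ ?_
      · rintro ⟨x, i⟩ hx
        simp only [Finset.coe_product, Set.mem_prod, Finset.mem_coe, Finset.mem_range] at hx
        obtain ⟨h3, h4⟩ := h1 x hx.1 i hx.2
        simp [h3, h4, hx.1, hx.2]
      · rintro ⟨x, i⟩ hx ⟨y, j⟩ hy hxy
        simp only [Finset.coe_product, Set.mem_prod, Finset.mem_coe, Finset.mem_range] at hx hy
        simp only [Sigma.mk.injEq, heq_eq_eq] at hxy
        obtain ⟨h3, rfl⟩ := hxy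
        have h5 : V x = V y := by rw [← (h1 x hx.1 i hx.2).2, ← (h1 y hy.1 i hy.2).2, h3]
        rw [h5] at h3
        exact Prod.ext (sub_left_injective h3) rfl
    _ = ∑ y ∈ S', ((Finset.range N).filter fun i => y + i • V y ∈ S).card := Finset.card_sigma _ _
    _ ≤ S'.card * T := Finset.sum_le_card_nsmul _ _ _ h2

/-- An interval of integers contains few members of a residue class. -/
lemma card_le_of_congr {m M : ℕ} (hm : 0 < m) (U : Finset ℤ) (hU : ∀ u ∈ U, |u| ≤ M)
    (hUU : ∀ u ∈ U, ∀ v ∈ U, (m : ℤ) ∣ u - v) : U.card ≤ 2 * (M / m) + 2 := by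
  have hm' : (0 : ℤ) < m := by exact_mod_cast hm
  have : (Finset.Icc (-((M / m : ℕ) : ℤ) - 1) (M / m : ℕ)).card = 2 * (M / m) + 2 := by
    rw [Int.card_Icc]; omega
  rw [← this]
  refine Finset.card_le_card_of_injOn (fun u => u / m) (fun u hu => ?_) fun u hu v hv huv => ?_
  · have h := abs_le.mp (hU u hu)
    simp only [Finset.coe_Icc, Set.mem_Icc]
    have e : ((M / m : ℕ) : ℤ) = (M : ℤ) / m := by push_cast; rfl
    constructor
    · have h1 : -(M : ℤ) / m ≤ u / m := Int.ediv_le_ediv hm' h.1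
      have h2 : -((M : ℤ) / m) - 1 ≤ -(M : ℤ) / m := by
        rw [Int.le_ediv_iff_mul_le hm']
        have := Int.lt_ediv_add_one_mul_self (M : ℤ) hm'
        linarith
      rw [e]; exact h2.trans h1
    · rw [e]; exact Int.ediv_le_ediv hm' h.2
  · have h6 : u % m = v % m := Int.emod_eq_emod_iff_emod_sub_eq_zero.mpr
      (Int.emod_eq_zero_of_dvd (hUU u hu v hv))
    have h5 : u / m = v / m := huv
    rw [← Int.emod_add_mul_ediv u m, ← Int.emod_add_mul_ediv v m, h5, h6]

lemma card_le_prod_of_congr {ι : Type*} [Fintype ι] [DecidableEq ι] {m : ℕ} {M : ι → ℕ}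
    (hm : 0 < m) (U : Finset (ι → ℤ))
    (hU : ∀ u ∈ U, ∀ i, |u i| ≤ M i) (hUU : ∀ u ∈ U, ∀ v ∈ U, ∀ i, (m : ℤ) ∣ u i - v i) :
    U.card ≤ ∏ i, (2 * (M i / m) + 2) := by
  classical
  refine (Finset.card_le_card (t := Fintype.piFinset fun i => U.image fun u => u i) ?_).trans ?_
  · intro u hu
    rw [Fintype.mem_piFinset]
    exact fun i => Finset.mem_image_of_mem _ hu
  · rw [Fintype.card_piFinset]
    refine Finset.prod_le_prod' fun i _ => card_le_of_congr hm _ ?_ ?_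
    · simp only [Finset.forall_mem_image]
      exact fun u hu => hU u hu i
    · simp only [Finset.forall_mem_image]
      exact fun u hu v hv => hUU u hu v hv i

lemma card_le_of_residue_map {ι β : Type*} [Fintype ι] [DecidableEq ι] [DecidableEq β] {m : ℕ}
    {M : ι → ℕ} (hm : 0 < m) (U : Finset (ι → ℤ)) (f : (ι → ℤ) → β)
    (hU : ∀ u ∈ U, ∀ i, |u i| ≤ M i)
    (hf : ∀ u ∈ U, ∀ v ∈ U, f u = f v → ∀ i, (m : ℤ) ∣ u i - v i) :
    U.card ≤ (∏ i, (2 * (M i / m) + 2)) * (U.image f).card := by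
  refine Finset.card_le_mul_card_image _ _ fun a _ => card_le_prod_of_congr hm _ ?_ ?_
  · intro u hu
    exact hU u (Finset.mem_filter.mp hu).1
  · intro u hu v hv
    obtain ⟨hu1, hu2⟩ := Finset.mem_filter.mp hu
    obtain ⟨hv1, hv2⟩ := Finset.mem_filter.mp hv
    exact hf u hu1 v hv1 (hu2.trans hv2.symm)

lemma Prime.pow_dvd_or_of_mul {p : ℤ} (hp : Prime p) {s t : ℕ} {x y : ℤ} (h : p ^ (s + t) ∣ x * y) :
    p ^ (s + 1) ∣ x ∨ p ^ t ∣ y := by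
  induction t with
  | zero => right; simp
  | succ t ih =>
    by_cases hx : p ^ (s + 1) ∣ x
    · exact Or.inl hx
    · right
      have h1 := (ih ((pow_dvd_pow p (by omega)).trans h)).resolve_left hx
      obtain ⟨w, rfl⟩ := h1
      have h2 : p ^ (s + 1) ∣ x * w := by
        have : p ^ t * p ^ (s + 1) ∣ p ^ t * (x * w) := by
          rw [← pow_add, show t + (s + 1) = s + (t + 1) by ring,
            show p ^ t * (x * w) = x * (p ^ t * w) by ring]
          exact h
        exact (mul_dvd_mul_iff_left (pow_ne_zero _ hp.ne_zero)).mp this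
      have : p ∣ w := by
        by_contra hw
        exact hx (hp.pow_dvd_of_dvd_mul_right _ hw h2)
      rw [pow_succ]
      exact mul_dvd_mul_left _ this

lemma sq_congr_cases {p : ℕ} (hp : p.Prime) (hp2 : p ≠ 2) {m : ℕ} {d e : ℤ}
    (hd : ¬ (p : ℤ) ∣ d) (h : (p : ℤ) ^ m ∣ d ^ 2 - e ^ 2) :
    (p : ℤ) ^ m ∣ d - e ∨ (p : ℤ) ^ m ∣ d + e := by
  have hpi : Prime (p : ℤ) := Nat.prime_iff_prime_int.mp hp
  have h' : (p : ℤ) ^ m ∣ (d - e) * (d + e) := by rwa [mul_comm, ← sq_sub_sq]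
  have h2 : ¬ (p : ℤ) ∣ 2 := fun h2 => hp2 ((Nat.prime_dvd_prime_iff_eq hp Nat.prime_two).mp
    (by exact_mod_cast h2))
  by_cases h1 : (p : ℤ) ∣ d - e
  · left
    refine hpi.pow_dvd_of_dvd_mul_right _ (fun h3 => ?_) h'
    have : (p : ℤ) ∣ 2 * d := (show d - e + (d + e) = 2 * d by ring) ▸ dvd_add h1 h3
    rcases hpi.dvd_or_dvd this with h4 | h4
    · exact h2 h4
    · exact hd h4
  · exact Or.inr (hpi.pow_dvd_of_dvd_mul_left _ h1 h')

/-- Residues of units whose squares are all congruent. -/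
lemma card_le_two_of_sq_congr {p : ℕ} (hp : p.Prime) (hp2 : p ≠ 2) {m : ℕ} (U : Finset ℤ)
    (hU : ∀ u ∈ U, 0 ≤ u ∧ u < (p : ℤ) ^ m ∧ ¬ (p : ℤ) ∣ u)
    (hUU : ∀ u ∈ U, ∀ v ∈ U, (p : ℤ) ^ m ∣ u ^ 2 - v ^ 2) : U.card ≤ 2 := by
  rcases U.eq_empty_or_nonempty with rfl | ⟨d, hd⟩
  · simp
  · refine (Finset.card_le_card (t := {d, (-d) % (p : ℤ) ^ m}) fun e he => ?_).trans
      Finset.card_le_two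
    obtain ⟨h0, h1, h2⟩ := hU e he
    obtain ⟨h0', h1', -⟩ := hU d hd
    rw [Finset.mem_insert, Finset.mem_singleton]
    rcases sq_congr_cases hp hp2 h2 (hUU e he d hd) with h | h
    · left
      rw [← Int.emod_eq_of_lt h0 h1, ← Int.emod_eq_of_lt h0' h1']
      exact Int.emod_eq_emod_iff_emod_sub_eq_zero.mpr (Int.emod_eq_zero_of_dvd h)
    · right
      rw [← Int.emod_eq_of_lt h0 h1]
      refine Int.emod_eq_emod_iff_emod_sub_eq_zero.mpr (Int.emod_eq_zero_of_dvd ?_)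
      rwa [sub_neg_eq_add]

/-- Vectors of the rank-four lattice. -/
abbrev Vec := Fin 4 → ℤ

/-- The determinant form of signature `(2, 2)`. -/
def nf (x : Vec) : ℤ := 4 * x 0 * x 2 - x 1 ^ 2 + x 3 ^ 2

def bn (x y : Vec) : ℤ := 4 * x 0 * y 2 + 4 * x 2 * y 0 - 2 * x 1 * y 1 + 2 * x 3 * y 3

/-- The form measuring the distance of `(x₀, x₁, x₂)` to the line spanned by `(A, B, C)`. -/
def rf (A B C : ℤ) (x : Vec) : ℤ :=
  (C * x 0 - A * x 2) ^ 2 + (B * x 0 - A * x 1) * (B * x 2 - C * x 1)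

def br (A B C : ℤ) (x y : Vec) : ℤ :=
  2 * (C * x 0 - A * x 2) * (C * y 0 - A * y 2) +
    (B * x 0 - A * x 1) * (B * y 2 - C * y 1) + (B * y 0 - A * y 1) * (B * x 2 - C * x 1)

/-- Polar form of the discriminant, evaluated at `(A, B, C)` and `x`. -/
def tf (A B C : ℤ) (x : Vec) : ℤ := 2 * A * x 2 + 2 * C * x 0 - B * x 1

lemma nf_add_smul (x v : Vec) (u : ℤ) : nf (x + u • v) = nf x + u * bn x v + u ^ 2 * nf v := by
  simp [nf, bn]; ring

lemma rf_add_smul (A B C : ℤ) (x v : Vec) (u : ℤ) :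
    rf A B C (x + u • v) = rf A B C x + u * br A B C x v + u ^ 2 * rf A B C v := by
  simp [rf, br]; ring

lemma four_sq_mul_rf (A B C : ℤ) (x : Vec) :
    4 * A ^ 2 * rf A B C x = (2 * A * (C * x 0 - A * x 2) - B * (B * x 0 - A * x 1)) ^ 2 +
      (4 * A * C - B ^ 2) * (B * x 0 - A * x 1) ^ 2 := by
  simp [rf]; ring

lemma four_rf (A B C : ℤ) (x : Vec) :
    4 * rf A B C x = tf A B C x ^ 2 - (4 * A * C - B ^ 2) * (4 * x 0 * x 2 - x 1 ^ 2) := by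
  simp [rf, tf]; ring

/-- Primitive reduced binary forms whose discriminant is prime to the odd prime `p`. -/
structure ReducedForm (A B C : ℤ) (p : ℕ) : Prop where
  pos : 0 < A
  abs_le : |B| ≤ A
  le : A ≤ C
  primitive : ∃ a b c : ℤ, a * A + b * B + c * C = 1
  prime : p.Prime
  ne_two : p ≠ 2
  not_dvd : ¬ (p : ℤ) ∣ 4 * A * C - B ^ 2

/-- The congruence conditions modulo `P`. -/
structure Adm (A B C P : ℤ) (x : Vec) : Prop where
  h02 : P ∣ C * x 0 - A * x 2
  h01 : P ∣ B * x 0 - A * x 1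
  h21 : P ∣ B * x 2 - C * x 1
  hnf : P ∣ nf x - 4 * (4 * A * C - B ^ 2)

namespace ReducedForm


lemma C_pos {A B C : ℤ} {p : ℕ} (F : ReducedForm A B C p) : 0 < C := F.pos.trans_le F.le

lemma sq_B_le {A B C : ℤ} {p : ℕ} (F : ReducedForm A B C p) : B ^ 2 ≤ A * C := by
  have h1 : B ^ 2 ≤ A ^ 2 := sq_le_sq' (by linarith [_root_.abs_le.mp F.abs_le])
    (by linarith [_root_.abs_le.mp F.abs_le])
  nlinarith [F.pos, F.le]

lemma disc_pos {A B C : ℤ} {p : ℕ} (F : ReducedForm A B C p) : 0 < 4 * A * C - B ^ 2 := by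
  nlinarith [F.sq_B_le, mul_pos F.pos F.C_pos]

lemma prime_int {A B C : ℤ} {p : ℕ} (F : ReducedForm A B C p) : Prime (p : ℤ) :=
  Nat.prime_iff_prime_int.mp F.prime

lemma not_dvd_two {A B C : ℤ} {p : ℕ} (F : ReducedForm A B C p) : ¬ (p : ℤ) ∣ 2 := fun h =>
  F.ne_two ((Nat.prime_dvd_prime_iff_eq F.prime Nat.prime_two).mp (by exact_mod_cast h))

lemma not_dvd_four_mul {A B C : ℤ} {p : ℕ} (F : ReducedForm A B C p) :
    ¬ (p : ℤ) ∣ 4 * (4 * A * C - B ^ 2) := fun h => by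
  rcases F.prime_int.dvd_or_dvd h with h | h
  · rw [show (4 : ℤ) = 2 * 2 by norm_num] at h
    rcases F.prime_int.dvd_or_dvd h with h | h <;> exact F.not_dvd_two h
  · exact F.not_dvd h

/-- The coordinate along `(A, B, C)` provided by a Bezout relation. -/
def lam {A B C : ℤ} {p : ℕ} (F : ReducedForm A B C p) (x : Vec) : ℤ :=
  F.primitive.choose * x 0 + F.primitive.choose_spec.choose * x 1 +
    F.primitive.choose_spec.choose_spec.choose * x 2

lemma bezout {A B C : ℤ} {p : ℕ} (F : ReducedForm A B C p) :
    F.primitive.choose * A + F.primitive.choose_spec.choose * B +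
      F.primitive.choose_spec.choose_spec.choose * C = 1 :=
  F.primitive.choose_spec.choose_spec.choose_spec

lemma dvd_sub_lam {A B C : ℤ} {p : ℕ} (F : ReducedForm A B C p) {m : ℤ} {x : Vec}
    (h02 : m ∣ C * x 0 - A * x 2) (h01 : m ∣ B * x 0 - A * x 1) (h21 : m ∣ B * x 2 - C * x 1) :
    m ∣ x 0 - F.lam x * A ∧ m ∣ x 1 - F.lam x * B ∧ m ∣ x 2 - F.lam x * C := by
  have hb := F.bezout
  unfold lam
  set a := F.primitive.choose
  set b := F.primitive.choose_spec.choose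
  set c := F.primitive.choose_spec.choose_spec.choose
  obtain ⟨s, hs⟩ := h02
  obtain ⟨t, ht⟩ := h01
  obtain ⟨r, hr⟩ := h21
  refine ⟨⟨b * t + c * s, ?_⟩, ⟨- a * t - c * r, ?_⟩, ⟨b * r - a * s, ?_⟩⟩
  · linear_combination b * ht + c * hs - x 0 * hb
  · linear_combination -a * ht - c * hr - x 1 * hb
  · linear_combination b * hr - a * hs - x 2 * hb

lemma dvd_conic {A B C : ℤ} {p : ℕ} (F : ReducedForm A B C p) {P : ℤ} {x : Vec}
    (hx : Adm A B C P x) :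
    P ∣ (4 * A * C - B ^ 2) * F.lam x ^ 2 + x 3 ^ 2 - 4 * (4 * A * C - B ^ 2) := by
  obtain ⟨⟨s, hs⟩, ⟨t, ht⟩, ⟨r, hr⟩⟩ := F.dvd_sub_lam hx.h02 hx.h01 hx.h21
  obtain ⟨w, hw⟩ := hx.hnf
  unfold nf at hw
  refine ⟨w - 4 * s * x 2 - 4 * F.lam x * A * r + t * (x 1 + F.lam x * B), ?_⟩
  linear_combination hw - 4 * x 2 * hs - 4 * F.lam x * A * hr + (x 1 + F.lam x * B) * ht

/-- The residues `(λ, x₃)` determining an admissible vector modulo `P`. -/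
def residue {A B C : ℤ} {p : ℕ} (F : ReducedForm A B C p) (P : ℤ) (x : Vec) : ℤ × ℤ :=
  (F.lam x % P, x 3 % P)

lemma dvd_sub_of_lam {A B C : ℤ} {p : ℕ} (F : ReducedForm A B C p) {P : ℤ} {x y : Vec}
    (hx : Adm A B C P x) (hy : Adm A B C P y) (hl : P ∣ F.lam x - F.lam y)
    (h3 : P ∣ x 3 - y 3) (i : Fin 4) : P ∣ x i - y i := by
  obtain ⟨⟨s, hs⟩, ⟨t, ht⟩, ⟨r, hr⟩⟩ := F.dvd_sub_lam hx.h02 hx.h01 hx.h21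
  obtain ⟨⟨s', hs'⟩, ⟨t', ht'⟩, ⟨r', hr'⟩⟩ := F.dvd_sub_lam hy.h02 hy.h01 hy.h21
  obtain ⟨l, hl⟩ := hl
  fin_cases i
  · exact ⟨s - s' + l * A, by simp; linear_combination hs - hs' + A * hl⟩
  · exact ⟨t - t' + l * B, by simp; linear_combination ht - ht' + B * hl⟩
  · exact ⟨r - r' + l * C, by simp; linear_combination hr - hr' + C * hl⟩
  · exact h3

lemma dvd_sub_of_residue_eq {A B C : ℤ} {p : ℕ} (F : ReducedForm A B C p) {P : ℤ} {x y : Vec}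
    (hx : Adm A B C P x) (hy : Adm A B C P y) (h : F.residue P x = F.residue P y) (i : Fin 4) :
    P ∣ x i - y i := by
  simp only [residue, Prod.mk.injEq] at h
  exact F.dvd_sub_of_lam hx hy (Int.ModEq.dvd h.1.symm) (Int.ModEq.dvd h.2.symm) i

lemma residue_mem {A B C : ℤ} {p : ℕ} (F : ReducedForm A B C p) {P : ℤ} (hP : 0 < P) {x : Vec}
    (hx : Adm A B C P x) :
    (0 ≤ (F.residue P x).1 ∧ (F.residue P x).1 < P) ∧
    (0 ≤ (F.residue P x).2 ∧ (F.residue P x).2 < P) ∧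
    P ∣ (4 * A * C - B ^ 2) * (F.residue P x).1 ^ 2 + (F.residue P x).2 ^ 2 -
      4 * (4 * A * C - B ^ 2) := by
  refine ⟨⟨Int.emod_nonneg _ hP.ne', Int.emod_lt_of_pos _ hP⟩,
    ⟨Int.emod_nonneg _ hP.ne', Int.emod_lt_of_pos _ hP⟩, ?_⟩
  have h1 : F.lam x % P = F.lam x - P * (F.lam x / P) := by
    have := Int.emod_add_mul_ediv (F.lam x) P; linarith
  have h2 : x 3 % P = x 3 - P * (x 3 / P) := by
    have := Int.emod_add_mul_ediv (x 3) P; linarith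
  simp only [residue, h1, h2]
  obtain ⟨w, hw⟩ := F.dvd_conic hx
  refine ⟨w + (4 * A * C - B ^ 2) * (-2 * F.lam x * (F.lam x / P) + P * (F.lam x / P) ^ 2) +
    (-2 * x 3 * (x 3 / P) + P * (x 3 / P) ^ 2), ?_⟩
  linear_combination hw

lemma card_conic_le_of_image {A B C : ℤ} {p : ℕ} (F : ReducedForm A B C p) {m L : ℕ} (hm : 1 ≤ m)
    (R : Finset (ℤ × ℤ)) (hR : ∀ r ∈ R, (0 ≤ r.1 ∧ r.1 < (p : ℤ) ^ m) ∧
      (0 ≤ r.2 ∧ r.2 < (p : ℤ) ^ m) ∧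
      (p : ℤ) ^ m ∣ (4 * A * C - B ^ 2) * r.1 ^ 2 + r.2 ^ 2 - 4 * (4 * A * C - B ^ 2))
    (h1 : (R.image Prod.fst).card ≤ L) (h2 : (R.image Prod.snd).card ≤ L) : R.card ≤ 4 * L := by
  have hpm : (p : ℤ) ∣ (p : ℤ) ^ m := dvd_pow_self _ (by omega)
  rw [← Finset.card_filter_add_card_filter_not (s := R) (fun r => ¬ (p : ℤ) ∣ r.2),
    show 4 * L = 2 * L + 2 * L by ring]
  refine add_le_add ?_ ?_
  · refine (Finset.card_le_mul_card_image (f := Prod.fst) _ 2 ?_).trans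
      (Nat.mul_le_mul_left _
        ((Finset.card_le_card (Finset.image_subset_image (Finset.filter_subset _ _))).trans h1))
    · intro a _
      rw [← Finset.card_image_of_injOn (f := fun r => r.2)]
      · refine card_le_two_of_sq_congr F.prime F.ne_two (m := m) _ ?_ ?_
        · simp only [Finset.forall_mem_image, Finset.mem_filter]
          rintro r ⟨⟨h1, h2⟩, h3⟩
          exact ⟨(hR r h1).2.1.1, (hR r h1).2.1.2, h2⟩
        · simp only [Finset.forall_mem_image, Finset.mem_filter]
          rintro r ⟨⟨h1, h2⟩, h3⟩ s ⟨⟨h1', h2'⟩, h3'⟩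
          refine (dvd_sub (hR r h1).2.2 (hR s h1').2.2).trans (Eq.dvd ?_)
          rw [h3, h3']; ring
      · intro r hr s hs hrs
        simp only [Finset.coe_filter, Set.mem_ofPred_eq] at hr hs
        exact Prod.ext (hr.2.trans hs.2.symm) hrs
  · refine (Finset.card_le_mul_card_image (f := Prod.snd) _ 2 ?_).trans
      (Nat.mul_le_mul_left _
        ((Finset.card_le_card (Finset.image_subset_image (Finset.filter_subset _ _))).trans h2))
    · intro a _
      rw [← Finset.card_image_of_injOn (f := fun r => r.1)]
      · refine card_le_two_of_sq_congr F.prime F.ne_two (m := m) _ ?_ ?_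
        · simp only [Finset.forall_mem_image, Finset.mem_filter, not_not]
          rintro r ⟨⟨h1, h2⟩, h3⟩
          refine ⟨(hR r h1).1.1, (hR r h1).1.2, fun h4 => F.not_dvd_four_mul ?_⟩
          obtain ⟨w, hw⟩ := h4
          obtain ⟨w', hw'⟩ := h2
          obtain ⟨w'', hw''⟩ := hpm.trans (hR r h1).2.2
          exact ⟨(4 * A * C - B ^ 2) * r.1 * w + r.2 * w' - w'', by
            linear_combination (-1) * hw'' + (4 * A * C - B ^ 2) * r.1 * hw + r.2 * hw'⟩
        · simp only [Finset.forall_mem_image, Finset.mem_filter]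
          rintro r ⟨⟨h1, h2⟩, h3⟩ s ⟨⟨h1', h2'⟩, h3'⟩
          refine F.prime_int.pow_dvd_of_dvd_mul_left _ F.not_dvd ?_
          refine (dvd_sub (hR r h1).2.2 (hR s h1').2.2).trans (Eq.dvd ?_)
          rw [h3, h3']; ring
      · intro r hr s hs hrs
        simp only [Finset.coe_filter, Set.mem_ofPred_eq] at hr hs
        exact Prod.ext hrs (hr.2.trans hs.2.symm)

lemma card_conic_le {A B C : ℤ} {p : ℕ} (F : ReducedForm A B C p) {m : ℕ} (hm : 1 ≤ m)
    (R : Finset (ℤ × ℤ)) (hR : ∀ r ∈ R, (0 ≤ r.1 ∧ r.1 < (p : ℤ) ^ m) ∧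
      (0 ≤ r.2 ∧ r.2 < (p : ℤ) ^ m) ∧
      (p : ℤ) ^ m ∣ (4 * A * C - B ^ 2) * r.1 ^ 2 + r.2 ^ 2 - 4 * (4 * A * C - B ^ 2)) :
    R.card ≤ 4 * p ^ m := by
  have hico : ∀ U : Finset ℤ, (∀ u ∈ U, 0 ≤ u ∧ u < (p : ℤ) ^ m) → U.card ≤ p ^ m := by
    intro U hU
    have : U ⊆ Finset.Ico 0 ((p : ℤ) ^ m) := fun u hu => Finset.mem_Ico.mpr (hU u hu)
    refine (Finset.card_le_card this).trans (le_of_eq ?_)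
    rw [Int.card_Ico, sub_zero]
    exact_mod_cast Int.toNat_natCast (p ^ m)
  refine F.card_conic_le_of_image hm R hR (hico _ ?_) (hico _ ?_)
  · simp only [Finset.forall_mem_image]
    exact fun r hr => (hR r hr).1
  · simp only [Finset.forall_mem_image]
    exact fun r hr => (hR r hr).2.1

/-- Admissible vectors in a box. -/
lemma card_adm_le {A B C : ℤ} {p : ℕ} (F : ReducedForm A B C p) {m : ℕ} (hm : 1 ≤ m)
    (M : Fin 4 → ℕ) (U : Finset Vec) (hU : ∀ x ∈ U, Adm A B C ((p : ℤ) ^ m) x)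
    (hM : ∀ x ∈ U, ∀ i, |x i| ≤ M i) :
    U.card ≤ (∏ i, (2 * (M i / p ^ m) + 2)) * (4 * p ^ m) := by
  have hP : (0 : ℤ) < (p : ℤ) ^ m := pow_pos (by exact_mod_cast F.prime.pos) _
  refine (card_le_of_residue_map (pow_pos F.prime.pos m) U (F.residue ((p : ℤ) ^ m)) hM ?_).trans
    (Nat.mul_le_mul_left _ (F.card_conic_le hm _ ?_))
  · intro u hu v hv huv i
    exact_mod_cast F.dvd_sub_of_residue_eq (hU u hu) (hU v hv) huv i
  · simp only [Finset.forall_mem_image]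
    exact fun x hx => F.residue_mem hP (hU x hx)

end ReducedForm

lemma card_le_of_congr_or {m : ℤ} {T : ℕ} (U : Finset ℤ)
    (hT : ∀ V ⊆ U, (∀ u ∈ V, ∀ v ∈ V, m ∣ u - v) → V.card ≤ T)
    (hUU : ∀ u ∈ U, ∀ v ∈ U, m ∣ u - v ∨ m ∣ u + v) : U.card ≤ 2 * T := by
  classical
  rcases U.eq_empty_or_nonempty with rfl | ⟨d, hd⟩
  · simp
  rw [← Finset.card_filter_add_card_filter_not (s := U) (fun u => m ∣ u - d), two_mul]
  refine add_le_add (hT _ (Finset.filter_subset _ _) ?_) (hT _ (Finset.filter_subset _ _) ?_)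
  · intro u hu v hv
    rw [Finset.mem_filter] at hu hv
    exact (dvd_sub hu.2 hv.2).trans (Eq.dvd (by ring))
  · intro u hu v hv
    rw [Finset.mem_filter] at hu hv
    have h1 := (hUU u hu.1 d hd).resolve_left hu.2
    have h2 := (hUU v hv.1 d hd).resolve_left hv.2
    exact (dvd_sub h1 h2).trans (Eq.dvd (by ring))

namespace ReducedForm

lemma eq_lam_of_rf_eq_zero {A B C : ℤ} {p : ℕ} (F : ReducedForm A B C p) {x : Vec}
    (hx : rf A B C x = 0) :
    x 0 = F.lam x * A ∧ x 1 = F.lam x * B ∧ x 2 = F.lam x * C := by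
  have h := four_sq_mul_rf A B C x
  rw [hx, mul_zero] at h
  have hE := F.disc_pos
  have h1 : (B * x 0 - A * x 1) ^ 2 = 0 := by
    by_contra hne
    have : 0 < (B * x 0 - A * x 1) ^ 2 := lt_of_le_of_ne (sq_nonneg _) (Ne.symm hne)
    nlinarith [mul_pos hE this, sq_nonneg (2 * A * (C * x 0 - A * x 2) - B * (B * x 0 - A * x 1))]
  have h1' : B * x 0 - A * x 1 = 0 := pow_eq_zero_iff two_ne_zero |>.mp h1
  rw [h1'] at h
  have h2 : C * x 0 - A * x 2 = 0 := by
    have : (2 * A * (C * x 0 - A * x 2)) ^ 2 = 0 := by linarith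
    have := pow_eq_zero_iff two_ne_zero |>.mp this
    have hA := F.pos.ne'
    simpa [hA] using this
  have h3 : B * x 2 - C * x 1 = 0 := by
    have : A * (B * x 2 - C * x 1) = 0 := by linear_combination C * h1' - B * h2
    exact (mul_eq_zero.mp this).resolve_left F.pos.ne'
  have := F.dvd_sub_lam (m := 0) (x := x) (by simp [h2]) (by simp [h1']) (by simp [h3])
  simp only [zero_dvd_iff] at this
  exact ⟨by linarith [this.1], by linarith [this.2.1], by linarith [this.2.2]⟩

lemma card_rf_eq_zero_le {A B C : ℤ} {p : ℕ} (F : ReducedForm A B C p) {s M : ℕ}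
    (U : Finset Vec) (hU : ∀ x ∈ U, Adm A B C ((p : ℤ) ^ (s + s)) x)
    (h0 : ∀ x ∈ U, rf A B C x = 0) (hA : ∀ x ∈ U, |x 0| ≤ 2 * A) (hM : ∀ x ∈ U, |x 3| ≤ M) :
    U.card ≤ 2 * (2 * (M / p ^ s) + 2) * 5 := by
  classical
  refine (Finset.card_le_mul_card_image (f := F.lam) _ (2 * (2 * (M / p ^ s) + 2)) ?_).trans
    (Nat.mul_le_mul_left _ ?_)
  · intro a _
    rw [← Finset.card_image_of_injOn (f := fun x : Vec => x 3)]
    · refine card_le_of_congr_or (m := (p : ℤ) ^ s) _ (fun V hV hVV => ?_) ?_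
      · refine card_le_of_congr (pow_pos F.prime.pos s) V (fun u hu => ?_) ?_
        · obtain ⟨x, hx, rfl⟩ := Finset.mem_image.mp (hV hu)
          exact hM x (Finset.mem_filter.mp hx).1
        · exact_mod_cast hVV
      · simp only [Finset.forall_mem_image, Finset.mem_filter]
        rintro x ⟨hx, hxa⟩ y ⟨hy, hya⟩
        have h1 := dvd_sub (F.dvd_conic (hU x hx)) (F.dvd_conic (hU y hy))
        rw [hxa, hya] at h1
        have h2 : (p : ℤ) ^ (s + s) ∣ (x 3 - y 3) * (x 3 + y 3) :=
          h1.trans (Eq.dvd (by ring))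
        rcases F.prime_int.pow_dvd_or_of_mul h2 with h3 | h3
        · exact Or.inl ((pow_dvd_pow _ (by omega)).trans h3)
        · exact Or.inr h3
    · intro x hx y hy hxy
      simp only [Finset.coe_filter, Set.mem_ofPred_eq] at hx hy
      have ex := F.eq_lam_of_rf_eq_zero (h0 x hx.1)
      have ey := F.eq_lam_of_rf_eq_zero (h0 y hy.1)
      rw [hx.2] at ex
      rw [hy.2] at ey
      ext i
      fin_cases i
      · simp [ex.1, ey.1]
      · simp [ex.2.1, ey.2.1]
      · simp [ex.2.2, ey.2.2]
      · exact hxy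
  · have : U.image F.lam ⊆ Finset.Icc (-2) 2 := by
      intro a ha
      obtain ⟨x, hx, rfl⟩ := Finset.mem_image.mp ha
      have h1 := hA x hx
      rw [(F.eq_lam_of_rf_eq_zero (h0 x hx)).1, abs_mul, abs_of_pos F.pos] at h1
      have := le_of_mul_le_mul_right h1 F.pos
      rw [Finset.mem_Icc]
      exact _root_.abs_le.mp this
    exact Finset.card_le_card this

/-- Residues with a prescribed first coordinate and prescribed divisibility of the second. -/
lemma card_second_residue_le {p : ℕ} (hp : p.Prime) (hp2 : p ≠ 2) {n w : ℕ} (hw : w ≤ 2 * n)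
    (U : Finset ℤ) (hU : ∀ d ∈ U, 0 ≤ d ∧ d < (p : ℤ) ^ (4 * n))
    (hd : ∀ d ∈ U, (p : ℤ) ^ w ∣ d ∧ (w = 2 * n ∨ ¬ (p : ℤ) ^ (w + 1) ∣ d))
    (hUU : ∀ d ∈ U, ∀ e ∈ U, (p : ℤ) ^ (4 * n) ∣ d ^ 2 - e ^ 2) : U.card ≤ 4 * p ^ w := by
  have hp0 : (p : ℤ) ≠ 0 := by exact_mod_cast hp.ne_zero
  have hpw : 1 ≤ p ^ w := Nat.one_le_pow _ _ hp.pos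
  have : U.card ≤ 2 * (p ^ w + 1) := by
    refine card_le_of_congr_or (m := (p : ℤ) ^ (4 * n - w)) U (fun V hV hVV => ?_) ?_
    · refine (card_filter_residue_le (N := p ^ (4 * n)) (ℓ := p ^ (4 * n - w))
        (pow_pos hp.pos _) V (fun u hu => ?_) ?_).trans (le_of_eq ?_)
      · exact_mod_cast hU u (hV hu)
      · exact_mod_cast hVV
      · rw [Nat.pow_div (by omega) hp.pos, show 4 * n - (4 * n - w) = w by omega]
    · intro d hdU e heU
      obtain ⟨⟨d', hd'⟩, hd2⟩ := hd d hdU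
      obtain ⟨⟨e', he'⟩, he2⟩ := hd e heU
      rcases hd2 with h | h
      · left
        rw [show 4 * n - w = w by omega]
        exact dvd_sub ⟨d', hd'⟩ ⟨e', he'⟩
      · have h1 : ¬ (p : ℤ) ∣ d' := fun h2 => h (by
          rw [hd', pow_succ]; exact mul_dvd_mul_left _ h2)
        have h2 : (p : ℤ) ^ (4 * n - 2 * w) ∣ d' ^ 2 - e' ^ 2 := by
          have h3 := hUU d hdU e heU
          rw [hd', he', show 4 * n = (w + w) + (4 * n - 2 * w) by omega, pow_add, pow_add,
            show ((p : ℤ) ^ w * d') ^ 2 - ((p : ℤ) ^ w * e') ^ 2 =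
              (p : ℤ) ^ w * (p : ℤ) ^ w * (d' ^ 2 - e' ^ 2) by ring] at h3
          exact (mul_dvd_mul_iff_left (by positivity)).mp h3
        rw [hd', he', show 4 * n - w = w + (4 * n - 2 * w) by omega, pow_add, ← mul_sub, ← mul_add]
        exact (sq_congr_cases hp hp2 h1 h2).imp (mul_dvd_mul_left _) (mul_dvd_mul_left _)
  omega

end ReducedForm

namespace ReducedForm

lemma card_first_residue_le {A B C : ℤ} {p : ℕ} (F : ReducedForm A B C p) {n w : ℕ} {s : ℤ}
    (hs : |s| ≤ 2) (hA : 4 * A < (p : ℤ) ^ (4 * n)) (L : Finset ℤ)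
    (hL : ∀ l ∈ L, 0 ≤ l ∧ l < (p : ℤ) ^ (4 * n)) (hw : ∀ l ∈ L, (p : ℤ) ^ (2 * w) ∣ l - s)
    (hy : ∀ l ∈ L, ∃ y, |y| ≤ 2 * A ∧ y ≠ s * A ∧ (p : ℤ) ^ (4 * n) ∣ y - l * A) :
    (L.card : ℤ) * (p : ℤ) ^ (2 * w) ≤ 32 * A := by
  classical
  have hp0 : (0 : ℤ) < p := by exact_mod_cast F.prime.pos
  rcases L.eq_empty_or_nonempty with rfl | ⟨l0, hl0⟩
  · simpa using F.pos.le
  choose! y hy1 hy2 hy3 using hy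
  obtain ⟨a, A', hA', hpA'⟩ : ∃ a : ℕ, ∃ A', A = (p : ℤ) ^ a * A' ∧ ¬ (p : ℤ) ∣ A' := by
    have : FiniteMultiplicity (p : ℤ) A :=
      Int.finiteMultiplicity_iff.mpr ⟨by simpa using F.prime.one_lt.ne', F.pos.ne'⟩
    obtain ⟨c, hc, hc'⟩ := this.exists_eq_pow_mul_and_not_dvd
    exact ⟨_, c, hc, hc'⟩
  have hmul : ∀ l ∈ L, (p : ℤ) ^ (a + 2 * w) ∣ A * (l - s) := fun l hl => by
    rw [pow_add]
    exact mul_dvd_mul ⟨A', hA'⟩ (hw l hl)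
  have hyd : ∀ l ∈ L, (p : ℤ) ^ (4 * n) ∣ (y l - s * A) - A * (l - s) := fun l hl =>
    (hy3 l hl).trans (Eq.dvd (by ring))
  have hylt : ∀ l ∈ L, |y l - s * A| ≤ 4 * A := fun l hl => by
    refine (abs_sub _ _).trans ?_
    rw [abs_mul, abs_of_pos F.pos]
    nlinarith [hy1 l hl, F.pos]
  have hle : a + 2 * w ≤ 4 * n := by
    by_contra! hcon
    have h1 : (p : ℤ) ^ (4 * n) ∣ y l0 - s * A := by
      have h2 := (pow_dvd_pow (p : ℤ) hcon.le).trans (hmul l0 hl0)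
      simpa using dvd_add (hyd l0 hl0) h2
    exact hy2 l0 hl0 (sub_eq_zero.mp
      (Int.eq_zero_of_abs_lt_dvd h1 ((hylt l0 hl0).trans_lt hA)))
  have hm : ∀ l ∈ L, (p : ℤ) ^ (a + 2 * w) ∣ y l - s * A := fun l hl => by
    simpa using dvd_add ((pow_dvd_pow (p : ℤ) hle).trans (hyd l hl)) (hmul l hl)
  have hmle : p ^ (a + 2 * w) ≤ (4 * A).toNat := by
    have h1 := Int.le_of_dvd (abs_pos.mpr (sub_ne_zero.mpr (hy2 l0 hl0)))
      ((dvd_abs _ _).mpr (hm l0 hl0))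
    have h2 := h1.trans (hylt l0 hl0)
    zify
    rw [Int.toNat_of_nonneg (by linarith [F.pos])]
    exact h2
  have hY : (L.image fun l => y l - s * A).card * p ^ (a + 2 * w) ≤ 4 * (4 * A).toNat := by
    have h1 : (L.image fun l => y l - s * A).card ≤ 2 * ((4 * A).toNat / p ^ (a + 2 * w)) + 2 := by
      refine card_le_of_congr (pow_pos F.prime.pos _) _ ?_ ?_
      · simp only [Finset.forall_mem_image]
        intro l hl
        rw [Int.toNat_of_nonneg (by linarith [F.pos])]
        exact hylt l hl
      · simp only [Finset.forall_mem_image]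
        intro l hl l' hl'
        exact_mod_cast dvd_sub (hm l hl) (hm l' hl')
    have h2 := Nat.div_mul_le_self (4 * A).toNat (p ^ (a + 2 * w))
    calc _ ≤ (2 * ((4 * A).toNat / p ^ (a + 2 * w)) + 2) * p ^ (a + 2 * w) :=
          Nat.mul_le_mul_right _ h1
      _ = 2 * ((4 * A).toNat / p ^ (a + 2 * w) * p ^ (a + 2 * w)) + 2 * p ^ (a + 2 * w) := by ring
      _ ≤ _ := by omega
  have hLc : L.card ≤ 2 * p ^ a * (L.image fun l => y l - s * A).card := by
    refine Finset.card_le_mul_card_image _ _ fun b _ => ?_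
    have hpa : 1 ≤ p ^ a := Nat.one_le_pow _ _ F.prime.pos
    have : (L.filter fun l => y l - s * A = b).card ≤ p ^ a + 1 := by
      refine (card_filter_residue_le (N := p ^ (4 * n)) (ℓ := p ^ (4 * n - a))
        (pow_pos F.prime.pos _) _ (fun u hu => ?_) ?_).trans (le_of_eq ?_)
      · exact_mod_cast hL u (Finset.mem_filter.mp hu).1
      · intro u hu v hv
        obtain ⟨hu1, hu2⟩ := Finset.mem_filter.mp hu
        obtain ⟨hv1, hv2⟩ := Finset.mem_filter.mp hv
        have h1 : (p : ℤ) ^ (4 * n) ∣ A * (u - v) := by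
          refine (dvd_sub (hyd v hv1) (hyd u hu1)).trans (Eq.dvd ?_)
          rw [hu2, hv2]; ring
        rw [hA', show 4 * n = a + (4 * n - a) by omega, pow_add, mul_assoc] at h1
        have h2 := (mul_dvd_mul_iff_left (pow_ne_zero a hp0.ne')).mp h1
        exact_mod_cast F.prime_int.pow_dvd_of_dvd_mul_left _ hpA' h2
      · rw [Nat.pow_div (by omega) F.prime.pos, show 4 * n - (4 * n - a) = a by omega]
    omega
  have hfin : L.card * p ^ (2 * w) ≤ 8 * (4 * A).toNat := by
    calc L.card * p ^ (2 * w) ≤ 2 * p ^ a * (L.image fun l => y l - s * A).card * p ^ (2 * w) :=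
          Nat.mul_le_mul_right _ hLc
      _ = 2 * ((L.image fun l => y l - s * A).card * p ^ (a + 2 * w)) := by rw [pow_add]; ring
      _ ≤ _ := by omega
  have : ((4 * A).toNat : ℤ) = 4 * A := Int.toNat_of_nonneg (by linarith [F.pos])
  have h3 : (L.card : ℤ) * (p : ℤ) ^ (2 * w) ≤ 8 * ((4 * A).toNat : ℤ) := by exact_mod_cast hfin
  linarith

/-- Points of the conic whose first coordinate comes from a small `x₀ ≠ ±2A`. -/
lemma card_residue_le {A B C : ℤ} {p : ℕ} (F : ReducedForm A B C p) {n : ℕ}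
    (hA : 4 * A < (p : ℤ) ^ (4 * n)) (R : Finset (ℤ × ℤ))
    (hR : ∀ r ∈ R, (0 ≤ r.1 ∧ r.1 < (p : ℤ) ^ (4 * n)) ∧ (0 ≤ r.2 ∧ r.2 < (p : ℤ) ^ (4 * n)) ∧
      (p : ℤ) ^ (4 * n) ∣ (4 * A * C - B ^ 2) * r.1 ^ 2 + r.2 ^ 2 - 4 * (4 * A * C - B ^ 2))
    (hy : ∀ r ∈ R, ∃ y, |y| ≤ 2 * A ∧ |y| ≠ 2 * A ∧ (p : ℤ) ^ (4 * n) ∣ y - r.1 * A) :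
    (R.card : ℝ) ≤ 512 * A := by
  classical
  have hpi := F.prime_int
  let W : ℕ → ℤ → Finset (ℤ × ℤ) := fun w s => R.filter fun r =>
    ((p : ℤ) ^ w ∣ r.2 ∧ (w = 2 * n ∨ ¬ (p : ℤ) ^ (w + 1) ∣ r.2)) ∧ (p : ℤ) ^ (2 * w) ∣ r.1 - s
  have hW : ∀ w ≤ 2 * n, ∀ s : ℤ, |s| = 2 → ((W w s).card : ℝ) ≤ 128 * A * (1 / 2) ^ w := by
    intro w hw s hs
    have h1 : (W w s).card ≤ 4 * p ^ w * ((W w s).image Prod.fst).card := by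
      refine Finset.card_le_mul_card_image _ _ fun l _ => ?_
      rw [← Finset.card_image_of_injOn (f := Prod.snd)]
      · refine card_second_residue_le F.prime F.ne_two hw _ ?_ ?_ ?_
        · simp only [Finset.forall_mem_image]
          intro r hr
          simp only [W, Finset.mem_filter] at hr
          exact (hR r hr.1.1).2.1
        · simp only [Finset.forall_mem_image]
          intro r hr
          simp only [W, Finset.mem_filter] at hr
          exact hr.1.2.1
        · simp only [Finset.forall_mem_image]
          intro r hr r' hr'
          simp only [W, Finset.mem_filter] at hr hr'
          refine (dvd_sub (hR r hr.1.1).2.2 (hR r' hr'.1.1).2.2).trans (Eq.dvd ?_)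
          rw [hr.2, hr'.2]; ring
      · intro r hr r' hr' h
        simp only [Finset.coe_filter, Set.mem_ofPred_eq] at hr hr'
        exact Prod.ext (hr.2.trans hr'.2.symm) h
    have h2 := F.card_first_residue_le (w := w) (s := s) hs.le hA ((W w s).image Prod.fst)
      (by
        simp only [Finset.forall_mem_image]
        intro r hr
        simp only [W, Finset.mem_filter] at hr
        exact (hR r hr.1).1)
      (by
        simp only [Finset.forall_mem_image]
        intro r hr
        simp only [W, Finset.mem_filter] at hr
        exact hr.2.2)
      (by
        simp only [Finset.forall_mem_image]
        intro r hr
        simp only [W, Finset.mem_filter] at hr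
        obtain ⟨y, hy1, hy2, hy3⟩ := hy r hr.1
        refine ⟨y, hy1, fun h => hy2 ?_, hy3⟩
        rw [h, abs_mul, hs, abs_of_pos F.pos])
    have hpw : (2 : ℝ) ^ w ≤ (p : ℝ) ^ w :=
      pow_le_pow_left₀ (by norm_num) (by exact_mod_cast F.prime.two_le) w
    have hp0 : (0 : ℝ) < (p : ℝ) ^ w := lt_of_lt_of_le (by positivity) hpw
    have h3 : ((W w s).card : ℝ) ≤ 4 * (p : ℝ) ^ w * (((W w s).image Prod.fst).card : ℝ) := by
      exact_mod_cast h1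
    have h4 : (((W w s).image Prod.fst).card : ℝ) * (p : ℝ) ^ (2 * w) ≤ 32 * A := by
      exact_mod_cast h2
    have h5 : ((W w s).card : ℝ) * (p : ℝ) ^ w ≤ 128 * A := by
      calc ((W w s).card : ℝ) * (p : ℝ) ^ w
          ≤ 4 * (p : ℝ) ^ w * (((W w s).image Prod.fst).card : ℝ) * (p : ℝ) ^ w := by gcongr
        _ = 4 * ((((W w s).image Prod.fst).card : ℝ) * (p : ℝ) ^ (2 * w)) := by ring
        _ ≤ _ := by linarith
    rw [one_div, inv_pow, ← div_eq_mul_inv, le_div_iff₀ (by positivity)]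
    exact (mul_le_mul_of_nonneg_left hpw (by positivity)).trans h5
  have hcover : R ⊆ (Finset.range (2 * n + 1)).biUnion fun w => W w 2 ∪ W w (-2) := by
    intro r hr
    obtain ⟨w, hw, hd, hd'⟩ : ∃ w ≤ 2 * n, (p : ℤ) ^ w ∣ r.2 ∧
        (w = 2 * n ∨ ¬ (p : ℤ) ^ (w + 1) ∣ r.2) := by
      refine ⟨Nat.findGreatest (fun w => (p : ℤ) ^ w ∣ r.2) (2 * n), Nat.findGreatest_le _,
        Nat.findGreatest_spec (P := fun w => (p : ℤ) ^ w ∣ r.2) (Nat.zero_le _) (by simp), ?_⟩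
      by_contra! hcon
      have hlt := lt_of_le_of_ne (Nat.findGreatest_le (2 * n)) hcon.1
      exact Nat.findGreatest_is_greatest (Nat.lt_succ_self _) hlt hcon.2
    rw [Finset.mem_biUnion]
    refine ⟨w, Finset.mem_range.mpr (by omega), ?_⟩
    have h1 : (p : ℤ) ^ (2 * w) ∣ r.2 ^ 2 := by
      rw [mul_comm, pow_mul]; exact pow_dvd_pow_of_dvd hd 2
    have h2 : (p : ℤ) ^ (2 * w) ∣ (4 * A * C - B ^ 2) * (r.1 ^ 2 - 2 ^ 2) := by
      refine (dvd_sub ((pow_dvd_pow (p : ℤ) (by omega)).trans (hR r hr).2.2) h1).trans (Eq.dvd ?_)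
      ring
    have h3 := F.prime_int.pow_dvd_of_dvd_mul_left _ F.not_dvd h2
    have h4 : (p : ℤ) ^ (2 * w) ∣ 2 ^ 2 - r.1 ^ 2 := by rwa [dvd_sub_comm]
    rw [Finset.mem_union]
    rcases sq_congr_cases F.prime F.ne_two F.not_dvd_two h4 with h5 | h5
    · left
      simp only [W, Finset.mem_filter]
      exact ⟨hr, ⟨hd, hd'⟩, by rwa [dvd_sub_comm]⟩
    · right
      simp only [W, Finset.mem_filter]
      exact ⟨hr, ⟨hd, hd'⟩, by rwa [sub_neg_eq_add, add_comm]⟩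
  have hA0 : (0 : ℝ) < A := by exact_mod_cast F.pos
  have h6 : (R.card : ℝ) ≤ ∑ w ∈ Finset.range (2 * n + 1), (W w 2 ∪ W w (-2)).card := by
    exact_mod_cast (Finset.card_le_card hcover).trans Finset.card_biUnion_le
  refine h6.trans ?_
  push_cast
  have h7 : ∀ w ∈ Finset.range (2 * n + 1),
      ((W w 2 ∪ W w (-2)).card : ℝ) ≤ 256 * A * (1 / 2) ^ w := by
    intro w hw
    have hw' : w ≤ 2 * n := by rw [Finset.mem_range] at hw; omega
    have h8 : ((W w 2 ∪ W w (-2)).card : ℝ) ≤ (W w 2).card + (W w (-2)).card := by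
      exact_mod_cast Finset.card_union_le _ _
    have := hW w hw' 2 (by norm_num)
    have := hW w hw' (-2) (by norm_num)
    linarith
  refine (Finset.sum_le_sum h7).trans ?_
  rw [← Finset.mul_sum]
  have := sum_geometric_two_le (2 * n + 1)
  nlinarith

end ReducedForm

/-- Integral points counted by `SSetQ`, in lattice coordinates. -/
structure Sol (A B C δ P : ℤ) (x : Vec) : Prop where
  adm : Adm A B C P x
  b0 : |x 0| ≤ 2 * A
  b1 : x 1 ^ 2 ≤ 16 * (A * C)
  b2 : |x 2| ≤ 2 * C
  b3 : x 3 ^ 2 ≤ 16 * (A * C)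
  eqn : ∃ z, δ * z ^ 2 = (nf x - 4 * (4 * A * C - B ^ 2)) ^ 2 - 64 * rf A B C x
  bdry : |x 0| = 2 * A → x 1 ^ 2 = (2 * B) ^ 2 ∧ x 3 = 0

/-- The restriction of the right-hand side of the defining equation to a line. -/
def gpoly (A B C : ℤ) (y v : Vec) : Polynomial ℤ :=
  .C ((nf y - 4 * (4 * A * C - B ^ 2)) ^ 2 - 64 * rf A B C y) +
  .C (2 * (nf y - 4 * (4 * A * C - B ^ 2)) * bn y v - 64 * br A B C y v) * .X ^ 1 +
  .C (bn y v ^ 2 + 2 * (nf y - 4 * (4 * A * C - B ^ 2)) * nf v - 64 * rf A B C v) * .X ^ 2 +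
  .C (2 * bn y v * nf v) * .X ^ 3 + .C (nf v ^ 2) * .X ^ 4

lemma coeff_gpoly (A B C : ℤ) (y v : Vec) :
    (gpoly A B C y v).coeff 0 = (nf y - 4 * (4 * A * C - B ^ 2)) ^ 2 - 64 * rf A B C y ∧
    (gpoly A B C y v).coeff 1 =
      2 * (nf y - 4 * (4 * A * C - B ^ 2)) * bn y v - 64 * br A B C y v ∧
    (gpoly A B C y v).coeff 2 =
      bn y v ^ 2 + 2 * (nf y - 4 * (4 * A * C - B ^ 2)) * nf v - 64 * rf A B C v ∧
    (gpoly A B C y v).coeff 3 = 2 * bn y v * nf v ∧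
    (gpoly A B C y v).coeff 4 = nf v ^ 2 := by
  simp only [gpoly, Polynomial.coeff_add, Polynomial.coeff_C_mul, Polynomial.coeff_X_pow,
    Polynomial.coeff_C]
  norm_num

lemma eval_gpoly (A B C : ℤ) (y v : Vec) (u : ℤ) :
    (gpoly A B C y v).eval u =
      (nf (y + u • v) - 4 * (4 * A * C - B ^ 2)) ^ 2 - 64 * rf A B C (y + u • v) := by
  rw [nf_add_smul, rf_add_smul]
  simp only [gpoly, Polynomial.eval_add, Polynomial.eval_mul, Polynomial.eval_C,
    Polynomial.eval_pow, Polynomial.eval_X]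
  ring

lemma natDegree_gpoly_le (A B C : ℤ) (y v : Vec) : (gpoly A B C y v).natDegree ≤ 4 := by
  unfold gpoly
  compute_degree

lemma abs_form_le {Y : ℤ} {A B C : ℤ} (hA : |A| ≤ Y) (hB : |B| ≤ Y) (hC : |C| ≤ Y) {y v : Vec}
    (hy : ∀ i, |y i| ≤ Y) (hv : ∀ i, |v i| ≤ Y) :
    |bn y v| ≤ 12 * Y ^ 2 ∧ |nf y| ≤ 6 * Y ^ 2 ∧ |br A B C y v| ≤ 16 * Y ^ 4 ∧
      |rf A B C y| ≤ 8 * Y ^ 4 := by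
  have hY : 0 ≤ Y := (abs_nonneg _).trans hA
  have m2 : ∀ a b : ℤ, |a| ≤ Y → |b| ≤ Y → |a * b| ≤ Y ^ 2 := fun a b ha hb => by
    rw [abs_mul, sq]; exact mul_le_mul ha hb (abs_nonneg _) hY
  have d2 : ∀ a b c d : ℤ, |a| ≤ Y → |b| ≤ Y → |c| ≤ Y → |d| ≤ Y →
      |a * b - c * d| ≤ 2 * Y ^ 2 := fun a b c d ha hb hc hd => by
    have := m2 a b ha hb; have := m2 c d hc hd
    refine (abs_sub _ _).trans (by linarith)
  have m4 : ∀ a b : ℤ, |a| ≤ 2 * Y ^ 2 → |b| ≤ 2 * Y ^ 2 → |a * b| ≤ 4 * Y ^ 4 :=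
    fun a b ha hb => by
      rw [abs_mul]
      calc |a| * |b| ≤ (2 * Y ^ 2) * (2 * Y ^ 2) :=
            mul_le_mul ha hb (abs_nonneg _) (by positivity)
        _ = _ := by ring
  refine ⟨?_, ?_, ?_, ?_⟩
  · have h1 := abs_le.mp (m2 _ _ (hy 0) (hv 2))
    have h2 := abs_le.mp (m2 _ _ (hy 2) (hv 0))
    have h3 := abs_le.mp (m2 _ _ (hy 1) (hv 1))
    have h4 := abs_le.mp (m2 _ _ (hy 3) (hv 3))
    unfold bn
    rw [abs_le]; constructor <;> linarith [h1.1, h1.2, h2.1, h2.2, h3.1, h3.2, h4.1, h4.2]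
  · have h1 := abs_le.mp (m2 _ _ (hy 0) (hy 2))
    have h3 := abs_le.mp (m2 _ _ (hy 1) (hy 1))
    have h4 := abs_le.mp (m2 _ _ (hy 3) (hy 3))
    unfold nf
    rw [abs_le]; constructor <;> linarith [h1.1, h1.2, h3.1, h3.2, h4.1, h4.2]
  · have h1 := abs_le.mp (m4 _ _ (d2 _ _ _ _ hC (hy 0) hA (hy 2)) (d2 _ _ _ _ hC (hv 0) hA (hv 2)))
    have h2 := abs_le.mp (m4 _ _ (d2 _ _ _ _ hB (hy 0) hA (hy 1)) (d2 _ _ _ _ hB (hv 2) hC (hv 1)))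
    have h3 := abs_le.mp (m4 _ _ (d2 _ _ _ _ hB (hv 0) hA (hv 1)) (d2 _ _ _ _ hB (hy 2) hC (hy 1)))
    unfold br
    rw [abs_le]; constructor <;> linarith [h1.1, h1.2, h2.1, h2.2, h3.1, h3.2]
  · have h1 := abs_le.mp (m4 _ _ (d2 _ _ _ _ hC (hy 0) hA (hy 2)) (d2 _ _ _ _ hC (hy 0) hA (hy 2)))
    have h2 := abs_le.mp (m4 _ _ (d2 _ _ _ _ hB (hy 0) hA (hy 1)) (d2 _ _ _ _ hB (hy 2) hC (hy 1)))
    unfold rf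
    rw [abs_le]; constructor <;> linarith [h1.1, h1.2, h2.1, h2.2]

lemma abs_coeff_gpoly_le {Y : ℤ} {A B C : ℤ} (hY : 1 ≤ Y) (hA : |A| ≤ Y) (hB : |B| ≤ Y)
    (hC : |C| ≤ Y) {y v : Vec} (hy : ∀ i, |y i| ≤ Y) (hv : ∀ i, |v i| ≤ Y) (i : ℕ) :
    |(gpoly A B C y v).coeff i| ≤ 3000 * Y ^ 4 := by
  obtain ⟨h1, h2, h3, h4⟩ := abs_form_le hA hB hC hy hv
  obtain ⟨-, h5, -, h6⟩ := abs_form_le hA hB hC hv hv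
  have hE : |nf y - 4 * (4 * A * C - B ^ 2)| ≤ 26 * Y ^ 2 := by
    have hAC : |A * C| ≤ Y ^ 2 := by
      rw [abs_mul, sq]; exact mul_le_mul hA hC (abs_nonneg _) (by linarith)
    have hBB : |B * B| ≤ Y ^ 2 := by
      rw [abs_mul, sq]; exact mul_le_mul hB hB (abs_nonneg _) (by linarith)
    rw [abs_le] at *
    constructor <;> linarith [h2.1, h2.2, hAC.1, hAC.2, hBB.1, hBB.2]
  set φ := nf y - 4 * (4 * A * C - B ^ 2)
  have m4 : ∀ a b c d : ℤ, |a| ≤ c * Y ^ 2 → |b| ≤ d * Y ^ 2 → 0 ≤ c →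
      |a * b| ≤ c * d * Y ^ 4 := fun a b c d ha hb hc => by
    rw [abs_mul]
    calc |a| * |b| ≤ (c * Y ^ 2) * (d * Y ^ 2) :=
          mul_le_mul ha hb (abs_nonneg _) (by positivity)
      _ = _ := by ring
  have hY4 : 1 ≤ Y ^ 4 := one_le_pow₀ hY
  have q1 := m4 φ φ 26 26 hE hE (by norm_num)
  have q2 := m4 φ (bn y v) 26 12 hE h1 (by norm_num)
  have q3 := m4 (bn y v) (bn y v) 12 12 h1 h1 (by norm_num)
  have q4 := m4 φ (nf v) 26 6 hE h5 (by norm_num)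
  have q5 := m4 (bn y v) (nf v) 12 6 h1 h5 (by norm_num)
  have q6 := m4 (nf v) (nf v) 6 6 h5 h5 (by norm_num)
  rw [abs_le] at q1 q2 q3 q4 q5 q6 h3 h4 h6
  have hcases : (gpoly A B C y v).coeff i = 0 ∨ i < 5 := by
    by_cases hi : i < 5
    · exact Or.inr hi
    · exact Or.inl (Polynomial.coeff_eq_zero_of_natDegree_lt
        ((natDegree_gpoly_le A B C y v).trans_lt (by omega)))
  rcases hcases with h | h
  · rw [h, abs_zero]; positivity
  · obtain ⟨e0, e1, e2, e3, e4⟩ := coeff_gpoly A B C y v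
    change _ = φ ^ 2 - _ at e0
    change _ = 2 * φ * _ - _ at e1
    change _ = _ + 2 * φ * _ - _ at e2
    rw [abs_le]
    interval_cases i
    · rw [e0, sq φ]; constructor <;> linarith [h4.1, h4.2, q1.1, q1.2]
    · rw [e1, mul_assoc]; constructor <;> linarith [h3.1, h3.2, q2.1, q2.2]
    · rw [e2, mul_assoc, sq (bn y v)]
      constructor <;> linarith [h6.1, h6.2, q3.1, q3.2, q4.1, q4.2]
    · rw [e3, mul_assoc]; constructor <;> linarith [q5.1, q5.2]
    · rw [e4, sq (nf v)]; constructor <;> linarith [q6.1, q6.2]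

lemma card_image_natCast (U : Finset ℕ) : (U.image (fun i : ℕ => (i : ℤ))).card = U.card :=
  Finset.card_image_of_injective _ Nat.cast_injective

open Polynomial in
/-- Solutions on a nondegenerate line. -/
lemma card_line_le (K : ℕ) (δ : ℤ) (hδ : 0 < δ) :
    ∃ Cst : ℝ, 0 < Cst ∧ ∀ (N : ℕ) (A B C P Y : ℤ) (p : ℕ), 1 ≤ N → ReducedForm A B C p →
      C ≤ Y → 3000 * Y ^ 4 ≤ (N : ℤ) ^ K → ∀ y v : Vec, (∀ i, |y i| ≤ Y) → (∀ i, |v i| ≤ Y) →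
      (¬ ∃ I : ℚ[X], Polynomial.C (δ : ℚ) * I ^ 2 =
        (gpoly A B C y v).map (Int.castRingHom ℚ)) →
      ∀ S : Finset Vec, (∀ x ∈ S, Sol A B C δ P x) →
      (((Finset.range N).filter fun i => y + i • v ∈ S).card : ℝ) ≤
        Cst * (N : ℝ) ^ (((2 * K + 2 : ℕ) : ℝ) / ((2 * K + 2 : ℕ) + 1)) := by
  obtain ⟨Cst, hC0, hC⟩ := card_solutions_rpow_le K δ hδ
  refine ⟨Cst, hC0, fun N A B C P Y p hN F hCY hY y v hy hv hnd S hS => ?_⟩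
  have hAC := F.le
  have hA0 := F.pos
  have hA : |A| ≤ Y := by rw [abs_of_pos hA0]; linarith
  have hB : |B| ≤ Y := F.abs_le.trans (by linarith)
  have hC' : |C| ≤ Y := by rw [abs_of_pos F.C_pos]; linarith
  have hY1 : 1 ≤ Y := by linarith
  rw [← card_image_natCast]
  refine hC N hN (gpoly A B C y v) (natDegree_gpoly_le _ _ _ _ _)
    (fun i => (abs_coeff_gpoly_le hY1 hA hB hC' hy hv i).trans hY) hnd _ ?_ ?_
  · simp only [Finset.forall_mem_image, Finset.mem_filter, Finset.mem_range]
    rintro i ⟨hi, -⟩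
    exact ⟨by positivity, by exact_mod_cast hi⟩
  · simp only [Finset.forall_mem_image, Finset.mem_filter, Finset.mem_range]
    rintro i ⟨-, hi⟩
    have hx := hS _ hi
    obtain ⟨z, hz⟩ := hx.eqn
    refine ⟨z, ?_, ?_⟩
    · set x := y + i • v
      have hr : 0 ≤ rf A B C x := by
        have h1 := four_sq_mul_rf A B C x
        have h2 : 0 ≤ 4 * A ^ 2 * rf A B C x := by
          rw [h1]; have := F.disc_pos; positivity
        exact nonneg_of_mul_nonneg_right h2 (by positivity)
      have h3 : z ^ 2 ≤ (nf x - 4 * (4 * A * C - B ^ 2)) ^ 2 := by nlinarith [sq_nonneg z]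
      have h4 := sq_le_sq.mp h3
      refine h4.trans ?_
      have h5 : |x 0 * x 2| ≤ 4 * (A * C) := by
        rw [abs_mul]
        calc |x 0| * |x 2| ≤ (2 * A) * (2 * C) :=
              mul_le_mul hx.b0 hx.b2 (abs_nonneg _) (by linarith)
          _ = _ := by ring
      have h6 := F.sq_B_le
      have h7 : A * C ≤ Y ^ 2 := by rw [sq]; exact mul_le_mul (by linarith) hCY F.C_pos.le (by linarith)
      have h8 : Y ^ 2 ≤ Y ^ 4 := pow_le_pow_right₀ hY1 (by norm_num)
      have h9 : |nf x - 4 * (4 * A * C - B ^ 2)| ≤ 100 * (A * C) := by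
        have h10 := hx.b1
        have h11 := hx.b3
        rw [abs_le] at h5 ⊢
        unfold nf
        constructor <;> nlinarith [h5.1, h5.2, sq_nonneg (x 1), sq_nonneg (x 3), sq_nonneg B]
      have h12 : 0 ≤ Y ^ 4 := by positivity
      linarith
    · rw [eval_gpoly, hz]
      simp

open Polynomial in
/-- A quartic which is `δ` times a square has the expected coefficients. -/
lemma exists_coeff_eq_of_sq {δ : ℤ} (hδ : 0 < δ) {G : ℤ[X]} (hG : G.natDegree ≤ 4)
    (h : ∃ I : ℚ[X], Polynomial.C (δ : ℚ) * I ^ 2 = G.map (Int.castRingHom ℚ)) :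
    ∃ a b c : ℚ, (G.coeff 0 : ℚ) = δ * c ^ 2 ∧ (G.coeff 1 : ℚ) = δ * (2 * b * c) ∧
      (G.coeff 2 : ℚ) = δ * (b ^ 2 + 2 * a * c) ∧ (G.coeff 3 : ℚ) = δ * (2 * a * b) ∧
      (G.coeff 4 : ℚ) = δ * a ^ 2 := by
  obtain ⟨I, hI⟩ := h
  have hδ' : (δ : ℚ) ≠ 0 := by exact_mod_cast hδ.ne'
  have hd : I.natDegree ≤ 2 := by
    have h1 : (Polynomial.C (δ : ℚ) * I ^ 2).natDegree ≤ 4 := by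
      rw [hI]; exact natDegree_map_le.trans hG
    rw [natDegree_C_mul hδ', natDegree_pow] at h1
    omega
  have hI' : I = Polynomial.C (I.coeff 0) + Polynomial.C (I.coeff 1) * X +
      Polynomial.C (I.coeff 2) * X ^ 2 := by
    conv_lhs => rw [I.as_sum_range' 3 (by omega)]
    simp [Finset.sum_range_succ, ← C_mul_X_pow_eq_monomial]
  have hc : ∀ i, (G.coeff i : ℚ) = δ * (I ^ 2).coeff i := fun i => by
    rw [← coeff_C_mul, hI, coeff_map]; simp
  have hsq : I ^ 2 = Polynomial.C (I.coeff 0 ^ 2) +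
      Polynomial.C (2 * I.coeff 1 * I.coeff 0) * X ^ 1 +
      Polynomial.C (I.coeff 1 ^ 2 + 2 * I.coeff 2 * I.coeff 0) * X ^ 2 +
      Polynomial.C (2 * I.coeff 2 * I.coeff 1) * X ^ 3 + Polynomial.C (I.coeff 2 ^ 2) * X ^ 4 := by
    conv_lhs => rw [hI']
    simp only [map_add, map_mul, map_pow, C_ofNat]
    ring
  refine ⟨I.coeff 2, I.coeff 1, I.coeff 0, ?_, ?_, ?_, ?_, ?_⟩ <;> rw [hc, hsq] <;>
    simp only [Polynomial.coeff_add, Polynomial.coeff_C_mul, Polynomial.coeff_X_pow,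
      Polynomial.coeff_C] <;> norm_num

/-- The lines on which the defining equation degenerates. -/
def Degenerate (A B C δ : ℤ) (y v : Vec) : Prop :=
  ∃ I : Polynomial ℚ, .C (δ : ℚ) * I ^ 2 = (gpoly A B C y v).map (Int.castRingHom ℚ)

lemma gpoly_add_smul (A B C : ℤ) (y v : Vec) (u : ℤ) :
    gpoly A B C (y + u • v) v = (gpoly A B C y v).comp (.X + .C u) := by
  refine Polynomial.funext fun t => ?_
  rw [Polynomial.eval_comp, eval_gpoly]
  simp only [Polynomial.eval_add, Polynomial.eval_X, Polynomial.eval_C, eval_gpoly]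
  rw [show y + u • v + t • v = y + (t + u) • v by rw [add_smul]; abel]

lemma Degenerate.add_smul {A B C δ : ℤ} {y v : Vec} (h : Degenerate A B C δ y v) (u : ℤ) :
    Degenerate A B C δ (y + u • v) v := by
  obtain ⟨I, hI⟩ := h
  refine ⟨I.comp (.X + .C (u : ℚ)), ?_⟩
  rw [gpoly_add_smul, Polynomial.map_comp, ← hI]
  simp

/-- Averaging a set of solutions over nondegenerate progressions. -/
lemma card_mul_le_of_lines (K : ℕ) (δ : ℤ) (hδ : 0 < δ) :
    ∃ Cst : ℝ, 0 < Cst ∧ ∀ (N : ℕ) (A B C P Y : ℤ) (p : ℕ), 1 ≤ N → ReducedForm A B C p →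
      C ≤ Y → 3000 * Y ^ 4 ≤ (N : ℤ) ^ K → ∀ (S : Finset Vec) (V : Vec → Vec),
      (∀ x ∈ S, Sol A B C δ P x) →
      (∀ x ∈ S, ∀ i < N, V (x - i • V x) = V x ∧ (∀ j, |(x - i • V x) j| ≤ Y) ∧
        (∀ j, |V x j| ≤ Y) ∧ ¬ Degenerate A B C δ (x - i • V x) (V x)) →
      ∃ S' : Finset Vec, (∀ y ∈ S', ∃ x ∈ S, ∃ i < N, y = x - i • V x) ∧
        (S.card : ℝ) * N ≤
          S'.card * (Cst * (N : ℝ) ^ (((2 * K + 2 : ℕ) : ℝ) / ((2 * K + 2 : ℕ) + 1))) := by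
  classical
  obtain ⟨Cst, hC0, hC⟩ := card_line_le K δ hδ
  refine ⟨Cst, hC0, fun N A B C P Y p hN F hCY hY S V hS hV => ?_⟩
  let S' : Finset Vec := S.biUnion fun x => (Finset.range N).image fun i => x - i • V x
  have hS' : ∀ y ∈ S', ∃ x ∈ S, ∃ i < N, y = x - i • V x := by
    intro y hy
    obtain ⟨x, hx, hy⟩ := Finset.mem_biUnion.mp hy
    obtain ⟨i, hi, rfl⟩ := Finset.mem_image.mp hy
    exact ⟨x, hx, i, Finset.mem_range.mp hi, rfl⟩
  refine ⟨S', hS', ?_⟩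
  set t : ℝ := Cst * (N : ℝ) ^ (((2 * K + 2 : ℕ) : ℝ) / ((2 * K + 2 : ℕ) + 1))
  have ht : 0 ≤ t := by positivity
  have key := card_mul_le_of_progressions (S := S) (S' := S') V N ⌊t⌋₊ ?_ ?_
  · calc (S.card : ℝ) * N ≤ S'.card * (⌊t⌋₊ : ℝ) := by exact_mod_cast key
      _ ≤ S'.card * t := by gcongr; exact Nat.floor_le ht
  · intro x hx i hi
    exact ⟨Finset.mem_biUnion.mpr ⟨x, hx, Finset.mem_image_of_mem _ (Finset.mem_range.mpr hi)⟩,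
      (hV x hx i hi).1⟩
  · intro y hy
    obtain ⟨x, hx, i, hi, rfl⟩ := hS' y hy
    obtain ⟨h1, h2, h3, h4⟩ := hV x hx i hi
    rw [h1]
    exact Nat.le_floor (hC N A B C P Y p hN F hCY hY _ _ h2 h3 h4 S hS)

namespace ReducedForm

/-- Solutions on the boundary `|x₀| = 2A`. -/
lemma card_boundary_le {A B C δ : ℤ} {p : ℕ} (F : ReducedForm A B C p) {m M : ℕ}
    (hM : 2 * C ≤ M) (S : Finset Vec) (hS : ∀ x ∈ S, Sol A B C δ ((p : ℤ) ^ m) x)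
    (h0 : ∀ x ∈ S, |x 0| = 2 * A) : S.card ≤ (2 * (M / p ^ m) + 2) * 4 := by
  classical
  have h1 : S.card ≤ (2 * (M / p ^ m) + 2) * (S.image fun x => (x 0, x 1)).card := by
    refine Finset.card_le_mul_card_image _ _ fun r hr => ?_
    rw [← Finset.card_image_of_injOn (f := fun x : Vec => x 2)]
    · refine card_le_of_congr (pow_pos F.prime.pos m) _ ?_ ?_
      · simp only [Finset.forall_mem_image, Finset.mem_filter]
        rintro x ⟨hx, -⟩
        exact (hS x hx).b2.trans hM
      · simp only [Finset.forall_mem_image, Finset.mem_filter]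
        rintro x ⟨hx, hxr⟩ y ⟨hy, hyr⟩
        obtain ⟨e0, e1⟩ := Prod.mk.inj (hxr.trans hyr.symm)
        push_cast
        refine F.prime_int.pow_dvd_of_dvd_mul_left _ F.not_dvd ?_
        obtain ⟨s, hs⟩ := (hS x hx).adm.h02
        obtain ⟨s', hs'⟩ := (hS y hy).adm.h02
        obtain ⟨t, ht⟩ := (hS x hx).adm.h21
        obtain ⟨t', ht'⟩ := (hS y hy).adm.h21
        refine ⟨4 * C * (s' - s) - B * (t - t'), ?_⟩
        linear_combination -4 * C * hs + 4 * C * hs' - B * ht + B * ht' + 4 * C ^ 2 * e0 - B * C * e1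
    · intro x hx y hy hxy
      simp only [Finset.coe_filter, Set.mem_ofPred_eq] at hx hy
      obtain ⟨e0, e1⟩ := Prod.mk.inj (hx.2.trans hy.2.symm)
      have e3 : x 3 = y 3 := by
        rw [((hS x hx.1).bdry (h0 x hx.1)).2, ((hS y hy.1).bdry (h0 y hy.1)).2]
      funext i
      fin_cases i
      exacts [e0, e1, hxy, e3]
  refine h1.trans (Nat.mul_le_mul_left _ ?_)
  have h2 : (S.image fun x => (x 0, x 1)) ⊆
      ({2 * A, -(2 * A)} : Finset ℤ) ×ˢ ({2 * B, -(2 * B)} : Finset ℤ) := by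
    intro r hr
    obtain ⟨x, hx, rfl⟩ := Finset.mem_image.mp hr
    simp only [Finset.mem_product, Finset.mem_insert, Finset.mem_singleton]
    exact ⟨eq_or_eq_neg_of_abs_eq (h0 x hx),
      sq_eq_sq_iff_eq_or_eq_neg.mp ((hS x hx).bdry (h0 x hx)).1⟩
  refine (Finset.card_le_card h2).trans ?_
  rw [Finset.card_product]
  exact Nat.mul_le_mul Finset.card_le_two Finset.card_le_two

lemma not_degenerate_single {A B C δ P : ℤ} (hδ : 0 < δ) (hP : P ≠ 0) {y : Vec}
    (hy : |y 0| < 2 * A) : ¬ Degenerate A B C δ y (Pi.single 2 P) := by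
  intro h
  obtain ⟨a, b, c, -, -, h2, -, h4⟩ := exists_coeff_eq_of_sq hδ (natDegree_gpoly_le _ _ _ _ _) h
  obtain ⟨-, -, e2, -, e4⟩ := coeff_gpoly A B C y (Pi.single 2 P)
  rw [e2] at h2
  rw [e4] at h4
  simp [nf, bn, rf] at h2 h4
  have ha : a = 0 := by
    rcases h4 with h4 | h4
    · exact absurd h4 hδ.ne'
    · exact h4
  rw [ha] at h2
  have h5 : (0 : ℚ) ≤ δ * b ^ 2 := by have : (0 : ℚ) < δ := by exact_mod_cast hδ
                                      positivity
  have h6 : ((y 0 : ℚ)) ^ 2 < (2 * A) ^ 2 := by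
    have : y 0 ^ 2 < (2 * A) ^ 2 := sq_lt_sq.mpr (hy.trans_le (le_abs_self _))
    exact_mod_cast this
  have h7 : (0 : ℚ) < P ^ 2 := by positivity
  nlinarith

lemma sq_le_imp_abs_le {x Y : ℤ} {A C : ℤ} (hA : 0 ≤ A) (hAC : A ≤ C) (hx : x ^ 2 ≤ 16 * (A * C))
    (hY : 4 * C ≤ Y) : |x| ≤ Y := by
  have hC : 0 ≤ C := hA.trans hAC
  refine abs_le_of_sq_le_sq (hx.trans ?_) (by linarith)
  calc 16 * (A * C) ≤ 16 * (C * C) := by gcongr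
    _ = (4 * C) ^ 2 := by ring
    _ ≤ Y ^ 2 := by gcongr

lemma card_long_le (K : ℕ) (δ : ℤ) (hδ : 0 < δ) :
    ∃ Cst : ℝ, 0 < Cst ∧ ∀ (N : ℕ) (A B C : ℤ) (p n : ℕ), 1 ≤ N → ReducedForm A B C p →
      1 ≤ n → 4 * A < (p : ℤ) ^ (4 * n) → N * (p : ℤ) ^ (4 * n) ≤ C →
      3000 * (4 * C) ^ 4 ≤ (N : ℤ) ^ K → ∀ M : Fin 4 → ℕ, 2 * A ≤ M 0 →
      16 * (A * C) ≤ M 1 ^ 2 → 3 * C ≤ M 2 → 16 * (A * C) ≤ M 3 ^ 2 → ∀ S : Finset Vec,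
      (∀ x ∈ S, Sol A B C δ ((p : ℤ) ^ (4 * n)) x) → (∀ x ∈ S, |x 0| ≠ 2 * A) →
      (S.card : ℝ) * N ≤ (∏ i, (2 * (M i / p ^ (4 * n)) + 2) : ℕ) * (512 * A) *
        (Cst * (N : ℝ) ^ (((2 * K + 2 : ℕ) : ℝ) / ((2 * K + 2 : ℕ) + 1))) := by
  classical
  obtain ⟨Cst, hC0, hCst⟩ := card_mul_le_of_lines K δ hδ
  refine ⟨Cst, hC0, fun N A B C p n hN F hn hAP hNP hY M hM0 hM1 hM2 hM3 S hS h0 => ?_⟩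
  have hP : (0 : ℤ) < (p : ℤ) ^ (4 * n) := pow_pos (by exact_mod_cast F.prime.pos) _
  set P := (p : ℤ) ^ (4 * n) with hPdef
  have hCp := F.C_pos
  have hAp := F.pos
  have hAC := F.le
  have hN1 : (1 : ℤ) ≤ N := by exact_mod_cast hN
  have hshift : ∀ x : Vec, ∀ i : ℕ, (x - i • (Pi.single 2 P : Vec)) 0 = x 0 ∧
      (x - i • (Pi.single 2 P : Vec)) 1 = x 1 ∧
      (x - i • (Pi.single 2 P : Vec)) 2 = x 2 - i * P ∧
      (x - i • (Pi.single 2 P : Vec)) 3 = x 3 := by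
    intro x i; simp
  have hb2 : ∀ x ∈ S, ∀ i < N, |x 2 - i * P| ≤ 3 * C := by
    intro x hx i hi
    have h1 := (hS x hx).b2
    have h2 : (i : ℤ) * P ≤ C := le_trans (by gcongr) hNP
    have h3 : 0 ≤ (i : ℤ) * P := by positivity
    rw [_root_.abs_le] at h1 ⊢
    constructor <;> linarith [h1.1, h1.2]
  have hV : ∀ x ∈ S, ∀ i < N, (Pi.single 2 P : Vec) = Pi.single 2 P ∧
      (∀ j, |(x - i • (Pi.single 2 P : Vec)) j| ≤ 4 * C) ∧
      (∀ j, |(Pi.single 2 P : Vec) j| ≤ 4 * C) ∧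
      ¬ Degenerate A B C δ (x - i • (Pi.single 2 P : Vec)) (Pi.single 2 P) := by
    intro x hx i hi
    obtain ⟨e0, e1, e2, e3⟩ := hshift x i
    refine ⟨rfl, ?_, ?_, not_degenerate_single hδ hP.ne' ?_⟩
    · intro j
      fin_cases j
      · change |(x - i • (Pi.single 2 P : Vec)) 0| ≤ _
        rw [e0]; linarith [(hS x hx).b0]
      · change |(x - i • (Pi.single 2 P : Vec)) 1| ≤ _
        rw [e1]; exact sq_le_imp_abs_le hAp.le hAC (hS x hx).b1 le_rfl
      · change |(x - i • (Pi.single 2 P : Vec)) 2| ≤ _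
        rw [e2]; linarith [hb2 x hx i hi]
      · change |(x - i • (Pi.single 2 P : Vec)) 3| ≤ _
        rw [e3]; exact sq_le_imp_abs_le hAp.le hAC (hS x hx).b3 le_rfl
    · have hPC : P ≤ 4 * C := by nlinarith
      intro j
      fin_cases j <;> simp [abs_of_pos hP] <;> linarith
    · rw [e0]
      exact lt_of_le_of_ne (hS x hx).b0 (h0 x hx)
  obtain ⟨S', hS', hcard⟩ := hCst N A B C P (4 * C) p hN F (by linarith) hY S
    (fun _ => Pi.single 2 P) hS hV
  · refine hcard.trans (mul_le_mul_of_nonneg_right ?_ (by positivity))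
    have hadm : ∀ y ∈ S', Adm A B C P y := by
      intro y hy
      obtain ⟨x, hx, i, hi, rfl⟩ := hS' y hy
      obtain ⟨e0, e1, e2, e3⟩ := hshift x i
      obtain ⟨⟨s, hs⟩, h01, ⟨t, ht⟩, ⟨r, hr⟩⟩ := (hS x hx).adm
      refine ⟨?_, ?_, ?_, ?_⟩
      · rw [e0, e2]; exact ⟨s + A * i, by linear_combination hs⟩
      · rw [e0, e1]; exact h01
      · rw [e1, e2]; exact ⟨t - B * i, by linear_combination ht⟩
      · unfold nf at hr ⊢
        rw [e0, e1, e2, e3]; exact ⟨r - 4 * x 0 * i, by linear_combination hr⟩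
    have h1 := card_le_of_residue_map (m := p ^ (4 * n)) (M := M) (pow_pos F.prime.pos _) S'
      (F.residue P) ?_ ?_
    · calc (S'.card : ℝ) ≤ ((∏ i, (2 * (M i / p ^ (4 * n)) + 2) : ℕ) : ℝ) *
            ((S'.image (F.residue P)).card : ℝ) := by exact_mod_cast h1
        _ ≤ _ := by
          refine mul_le_mul_of_nonneg_left ?_ (by positivity)
          refine F.card_residue_le (n := n) hAP _ ?_ ?_
          · simp only [Finset.forall_mem_image]
            exact fun y hy => F.residue_mem hP (hadm y hy)
          · simp only [Finset.forall_mem_image]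
            intro y hy
            refine ⟨y 0, ?_, ?_, ?_⟩
            · obtain ⟨x, hx, i, hi, rfl⟩ := hS' y hy
              rw [(hshift x i).1]; exact (hS x hx).b0
            · obtain ⟨x, hx, i, hi, rfl⟩ := hS' y hy
              rw [(hshift x i).1]; exact h0 x hx
            · have h2 := (F.dvd_sub_lam (hadm y hy).h02 (hadm y hy).h01 (hadm y hy).h21).1
              have h3 : P ∣ F.lam y - F.lam y % P := Int.dvd_self_sub_emod
              refine (dvd_add h2 (h3.mul_right A)).trans (Eq.dvd ?_)
              simp only [residue]; ring
    · intro y hy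
      obtain ⟨x, hx, i, hi, rfl⟩ := hS' y hy
      obtain ⟨e0, e1, e2, e3⟩ := hshift x i
      intro j
      fin_cases j
      · change |(x - i • (Pi.single 2 P : Vec)) 0| ≤ _
        rw [e0]; exact (hS x hx).b0.trans hM0
      · change |(x - i • (Pi.single 2 P : Vec)) 1| ≤ _
        rw [e1]
        exact abs_le_of_sq_le_sq ((hS x hx).b1.trans hM1) (by positivity)
      · change |(x - i • (Pi.single 2 P : Vec)) 2| ≤ _
        rw [e2]; exact (hb2 x hx i hi).trans hM2
      · change |(x - i • (Pi.single 2 P : Vec)) 3| ≤ _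
        rw [e3]
        exact abs_le_of_sq_le_sq ((hS x hx).b3.trans hM3) (by positivity)
    · intro u hu v hv huv i
      exact_mod_cast F.dvd_sub_of_residue_eq (hadm u hu) (hadm v hv) huv i

end ReducedForm

/-- Integral form of the relations expressing degeneracy of the line `x + ℤ v`. -/
structure DegRel (A B C P c : ℤ) (x v : Vec) : Prop where
  nfv : P * c * nf v = 32 * rf A B C v
  bnv : P * c * bn x v = 32 * br A B C x v
  self : P * c * (2 * (nf x - 4 * (4 * A * C - B ^ 2)) - P * c) = 64 * rf A B C x

lemma nf_smul (k : ℤ) (v : Vec) : nf (k • v) = k ^ 2 * nf v := by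
  simp [nf]; ring

lemma bn_smul (k : ℤ) (x v : Vec) : bn x (k • v) = k * bn x v := by
  simp [bn]; ring

lemma rf_smul (A B C k : ℤ) (v : Vec) : rf A B C (k • v) = k ^ 2 * rf A B C v := by
  simp [rf]; ring

lemma br_smul (A B C k : ℤ) (x v : Vec) : br A B C x (k • v) = k * br A B C x v := by
  simp [br]; ring

lemma DegRel.of_smul {A B C P c k : ℤ} {x v : Vec} (hk : k ≠ 0)
    (h : DegRel A B C P c x (k • v)) : DegRel A B C P c x v := by
  obtain ⟨h1, h2, h3⟩ := h
  rw [nf_smul, rf_smul] at h1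
  rw [bn_smul, br_smul] at h2
  exact ⟨mul_left_cancel₀ (pow_ne_zero 2 hk) (by linear_combination h1),
    mul_left_cancel₀ hk (by linear_combination h2), h3⟩

lemma Adm.sq_dvd_rf {A B C P : ℤ} {x : Vec} (hx : Adm A B C P x) : P ^ 2 ∣ rf A B C x := by
  obtain ⟨s, hs⟩ := hx.h02
  obtain ⟨t, ht⟩ := hx.h01
  obtain ⟨r, hr⟩ := hx.h21
  exact ⟨s ^ 2 + t * r, by unfold rf; rw [hs, ht, hr]; ring⟩

lemma Degenerate.exists_degRel {A B C δ P : ℤ} {x v : Vec} (hδ : 0 < δ) (hP : P ≠ 0)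
    (hx : Adm A B C P x) (hv : nf v ≠ 0) (h : Degenerate A B C δ x v) :
    ∃ c, DegRel A B C P c x v := by
  obtain ⟨a, b, c, h0, h1, h2, h3, h4⟩ := exists_coeff_eq_of_sq hδ (natDegree_gpoly_le _ _ _ _ _) h
  obtain ⟨e0, e1, e2, e3, e4⟩ := coeff_gpoly A B C x v
  rw [e0] at h0
  rw [e1] at h1
  rw [e2] at h2
  rw [e3] at h3
  rw [e4] at h4
  obtain ⟨f, hf⟩ := hx.hnf
  obtain ⟨r, hr⟩ := hx.sq_dvd_rf
  set φ := nf x - 4 * (4 * A * C - B ^ 2)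
  set R := rf A B C x
  set T := rf A B C v
  set S := br A B C x v
  set β := bn x v
  set ν := nf v
  push_cast at h0 h1 h2 h3 h4
  have hν : (ν : ℚ) ≠ 0 := by exact_mod_cast hv
  have hδ' : (δ : ℚ) ≠ 0 := by exact_mod_cast hδ.ne'
  have ha : a ≠ 0 := by
    rintro rfl
    apply hν
    simpa using h4
  obtain ⟨κ, hκ⟩ : ∃ κ : ℚ, κ * a = ν := ⟨ν / a, by field_simp⟩
  have hδκ : (δ : ℚ) = κ ^ 2 := by
    have : a ^ 2 * ((δ : ℚ) - κ ^ 2) = 0 := by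
      linear_combination -h4 - (ν + κ * a) * hκ
    rcases mul_eq_zero.mp this with h5 | h5
    · exact absurd h5 (pow_ne_zero 2 ha)
    · linarith
  rw [hδκ] at h0 h1 h2 h3
  have hb : κ * b = β := by
    have : (2 * (ν : ℚ)) * (κ * b - β) = 0 := by
      linear_combination -h3 - 2 * κ * b * hκ
    rcases mul_eq_zero.mp this with h5 | h5
    · exact absurd h5 (mul_ne_zero two_ne_zero hν)
    · linarith
  set c0 : ℚ := φ - κ * c with hc0
  have q0 : c0 * (2 * φ - c0) = 64 * R := by
    rw [hc0]; linear_combination h0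
  have q1 : c0 * β = 32 * S := by
    rw [hc0]; linear_combination h1 / 2 + κ * c * hb
  have q2 : c0 * ν = 32 * T := by
    rw [hc0]; linear_combination h2 / 2 + κ * c * hκ + (κ * b + β) / 2 * hb
  have hPq : (P : ℚ) ≠ 0 := by exact_mod_cast hP
  have hfq : (φ : ℚ) = P * f := by exact_mod_cast hf
  have hrq : (R : ℚ) = P ^ 2 * r := by exact_mod_cast hr
  set c1 : ℚ := c0 / P with hc1
  have hc01 : c0 = P * c1 := by rw [hc1]; field_simp
  have q3 : c1 ^ 2 - 2 * f * c1 + 64 * r = 0 := by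
    have : (P : ℚ) ^ 2 * (c1 ^ 2 - 2 * f * c1 + 64 * r) = 0 := by
      rw [hc01, hfq, hrq] at q0
      linear_combination -q0
    exact (mul_eq_zero.mp this).resolve_left (pow_ne_zero 2 hPq)
  have hint : IsIntegral ℤ c1 := by
    refine ⟨.X ^ 2 - .C (2 * f) * .X + .C (64 * r), ?_, ?_⟩
    · monicity!
    · simp only [Polynomial.eval₂_add, Polynomial.eval₂_sub, Polynomial.eval₂_mul,
        Polynomial.eval₂_pow, Polynomial.eval₂_X, Polynomial.eval₂_C]
      simp only [algebraMap_int_eq, eq_intCast]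
      push_cast
      exact q3
  obtain ⟨z, hz⟩ := IsIntegrallyClosed.isIntegral_iff.mp hint
  have hz' : c0 = P * z := by rw [hc01, ← hz]; simp
  rw [hz'] at q0 q1 q2
  refine ⟨z, ?_, ?_, ?_⟩
  · exact_mod_cast q2
  · exact_mod_cast q1
  · exact_mod_cast q0

/-- The determinant of `(A, B, C)` and the first three coordinates of `x`, `v`. -/
def dt (A B C : ℤ) (x v : Vec) : ℤ :=
  A * (x 1 * v 2 - x 2 * v 1) - B * (x 0 * v 2 - x 2 * v 0) + C * (x 0 * v 1 - x 1 * v 0)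

lemma rf_mul_dt_sq (A B C : ℤ) (w x v : Vec) :
    rf A B C w * dt A B C x v ^ 2 = dt A B C w v ^ 2 * rf A B C x +
      dt A B C w v * dt A B C x w * br A B C x v + dt A B C x w ^ 2 * rf A B C v := by
  simp only [rf, dt, br]; ring

lemma disc_mul_dt_sq (A B C : ℤ) (x v : Vec) :
    (4 * A * C - B ^ 2) * dt A B C x v ^ 2 =
      4 * rf A B C x * rf A B C v - br A B C x v ^ 2 := by
  simp only [rf, dt, br]; ring

lemma four_br (A B C : ℤ) (x v : Vec) :
    4 * br A B C x v = 2 * tf A B C x * tf A B C v -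
      (4 * A * C - B ^ 2) * (bn x v - 2 * x 3 * v 3) := by
  simp only [br, tf, bn]; ring

lemma Adm.dvd_dt {A B C P : ℤ} {x : Vec} (hx : Adm A B C P x) (v : Vec) : P ∣ dt A B C x v := by
  obtain ⟨s, hs⟩ := hx.h02
  obtain ⟨t, ht⟩ := hx.h01
  obtain ⟨r, hr⟩ := hx.h21
  refine ⟨v 1 * s - v 2 * t + v 0 * r, ?_⟩
  unfold dt
  linear_combination v 1 * hs - v 2 * ht + v 0 * hr

lemma nf_add (x y : Vec) : nf (x + y) = nf x + bn x y + nf y := by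
  simp [nf, bn]; ring

/-- The second invariant of a degenerate pair. -/
def th (A B C : ℤ) (x v : Vec) : ℤ := v 3 * tf A B C x - tf A B C v * x 3

lemma dt_sub (A B C : ℤ) (x y v : Vec) : dt A B C (x - y) v = dt A B C x v - dt A B C y v := by
  simp [dt]; ring

lemma th_sub (A B C : ℤ) (x y v : Vec) : th A B C (x - y) v = th A B C x v - th A B C y v := by
  simp [th, tf]; ring

lemma bn_sub_left (x y v : Vec) : bn (x - y) v = bn x v - bn y v := by
  simp [bn]; ring

lemma br_sub_left (A B C : ℤ) (x y v : Vec) :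
    br A B C (x - y) v = br A B C x v - br A B C y v := by
  simp [br]; ring

namespace ReducedForm

lemma rf_nonneg {A B C : ℤ} {p : ℕ} (F : ReducedForm A B C p) (x : Vec) : 0 ≤ rf A B C x := by
  have h1 := four_sq_mul_rf A B C x
  have h2 : 0 ≤ 4 * A ^ 2 * rf A B C x := by
    rw [h1]; have := F.disc_pos; positivity
  have := F.pos
  exact nonneg_of_mul_nonneg_right h2 (by positivity)

lemma dvd_of_forall_rf {A B C : ℤ} {p : ℕ} (F : ReducedForm A B C p) {c n : ℤ}
    (h : ∀ w, c ∣ rf A B C w * n) : c ∣ n := by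
  obtain ⟨a, b, e, habc⟩ := F.primitive
  obtain ⟨r0, h0⟩ := h ![1, 0, 0, 0]
  obtain ⟨r1, h1⟩ := h ![0, 1, 0, 0]
  obtain ⟨r2, h2⟩ := h ![0, 0, 1, 0]
  obtain ⟨r3, h3⟩ := h ![1, 1, 0, 0]
  obtain ⟨r4, h4⟩ := h ![0, 1, 1, 0]
  obtain ⟨r5, h5⟩ := h ![1, 0, 1, 0]
  simp [rf] at h0 h1 h2 h3 h4 h5
  have m00 : A ^ 2 * n = c * r2 := by linear_combination h2
  have m22 : C ^ 2 * n = c * r0 := by linear_combination h0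
  have m02 : A * C * n = c * r1 := by linear_combination h1
  have m12 : B * C * n = c * (r0 + r1 - r3) := by linear_combination h0 + h1 - h3
  have m01 : A * B * n = c * (r2 + r1 - r4) := by linear_combination h2 + h1 - h4
  have m11 : B ^ 2 * n = c * (r5 - r0 - r2 + 2 * r1) := by
    linear_combination h5 - h0 - h2 + 2 * h1
  refine ⟨a ^ 2 * r2 + b ^ 2 * (r5 - r0 - r2 + 2 * r1) + e ^ 2 * r0 +
    2 * a * b * (r2 + r1 - r4) + 2 * a * e * r1 + 2 * b * e * (r0 + r1 - r3), ?_⟩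
  linear_combination a ^ 2 * m00 + b ^ 2 * m11 + e ^ 2 * m22 + 2 * a * b * m01 +
    2 * a * e * m02 + 2 * b * e * m12 - n * (1 + a * A + b * B + e * C) * habc

end ReducedForm

namespace DegRel

variable {A B C P c : ℤ} {x v : Vec}

lemma abs_le (h : DegRel A B C P c x v) {p : ℕ} (F : ReducedForm A B C p) :
    |P * c| ≤ 2 * |nf x - 4 * (4 * A * C - B ^ 2)| := by
  have h1 := h.self
  have h2 := F.rf_nonneg x
  set φ := nf x - 4 * (4 * A * C - B ^ 2)
  rw [show 2 * |φ| = |2 * φ| by rw [abs_mul]; norm_num]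
  by_contra hlt
  push Not at hlt
  have h3 : (2 * φ) ^ 2 < (P * c) ^ 2 := sq_lt_sq.mpr hlt
  nlinarith

lemma disc_eq (h : DegRel A B C P c x v) :
    1024 * (4 * A * C - B ^ 2) * dt A B C x v ^ 2 = (P * c) ^ 2 *
      (4 * (nf x - 4 * (4 * A * C - B ^ 2)) * nf v - 2 * (P * c) * nf v - bn x v ^ 2) := by
  have h0 := disc_mul_dt_sq A B C x v
  linear_combination 1024 * h0 - 32 * rf A B C v * 2 * h.self -
    2 * (P * c) * (2 * (nf x - 4 * (4 * A * C - B ^ 2)) - P * c) * h.nfv +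
    (P * c * bn x v + 32 * br A B C x v) * h.bnv

lemma th_eq (h : DegRel A B C P c x v) {p : ℕ} (F : ReducedForm A B C p) :
    16 * (P * c) ^ 2 * th A B C x v ^ 2 =
      (P * c + 8 * (4 * A * C - B ^ 2)) ^ 2 * (64 * dt A B C x v ^ 2 + nf v * (P * c) ^ 2) := by
  have hd := h.disc_eq
  obtain ⟨h1, h2, h3⟩ := h
  have f1 := four_rf A B C x
  have f2 := four_rf A B C v
  have f3 := four_br A B C x v
  have hE := F.disc_pos
  set E := 4 * A * C - B ^ 2 with hEdef
  set c0 := P * c with hc0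
  have g1 : 16 * (tf A B C x ^ 2 + E * x 3 ^ 2) =
      (c0 + 8 * E) * (2 * (nf x - 4 * E) - c0 + 8 * E) := by
    have : 4 * x 0 * x 2 - x 1 ^ 2 = nf x - x 3 ^ 2 := by unfold nf; ring
    rw [this] at f1
    linear_combination -16 * f1 - h3
  have g2 : 8 * (tf A B C v ^ 2 + E * v 3 ^ 2) = nf v * (c0 + 8 * E) := by
    have : 4 * v 0 * v 2 - v 1 ^ 2 = nf v - v 3 ^ 2 := by unfold nf; ring
    rw [this] at f2
    linear_combination -8 * f2 - h1
  have g3 : 16 * (tf A B C x * tf A B C v + E * (x 3 * v 3)) = bn x v * (c0 + 8 * E) := by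
    linear_combination -8 * f3 - h2
  have g4 : E * th A B C x v ^ 2 = (tf A B C x ^ 2 + E * x 3 ^ 2) *
      (tf A B C v ^ 2 + E * v 3 ^ 2) - (tf A B C x * tf A B C v + E * (x 3 * v 3)) ^ 2 := by
    unfold th; ring
  have g5 : 256 * (E * th A B C x v ^ 2) = (c0 + 8 * E) ^ 2 *
      (2 * nf v * (2 * (nf x - 4 * E) - c0 + 8 * E) - bn x v ^ 2) := by
    linear_combination 256 * g4 + 2 * (8 * (tf A B C v ^ 2 + E * v 3 ^ 2)) * g1 +
      2 * ((c0 + 8 * E) * (2 * (nf x - 4 * E) - c0 + 8 * E)) * g2 -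
      (16 * (tf A B C x * tf A B C v + E * (x 3 * v 3)) + bn x v * (c0 + 8 * E)) * g3
  have hE16 : (16 * E) ≠ 0 := by positivity
  refine mul_left_cancel₀ hE16 ?_
  linear_combination c0 ^ 2 * g5 - (c0 + 8 * E) ^ 2 * hd

lemma dvd_sq (h : DegRel A B C P c x v) {p : ℕ} (F : ReducedForm A B C p) (hP : P ≠ 0)
    (hx : Adm A B C P x) {d : ℤ} (hd : dt A B C x v = P * d) : c ∣ 64 * d ^ 2 := by
  refine F.dvd_of_forall_rf fun w => ?_
  have h1 := rf_mul_dt_sq A B C w x v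
  obtain ⟨f, hf⟩ := hx.hnf
  obtain ⟨e, he⟩ := hx.dvd_dt w
  rw [show dt A B C x w = P * e from he, hd] at h1
  have h3 := h.self
  rw [hf] at h3
  refine ⟨dt A B C w v ^ 2 * (2 * f - c) + 2 * dt A B C w v * e * bn x v + 2 * P * e ^ 2 * nf v, ?_⟩
  refine mul_left_cancel₀ (pow_ne_zero 2 hP) ?_
  linear_combination 64 * h1 - dt A B C w v ^ 2 * h3 - 2 * dt A B C w v * (P * e) * h.bnv -
    2 * (P * e) ^ 2 * h.nfv

/-- Points sharing both invariants differ by a multiple of the direction. -/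
lemma parallel {x' : Vec} (h : DegRel A B C P c x v) (h' : DegRel A B C P c x' v) {p : ℕ}
    (F : ReducedForm A B C p) (hpP : (p : ℤ) ∣ P) (hP : P ≠ 0) (hc : c ≠ 0) (hv : nf v ≠ 0)
    (hdt : dt A B C x v = dt A B C x' v) (hth : th A B C x v = th A B C x' v) (i l : Fin 4) :
    v i * (x' l - x l) = (x' i - x i) * v l := by
  have hE := F.disc_pos
  have hnot := F.not_dvd
  have hnd2 := F.not_dvd_two
  have hc0 : P * c ≠ 0 := mul_ne_zero hP hc
  have hr : rf A B C v ≠ 0 := fun h0 => by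
    have := h.nfv
    rw [h0, mul_zero] at this
    exact mul_ne_zero hc0 hv this
  set y := x' - x with hy
  have hdy : dt A B C y v = 0 := by rw [hy, dt_sub, hdt, sub_self]
  have hty : th A B C y v = 0 := by rw [hy, th_sub, hth, sub_self]
  have hby : P * c * bn y v = 32 * br A B C y v := by
    rw [hy, bn_sub_left, br_sub_left]
    linear_combination h'.bnv - h.bnv
  set r := rf A B C v
  set m := br A B C y v
  set w : Vec := (2 * r) • y - m • v with hw
  have hrw : rf A B C w = 0 := by
    have h1 := disc_mul_dt_sq A B C y v
    rw [hdy] at h1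
    have h2 : rf A B C w = (2 * r) ^ 2 * rf A B C y - 2 * r * m * m + m ^ 2 * r := by
      simp [hw, rf, m, r, br]; ring
    rw [h2]
    linear_combination (-r) * h1
  have hlam := F.eq_lam_of_rf_eq_zero hrw
  have htw : th A B C w v = 0 := by
    have : th A B C w v = 2 * r * th A B C y v := by simp [hw, th, tf]; ring
    rw [this, hty, mul_zero]
  have hh : tf A B C w * tf A B C v + (4 * A * C - B ^ 2) * (w 3 * v 3) = 0 := by
    have f1 := four_br A B C y v
    have f2 := four_rf A B C v
    have f3 : tf A B C w = 2 * r * tf A B C y - m * tf A B C v := by simp [hw, tf]; ring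
    have f4 : w 3 = 2 * r * y 3 - m * v 3 := by simp [hw]
    have f5 : 4 * v 0 * v 2 - v 1 ^ 2 = nf v - v 3 ^ 2 := by unfold nf; ring
    rw [f5] at f2
    have f6 : r * bn y v = m * nf v := by
      refine mul_left_cancel₀ hc0 ?_
      linear_combination r * hby - m * h.nfv
    rw [f3, f4]
    linear_combination (-r) * f1 + m * f2 + (4 * A * C - B ^ 2) * f6
  have hHv : tf A B C v ^ 2 + (4 * A * C - B ^ 2) * v 3 ^ 2 ≠ 0 := by
    intro h0
    have f2 := four_rf A B C v
    have f5 : 4 * v 0 * v 2 - v 1 ^ 2 = nf v - v 3 ^ 2 := by unfold nf; ring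
    rw [f5] at f2
    have f7 : nf v * (P * c + 8 * (4 * A * C - B ^ 2)) = 0 := by
      linear_combination h.nfv + 8 * f2 + 8 * h0
    have f8 := (mul_eq_zero.mp f7).resolve_left hv
    have f9 : (p : ℤ) ∣ 2 * (4 * (4 * A * C - B ^ 2)) := by
      obtain ⟨q, hq⟩ := hpP
      exact ⟨-(q * c), by linear_combination f8 - c * hq⟩
    rcases F.prime_int.dvd_or_dvd f9 with f9 | f9
    exacts [hnd2 f9, F.not_dvd_four_mul f9]
  have htf : tf A B C w = 0 := by
    refine (mul_eq_zero.mp (?_ : tf A B C w * _ = 0)).resolve_right hHv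
    unfold th at htw
    linear_combination tf A B C v * hh + (4 * A * C - B ^ 2) * v 3 * htw
  have hw3 : w 3 = 0 := by
    refine (mul_eq_zero.mp (?_ : w 3 * _ = 0)).resolve_right hHv
    unfold th at htw
    linear_combination v 3 * hh - tf A B C v * htw
  have hl0 : F.lam w = 0 := by
    have : F.lam w * (4 * A * C - B ^ 2) = 0 := by
      rw [← htf, tf]; rw [hlam.1, hlam.2.1, hlam.2.2]; ring
    exact (mul_eq_zero.mp this).resolve_right hE.ne'
  have hw0 : ∀ l, w l = 0 := by
    obtain ⟨e0, e1, e2⟩ := hlam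
    rw [hl0, zero_mul] at e0 e1 e2
    intro l; fin_cases l
    exacts [e0, e1, e2, hw3]
  have hyv : ∀ l, 2 * r * y l = m * v l := fun l => by
    have := hw0 l
    simp [hw] at this
    linarith
  have h2r : 2 * r ≠ 0 := mul_ne_zero two_ne_zero hr
  change v i * y l = y i * v l
  refine mul_left_cancel₀ h2r ?_
  linear_combination v i * hyv l - v l * hyv i

end DegRel

/-- The isotropic tangent direction at the point of the conic with coordinates `(l, d)`. -/
def tau (A B C l d : ℤ) : Vec := ![-(d * A), -(d * B), -(d * C), (4 * A * C - B ^ 2) * l]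

lemma nf_tau (A B C l d : ℤ) :
    nf (tau A B C l d) = (4 * A * C - B ^ 2) * ((4 * A * C - B ^ 2) * l ^ 2 + d ^ 2) := by
  simp [nf, tau]; ring

lemma nf_dvd_sub {q : ℤ} {v w : Vec} (h : ∀ i, q ∣ v i - w i) : q ∣ nf v - nf w := by
  obtain ⟨a, ha⟩ := h 0
  obtain ⟨b, hb⟩ := h 1
  obtain ⟨c, hc⟩ := h 2
  obtain ⟨d, hd⟩ := h 3
  refine ⟨4 * v 0 * c + 4 * a * w 2 - b * (v 1 + w 1) + d * (v 3 + w 3), ?_⟩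
  unfold nf
  linear_combination 4 * v 0 * hc + 4 * w 2 * ha - (v 1 + w 1) * hb + (v 3 + w 3) * hd

lemma nf_ne_zero_of_congr {p : ℕ} (hp : p.Prime) {t : Vec} (ht : ¬ (p : ℤ) ∣ nf t) :
    ∀ (j : ℕ) (v : Vec) (ν : ℤ), (∃ i, v i ≠ 0) → (∀ i, |v i| < (p : ℤ) ^ j) →
      (∀ i, (p : ℤ) ^ j ∣ v i - ν * t i) → nf v ≠ 0 := by
  have hpi := Nat.prime_iff_prime_int.mp hp
  have hp0 : (0 : ℤ) < p := by exact_mod_cast hp.pos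
  intro j
  induction j with
  | zero =>
    rintro v ν ⟨i, hi⟩ hlt -
    exact absurd (Int.abs_lt_one_iff.mp (by simpa using hlt i)) hi
  | succ j ih =>
    intro v ν hi hlt hd
    have hdp : ∀ i, (p : ℤ) ∣ v i - ν * t i := fun i => (dvd_pow_self _ (by omega)).trans (hd i)
    by_cases hν : (p : ℤ) ∣ ν
    · obtain ⟨ν', rfl⟩ := hν
      have hv : ∀ i, (p : ℤ) ∣ v i := fun i => by
        obtain ⟨s, hs⟩ := hdp i
        exact ⟨s + ν' * t i, by linear_combination hs⟩
      choose w hw using hv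
      have hvw : v = (p : ℤ) • (w : Vec) := by funext i; simp [hw]
      have := ih w ν' ?_ ?_ ?_
      · rw [hvw, nf_smul]
        exact mul_ne_zero (pow_ne_zero 2 hp0.ne') this
      · obtain ⟨i, hi⟩ := hi
        exact ⟨i, fun h => hi (by rw [hw, h, mul_zero])⟩
      · intro i
        have h1 := hlt i
        rw [hw, abs_mul, abs_of_pos hp0, pow_succ'] at h1
        exact lt_of_mul_lt_mul_left h1 hp0.le
      · intro i
        have h1 := hd i
        rw [hw, pow_succ', mul_assoc, ← mul_sub] at h1
        exact Int.dvd_of_mul_dvd_mul_left hp0.ne' h1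
    · intro h0
      have h1 := nf_dvd_sub (v := v) (w := ν • t) (q := p) (fun i => by simpa using hdp i)
      rw [h0, nf_smul, zero_sub, dvd_neg] at h1
      rcases hpi.dvd_or_dvd h1 with h1 | h1
      exacts [hν (hpi.dvd_of_dvd_pow h1), ht h1]

namespace ReducedForm

lemma exists_direction {A B C : ℤ} {p : ℕ} (F : ReducedForm A B C p) {e j : ℕ}
    (hj : 3 * j < 4 * e) (hej : e < j) {l d : ℤ}
    (hld : (p : ℤ) ∣ (4 * A * C - B ^ 2) * l ^ 2 + d ^ 2 - 4 * (4 * A * C - B ^ 2)) :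
    ∃ v : Vec, (∀ i, |v i| < (p : ℤ) ^ e) ∧
      (∃ ν, ∀ i, (p : ℤ) ^ j ∣ v i - ν * tau A B C l d i) ∧ nf v ≠ 0 := by
  classical
  have hpi := F.prime_int
  have hp1 := F.prime.one_lt
  have ht : ¬ (p : ℤ) ∣ nf (tau A B C l d) := by
    rw [nf_tau]
    intro h
    rcases hpi.dvd_or_dvd h with h | h
    · exact F.not_dvd h
    · exact F.not_dvd_four_mul ((dvd_sub h hld).trans (Eq.dvd (by ring)))
  obtain ⟨a, ha⟩ : ∃ a, ¬ (p : ℤ) ∣ tau A B C l d a := by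
    by_contra! hall
    refine ht (((nf_dvd_sub (w := 0) (fun i => by simpa using hall i))).trans (Eq.dvd ?_))
    simp [nf]
  set t := tau A B C l d
  have : NeZero (p ^ j) := ⟨(pow_pos F.prime.pos j).ne'⟩
  have : NeZero (p ^ e) := ⟨(pow_pos F.prime.pos e).ne'⟩
  let f : (Fin 4 → Fin (p ^ e)) → ({i : Fin 4 // i ≠ a} → ZMod (p ^ j)) :=
    fun x i => (((t a * (x i : ℕ) - (x a : ℕ) * t i : ℤ)) : ZMod (p ^ j))
  have hcard : Fintype.card ({i : Fin 4 // i ≠ a} → ZMod (p ^ j)) <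
      Fintype.card (Fin 4 → Fin (p ^ e)) := by
    have h3 : Fintype.card {i : Fin 4 // i ≠ a} = 3 := by
      simp [Fintype.card_subtype_compl]
    rw [Fintype.card_fun, Fintype.card_fun, h3, ZMod.card, Fintype.card_fin, Fintype.card_fin,
      ← pow_mul, ← pow_mul]
    exact Nat.pow_lt_pow_right hp1 (by omega)
  obtain ⟨x, y, hxy, hf⟩ := Fintype.exists_ne_map_eq_of_card_lt f hcard
  let v : Vec := fun i => ((x i : ℕ) : ℤ) - ((y i : ℕ) : ℤ)
  have hv : ∀ i, (p : ℤ) ^ j ∣ t a * v i - v a * t i := by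
    intro i
    by_cases hi : i = a
    · subst hi
      exact (dvd_zero _).trans (Eq.dvd (by ring))
    · have h1 := congrFun hf ⟨i, hi⟩
      simp only [f] at h1
      rw [ZMod.intCast_eq_intCast_iff_dvd_sub] at h1
      push_cast at h1
      refine (dvd_neg.mpr h1).trans (Eq.dvd ?_)
      simp only [v]; ring
  have hlt : ∀ i, |v i| < (p : ℤ) ^ e := by
    intro i
    have h1 := (x i).isLt
    have h2 := (y i).isLt
    zify at h1 h2
    rw [abs_lt]
    constructor <;> simp only [v] <;> linarith [Int.natCast_nonneg (x i : ℕ), Int.natCast_nonneg (y i : ℕ)]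
  have hcop : IsCoprime (t a) ((p : ℤ) ^ j) := by
    refine IsCoprime.pow_right ?_
    exact ((Prime.coprime_iff_not_dvd hpi).mpr ha).symm
  obtain ⟨c, c', hc⟩ := hcop
  have hcong : ∃ ν, ∀ i, (p : ℤ) ^ j ∣ v i - ν * t i := by
    refine ⟨c * v a, fun i => ?_⟩
    obtain ⟨s, hs⟩ := hv i
    exact ⟨c * s + c' * v i, by linear_combination c * hs - v i * hc⟩
  refine ⟨v, hlt, hcong, ?_⟩
  obtain ⟨ν, hν⟩ := hcong
  refine nf_ne_zero_of_congr F.prime ht j v ν ?_ ?_ hν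
  · by_contra! h0
    refine hxy (funext fun i => Fin.ext ?_)
    have := h0 i
    simp only [v] at this
    omega
  · exact fun i => (hlt i).trans_le (pow_le_pow_right₀ (by exact_mod_cast F.prime.one_le) hej.le)

/-- Moving along a tangent direction preserves admissibility. -/
lemma adm_add_smul {A B C : ℤ} {p : ℕ} (F : ReducedForm A B C p) {k j m : ℕ} (hkj : k + j = m)
    (hjk : j ≤ k) {x v : Vec} (hx : Adm A B C ((p : ℤ) ^ m) x) {l d ν : ℤ}
    (hl : (p : ℤ) ^ j ∣ F.lam x - l) (hd : (p : ℤ) ^ j ∣ x 3 - d)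
    (hv : ∀ i, (p : ℤ) ^ j ∣ v i - ν * tau A B C l d i) (u : ℤ) :
    Adm A B C ((p : ℤ) ^ m) (x + u • ((p : ℤ) ^ k • v)) := by
  have hjm : (p : ℤ) ^ j ∣ (p : ℤ) ^ m := pow_dvd_pow _ (by omega)
  have hm : (p : ℤ) ^ m = (p : ℤ) ^ k * (p : ℤ) ^ j := by rw [← hkj, pow_add]
  have hkk : (p : ℤ) ^ m ∣ (p : ℤ) ^ k * (p : ℤ) ^ k := by
    rw [hm]; exact mul_dvd_mul_left _ (pow_dvd_pow _ hjk)
  obtain ⟨e0, e1, e2⟩ := F.dvd_sub_lam hx.h02 hx.h01 hx.h21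
  obtain ⟨s0, hs0⟩ := hjm.trans e0
  obtain ⟨s1, hs1⟩ := hjm.trans e1
  obtain ⟨s2, hs2⟩ := hjm.trans e2
  obtain ⟨a, ha⟩ := hl
  obtain ⟨b, hb⟩ := hd
  obtain ⟨w0, hw0⟩ := hv 0
  obtain ⟨w1, hw1⟩ := hv 1
  obtain ⟨w2, hw2⟩ := hv 2
  obtain ⟨w3, hw3⟩ := hv 3
  simp [tau] at hw0 hw1 hw2 hw3
  set q := (p : ℤ) ^ j
  set E := 4 * A * C - B ^ 2 with hE
  have h02 : q ∣ C * v 0 - A * v 2 := ⟨C * w0 - A * w2, by linear_combination C * hw0 - A * hw2⟩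
  have h01 : q ∣ B * v 0 - A * v 1 := ⟨B * w0 - A * w1, by linear_combination B * hw0 - A * hw1⟩
  have h21 : q ∣ B * v 2 - C * v 1 := ⟨B * w2 - C * w1, by linear_combination B * hw2 - C * hw1⟩
  have hbn : q ∣ bn x v := by
    have e : bn x v = 4 * (s0 * q + F.lam x * A) * v 2 + 4 * (s2 * q + F.lam x * C) * v 0 -
        2 * (s1 * q + F.lam x * B) * v 1 + 2 * x 3 * v 3 := by
      unfold bn
      linear_combination 4 * v 2 * hs0 + 4 * v 0 * hs2 - 2 * v 1 * hs1
    refine ⟨4 * s0 * v 2 + 4 * s2 * v 0 - 2 * s1 * v 1 + F.lam x * (4 * A * w2 + 4 * C * w0 -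
      2 * B * w1) + 2 * x 3 * w3 + 2 * ν * E * (b * l - a * d), ?_⟩
    rw [e]
    linear_combination F.lam x * (4 * A * hw2 + 4 * C * hw0 - 2 * B * hw1) + 2 * x 3 * hw3 +
      2 * ν * E * (l * hb - d * ha)
  obtain ⟨h1, h2, h3, h4⟩ := hx
  obtain ⟨t02, ht02⟩ := h02
  obtain ⟨t01, ht01⟩ := h01
  obtain ⟨t21, ht21⟩ := h21
  obtain ⟨tb, htb⟩ := hbn
  set Q := (p : ℤ) ^ k
  refine ⟨?_, ?_, ?_, ?_⟩
  · refine (dvd_add h1 (⟨u * t02, ?_⟩ : (p : ℤ) ^ m ∣ u * Q * (C * v 0 - A * v 2))).trans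
      (Eq.dvd ?_)
    · rw [hm, ht02]; ring
    · simp; ring
  · refine (dvd_add h2 (⟨u * t01, ?_⟩ : (p : ℤ) ^ m ∣ u * Q * (B * v 0 - A * v 1))).trans
      (Eq.dvd ?_)
    · rw [hm, ht01]; ring
    · simp; ring
  · refine (dvd_add h3 (⟨u * t21, ?_⟩ : (p : ℤ) ^ m ∣ u * Q * (B * v 2 - C * v 1))).trans
      (Eq.dvd ?_)
    · rw [hm, ht21]; ring
    · simp; ring
  · rw [nf_add_smul, bn_smul, nf_smul]
    refine (dvd_add (dvd_add h4 (⟨u * tb, ?_⟩ : (p : ℤ) ^ m ∣ u * (Q * bn x v)))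
      (hkk.mul_left (u ^ 2 * nf v))).trans (Eq.dvd ?_)
    · rw [hm, htb]; ring
    · ring

end ReducedForm

/-- A choice of small tangent directions, depending on the residues `(λ, x₃)`. -/
def IsDirection (A B C : ℤ) (p e j : ℕ) (V : ℤ × ℤ → Vec) : Prop :=
  ∀ r : ℤ × ℤ, (p : ℤ) ∣ (4 * A * C - B ^ 2) * r.1 ^ 2 + r.2 ^ 2 - 4 * (4 * A * C - B ^ 2) →
    (∀ i, |V r i| < (p : ℤ) ^ e) ∧
      (∃ ν, ∀ i, (p : ℤ) ^ j ∣ V r i - ν * tau A B C r.1 r.2 i) ∧ nf (V r) ≠ 0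

namespace ReducedForm

lemma exists_isDirection {A B C : ℤ} {p : ℕ} (F : ReducedForm A B C p) {e j : ℕ}
    (hj : 3 * j < 4 * e) (hej : e < j) : ∃ V, IsDirection A B C p e j V := by
  classical
  have : ∀ r : ℤ × ℤ, ∃ v : Vec,
      (p : ℤ) ∣ (4 * A * C - B ^ 2) * r.1 ^ 2 + r.2 ^ 2 - 4 * (4 * A * C - B ^ 2) →
      (∀ i, |v i| < (p : ℤ) ^ e) ∧
        (∃ ν, ∀ i, (p : ℤ) ^ j ∣ v i - ν * tau A B C r.1 r.2 i) ∧ nf v ≠ 0 := by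
    intro r
    by_cases h : (p : ℤ) ∣ (4 * A * C - B ^ 2) * r.1 ^ 2 + r.2 ^ 2 - 4 * (4 * A * C - B ^ 2)
    · obtain ⟨v, hv⟩ := F.exists_direction hj hej h
      exact ⟨v, fun _ => hv⟩
    · exact ⟨0, fun h' => absurd h' h⟩
  choose V hV using this
  exact ⟨V, hV⟩

lemma residue_conic {A B C : ℤ} {p : ℕ} (F : ReducedForm A B C p) {j m : ℕ} (hj : 1 ≤ j)
    (hjm : j ≤ m) {x : Vec} (hx : Adm A B C ((p : ℤ) ^ m) x) :
    (p : ℤ) ∣ (4 * A * C - B ^ 2) * (F.residue ((p : ℤ) ^ j) x).1 ^ 2 +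
      (F.residue ((p : ℤ) ^ j) x).2 ^ 2 - 4 * (4 * A * C - B ^ 2) := by
  have hd : (p : ℤ) ^ j ∣ (p : ℤ) ^ m := pow_dvd_pow _ hjm
  have hx' : Adm A B C ((p : ℤ) ^ j) x :=
    ⟨hd.trans hx.h02, hd.trans hx.h01, hd.trans hx.h21, hd.trans hx.hnf⟩
  exact (dvd_pow_self _ (by omega)).trans
    (F.residue_mem (pow_pos (by exact_mod_cast F.prime.pos) _) hx').2.2

lemma residue_add_smul {A B C : ℤ} {p : ℕ} (F : ReducedForm A B C p) {k j : ℕ} (hjk : j ≤ k)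
    (x v : Vec) (u : ℤ) :
    F.residue ((p : ℤ) ^ j) (x + u • ((p : ℤ) ^ k • v)) = F.residue ((p : ℤ) ^ j) x := by
  obtain ⟨t, ht⟩ : (p : ℤ) ^ j ∣ (p : ℤ) ^ k := pow_dvd_pow _ hjk
  refine Prod.ext ?_ ?_
  · simp only [residue]
    have : F.lam (x + u • ((p : ℤ) ^ k • v)) = F.lam x + (p : ℤ) ^ j * (u * t * F.lam v) := by
      simp only [lam, ht, Pi.add_apply, Pi.smul_apply, smul_eq_mul]; ring
    rw [this, Int.add_mul_emod_self_left]
  · simp only [residue]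
    have : (x + u • ((p : ℤ) ^ k • v)) 3 = x 3 + (p : ℤ) ^ j * (u * t * v 3) := by
      simp only [ht, Pi.add_apply, Pi.smul_apply, smul_eq_mul]; ring
    rw [this, Int.add_mul_emod_self_left]

lemma adm_add_direction {A B C : ℤ} {p : ℕ} (F : ReducedForm A B C p) {e k j m : ℕ}
    (hkj : k + j = m) (hj : 1 ≤ j) (hjk : j ≤ k) {V : ℤ × ℤ → Vec} (hV : IsDirection A B C p e j V)
    {x : Vec} (hx : Adm A B C ((p : ℤ) ^ m) x) (u : ℤ) :
    Adm A B C ((p : ℤ) ^ m)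
      (x + u • ((p : ℤ) ^ k • V (F.residue ((p : ℤ) ^ j) x))) := by
  obtain ⟨-, ⟨ν, hν⟩, -⟩ := hV _ (F.residue_conic hj (by omega) hx)
  exact F.adm_add_smul hkj hjk hx Int.dvd_self_sub_emod Int.dvd_self_sub_emod hν u

end ReducedForm

lemma Sol.abs_le {A B C δ P : ℤ} {p : ℕ} (F : ReducedForm A B C p) {x : Vec}
    (hx : Sol A B C δ P x) (i : Fin 4) : |x i| ≤ 4 * C := by
  have := F.pos
  have := F.le
  fin_cases i
  · exact hx.b0.trans (by linarith)
  · exact ReducedForm.sq_le_imp_abs_le F.pos.le F.le hx.b1 le_rfl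
  · exact hx.b2.trans (by linarith)
  · exact ReducedForm.sq_le_imp_abs_le F.pos.le F.le hx.b3 le_rfl

/-- Solutions on nondegenerate tangent lines. -/
lemma card_nondegenerate_le (K : ℕ) (δ : ℤ) (hδ : 0 < δ) :
    ∃ Cst : ℝ, 0 < Cst ∧ ∀ (N : ℕ) (A B C : ℤ) (p e k j m M : ℕ), 1 ≤ N →
      ∀ F : ReducedForm A B C p, k + j = m → 1 ≤ j → j ≤ k →
      N * (p : ℤ) ^ k * (p : ℤ) ^ e ≤ C → 3000 * (5 * C) ^ 4 ≤ (N : ℤ) ^ K → 5 * C ≤ M →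
      ∀ V, IsDirection A B C p e j V → ∀ S : Finset Vec,
      (∀ x ∈ S, Sol A B C δ ((p : ℤ) ^ m) x) →
      (∀ x ∈ S, ¬ Degenerate A B C δ x ((p : ℤ) ^ k • V (F.residue ((p : ℤ) ^ j) x))) →
      (S.card : ℝ) * N ≤ ((2 * (M / p ^ m) + 2) ^ 4 * (4 * p ^ m) : ℕ) *
        (Cst * (N : ℝ) ^ (((2 * K + 2 : ℕ) : ℝ) / ((2 * K + 2 : ℕ) + 1))) := by
  obtain ⟨Cst, hC0, hCst⟩ := card_mul_le_of_lines K δ hδ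
  refine ⟨Cst, hC0, fun N A B C p e k j m M hN F hkj hj hjk hNC hY hM V hV S hS hnd => ?_⟩
  have hp0 : (0 : ℤ) < p := by exact_mod_cast F.prime.pos
  have hCp := F.C_pos
  have hN1 : (1 : ℤ) ≤ N := by exact_mod_cast hN
  set W : Vec → Vec := fun x => (p : ℤ) ^ k • V (F.residue ((p : ℤ) ^ j) x) with hW
  have hsub : ∀ (x : Vec) (i : ℕ), x - i • W x = x + (-(i : ℤ)) • W x := by
    intro x i
    rw [neg_smul, natCast_zsmul, sub_eq_add_neg]
  have hWinv : ∀ (x : Vec) (i : ℕ), W (x - i • W x) = W x := by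
    intro x i
    rw [hsub]
    simp only [hW]
    rw [F.residue_add_smul hjk]
  have hWb : ∀ x ∈ S, ∀ l, |W x l| < (p : ℤ) ^ k * (p : ℤ) ^ e := by
    intro x hx l
    have h1 := (hV _ (F.residue_conic hj (by omega) (hS x hx).adm)).1 l
    simp only [hW, Pi.smul_apply, smul_eq_mul, abs_mul, abs_of_pos (pow_pos hp0 k)]
    exact mul_lt_mul_of_pos_left h1 (pow_pos hp0 k)
  have hQ : (p : ℤ) ^ k * (p : ℤ) ^ e ≤ C := by
    refine le_trans ?_ hNC
    rw [mul_assoc]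
    exact le_mul_of_one_le_left (by positivity) hN1
  have hb : ∀ x ∈ S, ∀ i < N, ∀ l, |(x - i • W x) l| ≤ 5 * C := by
    intro x hx i hi l
    have h1 := (hS x hx).abs_le F l
    have h2 : |(i : ℤ) * W x l| ≤ C := by
      rw [abs_mul, abs_of_nonneg (Int.natCast_nonneg i)]
      refine le_trans ?_ hNC
      rw [mul_assoc]
      exact mul_le_mul (by exact_mod_cast hi.le) (hWb x hx l).le (abs_nonneg _) (by positivity)
    have h3 : (x - i • W x) l = x l - (i : ℤ) * W x l := by simp
    rw [h3]
    refine (abs_sub _ _).trans (by linarith)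
  have hndeg : ∀ x ∈ S, ∀ i < N, W (x - i • W x) = W x ∧ (∀ l, |(x - i • W x) l| ≤ 5 * C) ∧
      (∀ l, |W x l| ≤ 5 * C) ∧ ¬ Degenerate A B C δ (x - i • W x) (W x) := by
    intro x hx i hi
    refine ⟨hWinv x i, hb x hx i hi, fun l => ?_, fun h => hnd x hx ?_⟩
    · linarith [hWb x hx l]
    · have := h.add_smul (i : ℤ)
      rwa [natCast_zsmul, sub_add_cancel] at this
  obtain ⟨S', hS', hcard⟩ := hCst N A B C ((p : ℤ) ^ m) (5 * C) p hN F (by linarith) hY S W hS hndeg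
  refine hcard.trans (mul_le_mul_of_nonneg_right ?_ (by positivity))
  have h1 := F.card_adm_le (m := m) (by omega) (fun _ => M) S' ?_ ?_
  · rw [Finset.prod_const, Finset.card_univ, Fintype.card_fin] at h1
    exact_mod_cast h1
  · intro y hy
    obtain ⟨x, hx, i, hi, rfl⟩ := hS' y hy
    rw [hsub]
    exact F.adm_add_direction hkj hj hjk hV (hS x hx).adm _
  · intro y hy l
    obtain ⟨x, hx, i, hi, rfl⟩ := hS' y hy
    exact (hb x hx i hi l).trans hM

lemma sq_congr_of_cross {p : ℕ} (hp : p.Prime) (hp2 : p ≠ 2) {e : ℕ} (he : 1 ≤ e)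
    {E l d l' d' : ℤ} (hE : ¬ (p : ℤ) ∣ 4 * E)
    (h : (p : ℤ) ^ e ∣ E * l ^ 2 + d ^ 2 - 4 * E) (h' : (p : ℤ) ^ e ∣ E * l' ^ 2 + d' ^ 2 - 4 * E)
    (hω : (p : ℤ) ^ e ∣ l * d' - l' * d) :
    ((p : ℤ) ^ e ∣ l - l' ∨ (p : ℤ) ^ e ∣ l + l') ∧
      ((p : ℤ) ^ e ∣ d - d' ∨ (p : ℤ) ^ e ∣ d + d') := by
  have hpi := Nat.prime_iff_prime_int.mp hp
  have hpe : (p : ℤ) ∣ (p : ℤ) ^ e := dvd_pow_self _ (by omega)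
  obtain ⟨a, ha⟩ := h
  obtain ⟨b, hb⟩ := h'
  obtain ⟨w, hw⟩ := hω
  have hl : (p : ℤ) ^ e ∣ l ^ 2 - l' ^ 2 := by
    refine hpi.pow_dvd_of_dvd_mul_left _ hE ⟨w * (l * d' + l' * d) + l' ^ 2 * a - l ^ 2 * b, ?_⟩
    linear_combination (l * d' + l' * d) * hw + l' ^ 2 * ha - l ^ 2 * hb
  have hd : (p : ℤ) ^ e ∣ d ^ 2 - d' ^ 2 := by
    obtain ⟨r, hr⟩ := hl
    exact ⟨a - b - E * r, by linear_combination ha - hb - E * hr⟩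
  by_cases h1 : (p : ℤ) ∣ l
  · have h2 : ¬ (p : ℤ) ∣ d := fun h2 => hE <| by
      have h3 : (p : ℤ) ∣ E * l ^ 2 + d ^ 2 - 4 * E := hpe.trans ⟨a, ha⟩
      have h4 : (p : ℤ) ∣ E * l ^ 2 + d ^ 2 :=
        dvd_add ((dvd_pow h1 two_ne_zero).mul_left _) (dvd_pow h2 two_ne_zero)
      exact (dvd_sub h4 h3).trans (Eq.dvd (by ring))
    have h3 := sq_congr_cases hp hp2 h2 hd
    refine ⟨?_, h3⟩
    rcases h3 with ⟨r, hr⟩ | ⟨r, hr⟩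
    · exact Or.inl (hpi.pow_dvd_of_dvd_mul_left _ h2 ⟨w + l * r, by
        linear_combination hw + l * hr⟩)
    · exact Or.inr (hpi.pow_dvd_of_dvd_mul_left _ h2 ⟨-w + l * r, by
        linear_combination -hw + l * hr⟩)
  · have h3 := sq_congr_cases hp hp2 h1 hl
    refine ⟨h3, ?_⟩
    rcases h3 with ⟨r, hr⟩ | ⟨r, hr⟩
    · exact Or.inl (hpi.pow_dvd_of_dvd_mul_left _ h1 ⟨-w + d * r, by
        linear_combination -hw + d * hr⟩)
    · exact Or.inr (hpi.pow_dvd_of_dvd_mul_left _ h1 ⟨w + d * r, by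
        linear_combination hw + d * hr⟩)

namespace ReducedForm

lemma dvd_cross {A B C : ℤ} {p : ℕ} (F : ReducedForm A B C p) {P c : ℤ} {n s e : ℕ}
    {x y v : Vec} (hse : s + e = n) (hnP : (p : ℤ) ^ n ∣ P) (hx : Adm A B C P x)
    (hy : Adm A B C P y) (hr : P * c * nf v = 32 * rf A B C v) {w : ℤ}
    (hw : w * nf v ≠ 0) (hws : |w * nf v| < (p : ℤ) ^ (s + 1))
    (hbx : (p : ℤ) ^ n ∣ w * bn x v) (hby : (p : ℤ) ^ n ∣ w * bn y v) :
    (p : ℤ) ^ e ∣ F.lam x * y 3 - F.lam y * x 3 := by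
  have hpi := F.prime_int
  have key : ∀ z : Vec, Adm A B C P z → (p : ℤ) ^ n ∣ w * bn z v →
      (p : ℤ) ^ n ∣ w * (2 * (F.lam z * tf A B C v + z 3 * v 3)) := by
    intro z hz hb
    obtain ⟨⟨a, ha⟩, ⟨b, hb'⟩, ⟨d, hd⟩⟩ := F.dvd_sub_lam hz.h02 hz.h01 hz.h21
    have : P ∣ bn z v - 2 * (F.lam z * tf A B C v + z 3 * v 3) :=
      ⟨4 * v 2 * a + 4 * v 0 * d - 2 * v 1 * b, by
        unfold bn tf; linear_combination 4 * v 2 * ha + 4 * v 0 * hd - 2 * v 1 * hb'⟩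
    exact (dvd_sub hb ((hnP.trans this).mul_left w)).trans (Eq.dvd (by ring))
  obtain ⟨a, ha⟩ := key x hx hbx
  obtain ⟨b, hb⟩ := key y hy hby
  obtain ⟨q, hq⟩ := hnP
  have hω : (p : ℤ) ^ n ∣ (w * nf v) * (F.lam x * y 3 - F.lam y * x 3) := by
    have g2 : 8 * (tf A B C v ^ 2 + (4 * A * C - B ^ 2) * v 3 ^ 2) =
        nf v * (P * c + 8 * (4 * A * C - B ^ 2)) := by
      have f2 := four_rf A B C v
      have : 4 * v 0 * v 2 - v 1 ^ 2 = nf v - v 3 ^ 2 := by unfold nf; ring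
      rw [this] at f2
      linear_combination -8 * f2 - hr
    have h2E : ¬ (p : ℤ) ∣ 2 * (4 * (4 * A * C - B ^ 2)) := fun h => by
      rcases hpi.dvd_or_dvd h with h | h
      exacts [F.not_dvd_two h, F.not_dvd_four_mul h]
    refine hpi.pow_dvd_of_dvd_mul_left _ h2E
      ⟨4 * (tf A B C v * (y 3 * a - x 3 * b) + (4 * A * C - B ^ 2) * v 3 *
        (F.lam x * b - F.lam y * a)) - q * c * (w * nf v) * (F.lam x * y 3 - F.lam y * x 3), ?_⟩
    linear_combination 4 * tf A B C v * (y 3 * ha - x 3 * hb) + 4 * (4 * A * C - B ^ 2) * v 3 *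
      (F.lam x * hb - F.lam y * ha) - w * (F.lam x * y 3 - F.lam y * x 3) * g2 -
      c * (w * nf v) * (F.lam x * y 3 - F.lam y * x 3) * hq
  rw [← hse] at hω
  refine (Prime.pow_dvd_or_of_mul hpi hω).resolve_left fun h => ?_
  exact absurd (Int.le_of_dvd (abs_pos.mpr hw) ((dvd_abs _ _).mpr h)) (not_le.mpr hws)

/-- Degenerate points whose tangent line is nearly contained in the quadric modulo `p ^ n`. -/
lemma card_tangent_le {A B C : ℤ} {p : ℕ} (F : ReducedForm A B C p) {c : ℤ} {n s e M m : ℕ}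
    {v : Vec} (hse : s + e = n) (he : 1 ≤ e) (hnm : n ≤ m)
    (hr : (p : ℤ) ^ m * c * nf v = 32 * rf A B C v) {w : ℤ}
    (hw : w * nf v ≠ 0) (hws : |w * nf v| < (p : ℤ) ^ (s + 1))
    (U : Finset Vec) (hU : ∀ x ∈ U, Adm A B C ((p : ℤ) ^ m) x) (hM : ∀ x ∈ U, ∀ i, |x i| ≤ M)
    (hb : ∀ x ∈ U, (p : ℤ) ^ n ∣ w * bn x v) :
    U.card ≤ (2 * (M / p ^ m) + 2) ^ 4 * (32 * p ^ (m - e)) := by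
  have hP : (0 : ℤ) < (p : ℤ) ^ m := pow_pos (by exact_mod_cast F.prime.pos) _
  have hpe : 0 < p ^ e := pow_pos F.prime.pos e
  have heP : (p : ℤ) ^ e ∣ (p : ℤ) ^ m := pow_dvd_pow _ (by omega)
  have hdiv : p ^ m / p ^ e = p ^ (m - e) := Nat.pow_div (by omega) F.prime.pos
  have h1le : 1 ≤ p ^ (m - e) := Nat.one_le_pow _ _ F.prime.pos
  have h1 := card_le_of_residue_map (M := fun _ => M) (pow_pos F.prime.pos m) U
    (F.residue ((p : ℤ) ^ m)) hM (fun u hu v hv huv i => by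
      exact_mod_cast F.dvd_sub_of_residue_eq (hU u hu) (hU v hv) huv i)
  rw [Finset.prod_const, Finset.card_univ, Fintype.card_fin] at h1
  refine h1.trans (Nat.mul_le_mul_left _ ?_)
  have hcases : ∀ x ∈ U, ∀ y ∈ U,
      ((p : ℤ) ^ e ∣ F.lam x - F.lam y ∨ (p : ℤ) ^ e ∣ F.lam x + F.lam y) ∧
      ((p : ℤ) ^ e ∣ x 3 - y 3 ∨ (p : ℤ) ^ e ∣ x 3 + y 3) := by
    intro x hx y hy
    exact sq_congr_of_cross F.prime F.ne_two he F.not_dvd_four_mul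
      (heP.trans (F.dvd_conic (hU x hx))) (heP.trans (F.dvd_conic (hU y hy)))
      (F.dvd_cross hse (pow_dvd_pow _ hnm) (hU x hx) (hU y hy) hr hw hws (hb x hx) (hb y hy))
  have hmod : ∀ a : ℤ, (p : ℤ) ^ e ∣ a - a % (p : ℤ) ^ m := fun a =>
    heP.trans Int.dvd_self_sub_emod
  have hlift : ∀ a b : ℤ, ((p : ℤ) ^ e ∣ a - b ∨ (p : ℤ) ^ e ∣ a + b) →
      ((p : ℤ) ^ e ∣ a % (p : ℤ) ^ m - b % (p : ℤ) ^ m ∨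
        (p : ℤ) ^ e ∣ a % (p : ℤ) ^ m + b % (p : ℤ) ^ m) := by
    intro a b h
    refine h.imp (fun h => ?_) fun h => ?_
    · exact (dvd_add (dvd_sub h (hmod a)) (hmod b)).trans (Eq.dvd (by ring))
    · exact (dvd_sub (dvd_sub h (hmod a)) (hmod b)).trans (Eq.dvd (by ring))
  have hcount : ∀ W : Finset ℤ, (∀ u ∈ W, 0 ≤ u ∧ u < (p : ℤ) ^ m) →
      (∀ u ∈ W, ∀ v ∈ W, (p : ℤ) ^ e ∣ u - v ∨ (p : ℤ) ^ e ∣ u + v) →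
      W.card ≤ 8 * p ^ (m - e) := by
    intro W hW hWW
    have := card_le_of_congr_or (T := 2 * (p ^ m / p ^ e) + 2) W (fun V hV hVV => ?_) hWW
    · rw [hdiv] at this
      omega
    · refine card_le_of_congr hpe V (fun u hu => ?_) (fun u hu v hv => ?_)
      · obtain ⟨h0, h1⟩ := hW u (hV hu)
        rw [abs_of_nonneg h0]
        exact_mod_cast h1.le
      · exact_mod_cast hVV u hu v hv
  have := F.card_conic_le_of_image (m := m) (L := 8 * p ^ (m - e)) (by omega)
    (U.image (F.residue ((p : ℤ) ^ m))) ?_ (hcount _ ?_ ?_) (hcount _ ?_ ?_)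
  · omega
  · simp only [Finset.forall_mem_image]
    exact fun x hx => F.residue_mem hP (hU x hx)
  · simp only [Finset.forall_mem_image]
    exact fun x hx => (F.residue_mem hP (hU x hx)).1
  · simp only [Finset.forall_mem_image]
    exact fun x hx y hy => hlift _ _ (hcases x hx y hy).1
  · simp only [Finset.forall_mem_image]
    exact fun x hx => (F.residue_mem hP (hU x hx)).2.1
  · simp only [Finset.forall_mem_image]
    exact fun x hx y hy => hlift _ _ (hcases x hx y hy).2

end ReducedForm

lemma card_le_of_separated {s M : ℕ} (hs : 0 < s) (U : Finset ℤ) (hU : ∀ u ∈ U, |u| ≤ M)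
    (hUU : ∀ u ∈ U, ∀ v ∈ U, u ≠ v → (s : ℤ) ≤ |u - v|) : U.card ≤ 2 * (M / s) + 2 := by
  have hs' : (0 : ℤ) < s := by exact_mod_cast hs
  have : (Finset.Icc (-((M / s : ℕ) : ℤ) - 1) (M / s : ℕ)).card = 2 * (M / s) + 2 := by
    rw [Int.card_Icc]; omega
  rw [← this]
  refine Finset.card_le_card_of_injOn (fun u => u / s) (fun u hu => ?_) fun u hu v hv huv => ?_
  · have h := abs_le.mp (hU u hu)
    simp only [Finset.coe_Icc, Set.mem_Icc]
    have hMs : (M : ℤ) < (M / s : ℕ) * s + s := by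
      have := Nat.lt_div_mul_add (a := M) hs
      exact_mod_cast this
    constructor
    · rw [Int.le_ediv_iff_mul_le hs']
      nlinarith
    · refine Int.le_of_lt_add_one ((Int.ediv_lt_iff_lt_mul hs').mpr ?_)
      nlinarith
  · by_contra hne
    have h1 := hUU u hu v hv hne
    have h2 : u / (s : ℤ) = v / s := huv
    have h3 := Int.emod_add_mul_ediv u s
    have h4 := Int.emod_add_mul_ediv v s
    have h5 : u - v = u % s - v % s := by rw [← h3, ← h4, h2]; ring_nf; simp
    have h6 := Int.emod_nonneg u hs'.ne'
    have h7 := Int.emod_lt_of_pos u hs'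
    have h8 := Int.emod_nonneg v hs'.ne'
    have h9 := Int.emod_lt_of_pos v hs'
    have : |u - v| < s := by rw [h5, abs_lt]; constructor <;> linarith
    linarith

lemma dvd_mul_sub_sq {c u v : ℤ} (hu : c ∣ 64 * u ^ 2) (hv : c ∣ 64 * v ^ 2) :
    c ∣ 64 * (u - v) ^ 2 := by
  have h : c ∣ 64 * u * v := by
    rw [← Int.pow_dvd_pow_iff (two_ne_zero)]
    exact (Eq.dvd (by ring)).trans ((mul_dvd_mul hu hv).trans (Eq.dvd (by ring)))
  obtain ⟨a, ha⟩ := hu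
  obtain ⟨b, hb⟩ := hv
  obtain ⟨d, hd⟩ := h
  exact ⟨a - 2 * d + b, by linear_combination ha - 2 * hd + hb⟩

lemma card_le_of_dvd_sq {c : ℤ} (hc : c ≠ 0) {Z : ℕ} (hZ : 1 ≤ Z) (U : Finset ℤ)
    (hU : ∀ u ∈ U, |u| ≤ |c| * Z) (hd : ∀ u ∈ U, c ∣ 64 * u ^ 2) :
    ∃ s : ℕ, (s : ℤ) ^ 2 ≤ |c| ∧ U.card ≤ 514 * s * Z := by
  set a := c.natAbs with ha
  have ha1 : 1 ≤ a := Int.natAbs_pos.mpr hc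
  have hca : |c| = (a : ℤ) := Int.abs_eq_natAbs c
  set r := Nat.sqrt a
  have hr1 : r ^ 2 ≤ a := Nat.sqrt_le' a
  have hr2 : a < (r + 1) ^ 2 := Nat.lt_succ_sqrt' a
  set s := max 1 (r / 8) with hs
  have hs1 : 1 ≤ s := le_max_left _ _
  have hrs : r + 1 ≤ 16 * s := by omega
  refine ⟨s, ?_, ?_⟩
  · rw [hca]
    rcases le_total 1 (r / 8) with h | h
    · have : s ≤ r := by omega
      exact_mod_cast (Nat.pow_le_pow_left this 2).trans hr1
    · have : s = 1 := by omega
      rw [this]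
      exact_mod_cast ha1
  · have h1 := card_le_of_separated (s := s) (M := a * Z) hs1 U
      (fun u hu => by have := hU u hu; rw [hca] at this; exact_mod_cast this) ?_
    · have h2 : a * Z / s ≤ 256 * s * Z := by
        refine Nat.div_le_of_le_mul ?_
        have : a ≤ 256 * s ^ 2 := by nlinarith
        nlinarith
      nlinarith [mul_le_mul hs1 hZ zero_le_one (Nat.zero_le s)]
    · intro u hu v hv huv
      have hne : u - v ≠ 0 := sub_ne_zero.mpr huv
      have h3 := Int.le_of_dvd (by positivity)
        ((abs_dvd _ _).mpr (dvd_mul_sub_sq (hd u hu) (hd v hv)))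
      rcases le_total (r / 8) 1 with h | h
      · rw [show s = 1 by omega]
        exact_mod_cast Int.one_le_abs hne
      · have h4 : 8 * s ≤ r := by omega
        have h5 : (8 * s : ℤ) ^ 2 ≤ 64 * (u - v) ^ 2 := by
          refine le_trans ?_ h3
          rw [hca]
          exact_mod_cast (Nat.pow_le_pow_left h4 2).trans hr1
        refine (le_abs_self _).trans (sq_le_sq.mp ?_)
        linarith

namespace DegRel

variable {A B C c : ℤ} {p : ℕ} {v : Vec}

/-- Degenerate points in a fibre of both invariants. -/
lemma card_fiber_le (F : ReducedForm A B C p) {n s M : ℕ} (hn : 1 ≤ n) (hsn : s ≤ 3 * n)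
    (hc : c ≠ 0) (hv : nf v ≠ 0) (hvs : |nf v| < (p : ℤ) ^ (s + 1)) {i : Fin 4} (hi : v i ≠ 0)
    (U : Finset Vec) (hU : ∀ x ∈ U, Adm A B C ((p : ℤ) ^ (4 * n)) x)
    (hR : ∀ x ∈ U, DegRel A B C ((p : ℤ) ^ (4 * n)) c x v) (hM : ∀ x ∈ U, ∀ i, |x i| ≤ M)
    (hb : ∀ x ∈ U, ¬ (p : ℤ) ^ n ∣ v i * bn x v)
    (hdt : ∀ x ∈ U, ∀ y ∈ U, dt A B C x v = dt A B C y v)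
    (hth : ∀ x ∈ U, ∀ y ∈ U, th A B C x v = th A B C y v) :
    U.card ≤ 4 * (M / p ^ (3 * n - s)) + 4 := by
  classical
  have hpi := F.prime_int
  have hp0 : (0 : ℤ) < p := by exact_mod_cast F.prime.pos
  rcases U.eq_empty_or_nonempty with rfl | ⟨x, hx⟩
  · simp
  have hpar : ∀ x ∈ U, ∀ y ∈ U, ∀ l, v i * (y l - x l) = (y i - x i) * v l := fun x hx y hy l =>
    (hR x hx).parallel (hR y hy) F (dvd_pow_self _ (by omega)) (pow_pos hp0 _).ne' hc hv
      (hdt x hx y hy) (hth x hx y hy) i l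
  have hinj : Set.InjOn (fun y : Vec => y i) U := by
    intro y hy z hz hyz
    funext l
    have h1 := hpar y hy z hz l
    have h2 : y i = z i := hyz
    rw [h2, sub_self, zero_mul] at h1
    linarith [(mul_eq_zero.mp h1).resolve_left hi]
  have hstep : ∀ y ∈ U, (p : ℤ) ^ (3 * n) ∣ y i - x i ∨
      (p : ℤ) ^ (3 * n) ∣ v i * bn x v + (y i - x i) * nf v := by
    intro y hy
    have hd : (p : ℤ) ^ (4 * n) ∣ (y i - x i) * (v i * bn x v + (y i - x i) * nf v) := by
      obtain ⟨a, ha⟩ := (hU x hx).hnf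
      obtain ⟨b, hb'⟩ := (hU y hy).hnf
      have h0 := hpar x hx y hy 0
      have h1 := hpar x hx y hy 1
      have h2 := hpar x hx y hy 2
      have h3 := hpar x hx y hy 3
      have e1 : v i * bn x (y - x) = (y i - x i) * bn x v := by
        simp only [bn, Pi.sub_apply]
        linear_combination 4 * x 0 * h2 + 4 * x 2 * h0 - 2 * x 1 * h1 + 2 * x 3 * h3
      have e2 : v i ^ 2 * nf (y - x) = (y i - x i) ^ 2 * nf v := by
        rw [← nf_smul, ← nf_smul]
        congr 1
        funext l
        simpa using hpar x hx y hy l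
      have e3 : nf y = nf x + bn x (y - x) + nf (y - x) := by
        rw [← nf_add, add_sub_cancel]
      refine ⟨v i ^ 2 * (b - a), ?_⟩
      linear_combination v i ^ 2 * (hb' - ha) - v i ^ 2 * e3 - v i * e1 - e2
    by_cases h : (p : ℤ) ^ n ∣ y i - x i
    · left
      rw [mul_comm (y i - x i)] at hd
      have h2 := Prime.pow_dvd_or_of_mul (s := n - 1) (t := 3 * n + 1) hpi
        (by rwa [show n - 1 + (3 * n + 1) = 4 * n by omega])
      rw [Nat.sub_add_cancel hn] at h2
      refine (pow_dvd_pow _ (Nat.le_succ _)).trans (h2.resolve_left fun h3 => hb x hx ?_)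
      exact (dvd_sub h3 (h.mul_right (nf v))).trans (Eq.dvd (by ring))
    · right
      have h2 := Prime.pow_dvd_or_of_mul (s := n - 1) (t := 3 * n + 1) hpi
        (by rwa [show n - 1 + (3 * n + 1) = 4 * n by omega])
      rw [Nat.sub_add_cancel hn] at h2
      exact (pow_dvd_pow _ (Nat.le_succ _)).trans (h2.resolve_left h)
  have hcnt : ∀ W ⊆ U, (∀ y ∈ W, ∀ z ∈ W, (p : ℤ) ^ (3 * n - s) ∣ y i - z i) →
      W.card ≤ 2 * (M / p ^ (3 * n - s)) + 2 := by
    intro W hW hWW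
    rw [← Finset.card_image_of_injOn (hinj.mono (Finset.coe_subset.mpr hW))]
    refine card_le_of_congr (pow_pos F.prime.pos _) _ ?_ ?_
    · simp only [Finset.forall_mem_image]
      exact fun y hy => hM y (hW hy) i
    · simp only [Finset.forall_mem_image]
      exact fun y hy z hz => by exact_mod_cast hWW y hy z hz
  rw [← Finset.card_filter_add_card_filter_not (s := U) (fun y => (p : ℤ) ^ (3 * n) ∣ y i - x i)]
  have h1 := hcnt (U.filter fun y => (p : ℤ) ^ (3 * n) ∣ y i - x i) (Finset.filter_subset _ _) ?_
  · have h2 := hcnt (U.filter fun y => ¬ (p : ℤ) ^ (3 * n) ∣ y i - x i)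
      (Finset.filter_subset _ _) ?_
    · omega
    · intro y hy z hz
      rw [Finset.mem_filter] at hy hz
      have h3 := dvd_sub ((hstep y hy.1).resolve_left hy.2) ((hstep z hz.1).resolve_left hz.2)
      have h4 : (p : ℤ) ^ (s + (3 * n - s)) ∣ nf v * (y i - z i) := by
        rw [Nat.add_sub_cancel' hsn]
        exact h3.trans (Eq.dvd (by ring))
      refine (Prime.pow_dvd_or_of_mul hpi h4).resolve_left fun h => ?_
      exact absurd (Int.le_of_dvd (abs_pos.mpr hv) ((dvd_abs _ _).mpr h)) (not_le.mpr hvs)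
  · intro y hy z hz
    rw [Finset.mem_filter] at hy hz
    exact (pow_dvd_pow _ (by omega)).trans ((dvd_sub hy.2 hz.2).trans (Eq.dvd (by ring)))

end DegRel

lemma card_le_two_of_sq_eq (U : Finset ℤ) (h : ∀ u ∈ U, ∀ v ∈ U, u ^ 2 = v ^ 2) : U.card ≤ 2 := by
  rcases U.eq_empty_or_nonempty with rfl | ⟨d, hd⟩
  · simp
  · refine (Finset.card_le_card (t := {d, -d}) fun e he => ?_).trans Finset.card_le_two
    simpa using sq_eq_sq_iff_eq_or_eq_neg.mp (h e he d hd)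

lemma abs_nf_le {v : Vec} {Z : ℕ} (h : ∀ i, |v i| ≤ Z) : |nf v| ≤ 6 * (Z : ℤ) ^ 2 := by
  have hm : ∀ i l, |v i * v l| ≤ (Z : ℤ) ^ 2 := fun i l => by
    rw [abs_mul, sq]
    exact mul_le_mul (h i) (h l) (abs_nonneg _) (by positivity)
  have h1 := abs_le.mp (hm 0 2)
  have h2 := abs_le.mp (hm 1 1)
  have h3 := abs_le.mp (hm 3 3)
  unfold nf
  rw [abs_le]
  constructor <;> nlinarith [sq_nonneg (v 1), sq_nonneg (v 3)]

namespace DegRel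

lemma abs_quot_le {A B C c P : ℤ} {p : ℕ} {x v : Vec} (F : ReducedForm A B C p) {Z : ℕ}
    (h : DegRel A B C P c x v) (hP : P ≠ 0)
    (hφ : |nf x - 4 * (4 * A * C - B ^ 2)| ≤ 15 * (4 * A * C - B ^ 2))
    (hZ : ∀ i, |v i| ≤ Z) {d : ℤ} (hd : dt A B C x v = P * d) : |d| ≤ |c| * Z := by
  have h1 := h.disc_eq
  have h2 := h.abs_le F
  have hE := F.disc_pos
  have hν := abs_nf_le hZ
  set E := 4 * A * C - B ^ 2
  set φ := nf x - 4 * E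
  rw [hd] at h1
  have h3 : 1024 * E * d ^ 2 = c ^ 2 * (4 * φ * nf v - 2 * (P * c) * nf v - bn x v ^ 2) :=
    mul_left_cancel₀ (pow_ne_zero 2 hP) (by linear_combination h1)
  have h4 : 4 * φ * nf v - 2 * (P * c) * nf v ≤ 8 * (15 * E * (6 * (Z : ℤ) ^ 2)) := by
    calc 4 * φ * nf v - 2 * (P * c) * nf v ≤ |(4 * φ - 2 * (P * c)) * nf v| := by
          refine le_trans (le_of_eq ?_) (le_abs_self _); ring
      _ = |4 * φ - 2 * (P * c)| * |nf v| := abs_mul _ _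
      _ ≤ (8 * |φ|) * |nf v| := by
          refine mul_le_mul_of_nonneg_right ((abs_sub _ _).trans ?_) (abs_nonneg _)
          rw [abs_mul, abs_mul 2, abs_two, abs_of_pos (show (0 : ℤ) < 4 by norm_num)]
          linarith
      _ ≤ 8 * (15 * E * (6 * (Z : ℤ) ^ 2)) := by
          rw [mul_assoc]
          gcongr
  have h5 : 1024 * E * d ^ 2 ≤ c ^ 2 * (8 * (15 * E * (6 * (Z : ℤ) ^ 2))) := by
    rw [h3]
    exact mul_le_mul_of_nonneg_left (by linarith [sq_nonneg (bn x v)]) (sq_nonneg _)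
  have h6 : d ^ 2 ≤ (c * Z) ^ 2 := by
    refine le_of_mul_le_mul_left ?_ (show (0 : ℤ) < 1024 * E by positivity)
    nlinarith [mul_nonneg hE.le (sq_nonneg (c * (Z : ℤ)))]
  have h7 := sq_le_sq.mp h6
  rwa [abs_mul, abs_of_nonneg (Int.natCast_nonneg Z)] at h7

/-- Degenerate points along a fixed direction that is transverse modulo `p ^ n`. -/
lemma card_transverse_le {A B C c : ℤ} {p : ℕ} {v : Vec} (F : ReducedForm A B C p)
    {n s M Z S₀ : ℕ} (hn : 1 ≤ n) (hsn : s ≤ 3 * n) (hc : c ≠ 0) (hv : nf v ≠ 0)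
    (hvs : |nf v| < (p : ℤ) ^ (s + 1)) {i : Fin 4} (hi : v i ≠ 0) (hZ : ∀ i, |v i| ≤ Z)
    (hS : 30 * (4 * A * C - B ^ 2) ≤ (S₀ : ℤ) ^ 2 * (p : ℤ) ^ (4 * n))
    (U : Finset Vec) (hU : ∀ x ∈ U, Adm A B C ((p : ℤ) ^ (4 * n)) x)
    (hφ : ∀ x ∈ U, |nf x - 4 * (4 * A * C - B ^ 2)| ≤ 15 * (4 * A * C - B ^ 2))
    (hR : ∀ x ∈ U, DegRel A B C ((p : ℤ) ^ (4 * n)) c x v) (hM : ∀ x ∈ U, ∀ i, |x i| ≤ M)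
    (hb : ∀ x ∈ U, ¬ (p : ℤ) ^ n ∣ v i * bn x v) :
    U.card ≤ (4 * (M / p ^ (3 * n - s)) + 4) * 2 * (514 * S₀ * Z) := by
  classical
  have hp0 : (0 : ℤ) < p := by exact_mod_cast F.prime.pos
  have hP : (0 : ℤ) < (p : ℤ) ^ (4 * n) := pow_pos hp0 _
  rcases U.eq_empty_or_nonempty with rfl | ⟨x₀, hx₀⟩
  · simp
  set P := (p : ℤ) ^ (4 * n)
  have hZ1 : 1 ≤ Z := by
    have := (Int.one_le_abs hi).trans (hZ i)
    exact_mod_cast this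
  have hdt : ∀ x ∈ U, dt A B C x v = P * (dt A B C x v / P) := fun x hx =>
    (Int.mul_ediv_cancel' ((hU x hx).dvd_dt v)).symm
  obtain ⟨s', hs', hcard⟩ := card_le_of_dvd_sq hc hZ1 (U.image fun x => dt A B C x v / P)
    (by simp only [Finset.forall_mem_image]
        exact fun x hx => (hR x hx).abs_quot_le F hP.ne' (hφ x hx) hZ (hdt x hx))
    (by simp only [Finset.forall_mem_image]
        exact fun x hx => (hR x hx).dvd_sq F hP.ne' (hU x hx) (hdt x hx))
  have hsS : s' ≤ S₀ := by
    have h1 := (hR x₀ hx₀).abs_le F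
    rw [abs_mul, abs_of_pos hP] at h1
    have h2 : (s' : ℤ) ^ 2 * P ≤ (S₀ : ℤ) ^ 2 * P := by
      nlinarith [hφ x₀ hx₀, mul_le_mul_of_nonneg_left hs' hP.le]
    have h3 := le_of_mul_le_mul_right h2 hP
    exact_mod_cast (sq_le_sq₀ (by positivity) (by positivity)).mp h3
  refine (Finset.card_le_mul_card_image (f := fun x => dt A B C x v / P) U
    ((4 * (M / p ^ (3 * n - s)) + 4) * 2) fun a _ => ?_).trans (Nat.mul_le_mul_left _ (hcard.trans ?_))
  · set U' := U.filter fun x => dt A B C x v / P = a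
    have hU' : ∀ x ∈ U', x ∈ U ∧ dt A B C x v = P * a := fun x hx => by
      obtain ⟨h1, h2⟩ := Finset.mem_filter.mp hx
      exact ⟨h1, by rw [← h2]; exact hdt x h1⟩
    refine (Finset.card_le_mul_card_image (f := fun x => th A B C x v) U'
      (4 * (M / p ^ (3 * n - s)) + 4) fun t _ => ?_).trans (Nat.mul_le_mul_left _ ?_)
    · have hm : ∀ x ∈ U'.filter fun x => th A B C x v = t, x ∈ U := fun x hx =>
        (hU' x (Finset.mem_filter.mp hx).1).1
      refine card_fiber_le F hn hsn hc hv hvs hi _ (fun x hx => hU x (hm x hx))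
        (fun x hx => hR x (hm x hx)) (fun x hx => hM x (hm x hx)) (fun x hx => hb x (hm x hx)) ?_ ?_
      · intro x hx y hy
        rw [(hU' x (Finset.mem_filter.mp hx).1).2, (hU' y (Finset.mem_filter.mp hy).1).2]
      · intro x hx y hy
        rw [(Finset.mem_filter.mp hx).2, (Finset.mem_filter.mp hy).2]
    · refine card_le_two_of_sq_eq _ ?_
      simp only [Finset.forall_mem_image]
      intro x hx y hy
      have h1 := (hR x (hU' x hx).1).th_eq F
      have h2 := (hR y (hU' y hy).1).th_eq F
      rw [(hU' x hx).2] at h1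
      rw [(hU' y hy).2] at h2
      have hne : 16 * (P * c) ^ 2 ≠ 0 := by
        have := hP.ne'
        positivity
      exact mul_left_cancel₀ hne (h1.trans h2.symm)
  · gcongr

end DegRel

lemma Sol.abs_nf_sub_le {A B C δ P : ℤ} {p : ℕ} (F : ReducedForm A B C p) {x : Vec}
    (hx : Sol A B C δ P x) :
    |nf x - 4 * (4 * A * C - B ^ 2)| ≤ 15 * (4 * A * C - B ^ 2) := by
  have h1 : |x 0 * x 2| ≤ (2 * A) * (2 * C) := by
    rw [abs_mul]
    exact mul_le_mul hx.b0 hx.b2 (abs_nonneg _) (by linarith [F.pos])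
  have h2 := _root_.abs_le.mp h1
  have h3 := F.sq_B_le
  have h4 := hx.b1
  have h5 := hx.b3
  unfold nf
  rw [_root_.abs_le]
  constructor <;> nlinarith [sq_nonneg (x 1), sq_nonneg (x 3)]

/-- Solutions off the line spanned by `(A, B, C)` and lying on degenerate tangent lines. -/
lemma card_degenerate_le {A B C δ : ℤ} {p : ℕ} (F : ReducedForm A B C p) (hδ : 0 < δ)
    {n e k j M S₀ : ℕ} (hkj : k + j = 4 * n) (hj : 1 ≤ j) (hen : 3 * e + 2 ≤ n)
    (hM : 4 * C ≤ M)
    (hS₀ : 30 * (4 * A * C - B ^ 2) ≤ (S₀ : ℤ) ^ 2 * (p : ℤ) ^ (4 * n))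
    {V : ℤ × ℤ → Vec} (hV : IsDirection A B C p e j V) (S : Finset Vec)
    (hS : ∀ x ∈ S, Sol A B C δ ((p : ℤ) ^ (4 * n)) x) (h0 : ∀ x ∈ S, rf A B C x ≠ 0)
    (hd : ∀ x ∈ S, Degenerate A B C δ x ((p : ℤ) ^ k • V (F.residue ((p : ℤ) ^ j) x))) :
    S.card ≤ ((2 * (M / p ^ (4 * n)) + 2) ^ 4 * (32 * p ^ (4 * n - (n - (3 * e + 1)))) +
      (4 * (M / p ^ (3 * n - (2 * e + 1))) + 4) * 2 * (514 * S₀ * p ^ e)) * (2 * p ^ e) ^ 4 := by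
  classical
  have hp0 : (0 : ℤ) < p := by exact_mod_cast F.prime.pos
  have hp3 : (3 : ℤ) ≤ p := by
    have := F.prime.two_le
    have := F.ne_two
    have : 3 ≤ p := by omega
    exact_mod_cast this
  have hP : (0 : ℤ) < (p : ℤ) ^ (4 * n) := pow_pos hp0 _
  have hVx : ∀ x ∈ S, _ := fun x hx => hV _ (F.residue_conic hj (by omega) (hS x hx).adm)
  refine (Finset.card_le_mul_card_image (f := fun x => V (F.residue ((p : ℤ) ^ j) x)) S _
    fun v hv => ?_).trans (Nat.mul_le_mul_left _ ?_)
  · obtain ⟨x₀, hx₀, rfl⟩ := Finset.mem_image.mp hv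
    obtain ⟨hlt, -, hnf⟩ := hVx x₀ hx₀
    have hrel : ∀ x ∈ S, ∃ c, DegRel A B C ((p : ℤ) ^ (4 * n)) c x
        (V (F.residue ((p : ℤ) ^ j) x)) := fun x hx => by
      have hpk : (p : ℤ) ^ k ≠ 0 := (pow_pos hp0 k).ne'
      obtain ⟨c, hc⟩ := (hd x hx).exists_degRel hδ hP.ne' (hS x hx).adm
        (by rw [nf_smul]; exact mul_ne_zero (pow_ne_zero 2 hpk) (hVx x hx).2.2)
      exact ⟨c, hc.of_smul hpk⟩
    obtain ⟨c, hc⟩ := hrel x₀ hx₀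
    have hc0 : c ≠ 0 := fun h => h0 x₀ hx₀ <| by
      have := hc.self
      rw [h, mul_zero, zero_mul] at this
      linarith
    set v := V (F.residue ((p : ℤ) ^ j) x₀)
    obtain ⟨i, hi⟩ : ∃ i, v i ≠ 0 := by
      by_contra! hall
      exact hnf (by simp [nf, hall])
    set U := S.filter fun x => V (F.residue ((p : ℤ) ^ j) x) = v
    have hU : ∀ x ∈ U, x ∈ S ∧ DegRel A B C ((p : ℤ) ^ (4 * n)) c x v := fun x hx => by
      obtain ⟨h1, h2⟩ := Finset.mem_filter.mp hx
      obtain ⟨c', hc'⟩ := hrel x h1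
      rw [h2] at hc'
      have : c' = c := by
        have := hc'.nfv.trans hc.nfv.symm
        exact mul_left_cancel₀ hP.ne' (mul_right_cancel₀ hnf this)
      exact ⟨h1, this ▸ hc'⟩
    have hZ : ∀ i, |v i| ≤ ((p ^ e : ℕ) : ℤ) := fun i => by push_cast; exact (hlt i).le
    have hν := abs_nf_le hZ
    push_cast at hν
    have hp9 : (9 : ℤ) ≤ (p : ℤ) ^ 2 := by nlinarith
    have hν1 : |nf v| < (p : ℤ) ^ (2 * e + 1 + 1) := by
      refine hν.trans_lt ?_
      rw [show 2 * e + 1 + 1 = e * 2 + 2 by ring, pow_add, pow_mul]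
      nlinarith [pow_pos (pow_pos hp0 e) 2]
    have hν2 : |v i * nf v| < (p : ℤ) ^ (3 * e + 1 + 1) := by
      rw [abs_mul]
      calc |v i| * |nf v| ≤ (p : ℤ) ^ e * (6 * ((p : ℤ) ^ e) ^ 2) :=
            mul_le_mul (hlt i).le hν (abs_nonneg _) (by positivity)
        _ < (p : ℤ) ^ (3 * e + 1 + 1) := by
            rw [show 3 * e + 1 + 1 = e + e * 2 + 2 by ring, pow_add, pow_add, pow_mul]
            nlinarith [mul_pos (pow_pos hp0 e) (pow_pos (pow_pos hp0 e) 2)]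
    have hMx : ∀ x ∈ U, ∀ i, |x i| ≤ M := fun x hx i => ((hS x (hU x hx).1).abs_le F i).trans hM
    rw [← Finset.card_filter_add_card_filter_not (s := U) (fun x => (p : ℤ) ^ n ∣ v i * bn x v)]
    refine add_le_add ?_ ?_
    · have hm : ∀ x ∈ U.filter fun x => (p : ℤ) ^ n ∣ v i * bn x v, x ∈ U := fun x hx =>
        (Finset.mem_filter.mp hx).1
      exact F.card_tangent_le (s := 3 * e + 1) (n := n) (by omega) (by omega) (by omega) hc.nfv
        (mul_ne_zero hi hnf) hν2 _ (fun x hx => (hS x (hU x (hm x hx)).1).adm)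
        (fun x hx => hMx x (hm x hx)) (fun x hx => (Finset.mem_filter.mp hx).2)
    · have hm : ∀ x ∈ U.filter fun x => ¬ (p : ℤ) ^ n ∣ v i * bn x v, x ∈ U := fun x hx =>
        (Finset.mem_filter.mp hx).1
      exact DegRel.card_transverse_le F (by omega) (by omega) hc0 hnf hν1 hi hZ hS₀ _
        (fun x hx => (hS x (hU x (hm x hx)).1).adm)
        (fun x hx => (hS x (hU x (hm x hx)).1).abs_nf_sub_le F)
        (fun x hx => (hU x (hm x hx)).2)
        (fun x hx => hMx x (hm x hx)) (fun x hx => (Finset.mem_filter.mp hx).2)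
  · have hsub : (S.image fun x => V (F.residue ((p : ℤ) ^ j) x)) ⊆
        Fintype.piFinset fun _ : Fin 4 => Finset.Ioo (-((p : ℤ) ^ e)) ((p : ℤ) ^ e) := by
      simp only [Finset.subset_iff, Finset.forall_mem_image, Fintype.mem_piFinset, Finset.mem_Ioo]
      exact fun x hx i => abs_lt.mp ((hVx x hx).1 i)
    refine (Finset.card_le_card hsub).trans ?_
    rw [Fintype.card_piFinset_const, Int.card_Ioo]
    refine Nat.pow_le_pow_left ?_ 4
    have : ((p : ℤ) ^ e) = ((p ^ e : ℕ) : ℤ) := by push_cast; rfl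
    rw [this]
    omega

lemma mul_le_of_mul_le_rpow {c N y X : ℝ} {L : ℕ} (hc : 0 ≤ c) (hN : 1 ≤ N) (hy : 0 ≤ y)
    (hyN : y ^ (L + 1) ≤ N) (h : c * N ≤ X * N ^ ((L : ℝ) / (L + 1))) : c * y ≤ X := by
  have hN0 : 0 < N := by linarith
  have hL : (0 : ℝ) < (L : ℝ) + 1 := by positivity
  have h1 : N = N ^ ((1 : ℝ) / (L + 1)) * N ^ ((L : ℝ) / (L + 1)) := by
    rw [← Real.rpow_add hN0, ← add_div, add_comm, div_self hL.ne', Real.rpow_one]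
  have h2 : y ≤ N ^ ((1 : ℝ) / (L + 1)) := by
    rw [one_div, Real.le_rpow_inv_iff_of_pos hy hN0.le hL]
    exact_mod_cast hyN
  have h3 : 0 < N ^ ((L : ℝ) / (L + 1)) := by positivity
  refine (mul_le_mul_of_nonneg_left h2 hc).trans (le_of_mul_le_mul_right ?_ h3)
  rw [mul_assoc, ← h1]
  exact h

lemma three_le_of_prime {p : ℕ} (hp : p.Prime) (hp2 : p ≠ 2) : 3 ≤ p := by
  have := hp.two_le
  omega

/-- Very unbalanced forms: solutions off the boundary. -/
lemma card_unbalanced_le (K : ℕ) (δ : ℤ) (hδ : 0 < δ) :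
    ∃ Cst : ℝ, 0 < Cst ∧ ∀ (A B C : ℤ) (p n u H : ℕ), ReducedForm A B C p → 1 ≤ n → 2 ≤ H →
      H ^ (4 * (2 * K + 3)) ≤ p ^ u → (p : ℤ) ^ u * (p : ℤ) ^ (4 * n) ≤ C →
      A * C ≤ (H * (p : ℤ) ^ (4 * n)) ^ 2 → 13 + u + 32 * n ≤ K * u → ∀ S : Finset Vec,
      (∀ x ∈ S, Sol A B C δ ((p : ℤ) ^ (4 * n)) x) → (∀ x ∈ S, |x 0| ≠ 2 * A) →
      (S.card : ℝ) ≤ Cst * (p : ℝ) ^ (4 * n) := by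
  obtain ⟨Cst, hC0, hCst⟩ := ReducedForm.card_long_le K δ hδ
  refine ⟨663552 * Cst, by positivity, fun A B C p n u H F hn hH hHu huC hAC hK S hS h0 => ?_⟩
  have hp3 := three_le_of_prime F.prime F.ne_two
  have hA := F.pos
  have hC := F.C_pos
  lift A to ℕ using hA.le
  lift C to ℕ using hC.le
  set P := p ^ (4 * n) with hP
  have hPpos : 0 < P := pow_pos F.prime.pos _
  have hN1 : 1 ≤ p ^ u := Nat.one_le_pow _ _ F.prime.pos
  have huC' : p ^ u * P ≤ C := by exact_mod_cast huC
  have hAC' : A * C ≤ (H * P) ^ 2 := by exact_mod_cast hAC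
  have hA' : 0 < A := by exact_mod_cast hA
  have hPC : P ≤ C := le_trans (Nat.le_mul_of_pos_left _ hN1) huC'
  have hH8 : H ^ 8 ≤ p ^ u := (Nat.pow_le_pow_right (by omega) (by omega)).trans hHu
  have hH4 : 4 * H ^ 2 < p ^ u := by
    refine lt_of_lt_of_le ?_ hH8
    have : 2 ^ 6 ≤ H ^ 6 := Nat.pow_le_pow_left hH 6
    have h2 : 0 < H ^ 2 := by positivity
    calc 4 * H ^ 2 < 2 ^ 6 * H ^ 2 := by omega
      _ ≤ H ^ 6 * H ^ 2 := Nat.mul_le_mul_right _ this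
      _ = H ^ 8 := by ring
  have hAP : 4 * A < P := by
    by_contra! hle
    have h1 : A * (p ^ u * P) ≤ (H * P) ^ 2 := (Nat.mul_le_mul_left _ huC').trans hAC'
    have h2 : 4 * (H * P) ^ 2 < (4 * A) * (p ^ u * P) := by
      calc 4 * (H * P) ^ 2 = (4 * H ^ 2) * P ^ 2 := by ring
        _ < p ^ u * P ^ 2 := Nat.mul_lt_mul_of_pos_right hH4 (by positivity)
        _ = P * (p ^ u * P) := by ring
        _ ≤ _ := Nat.mul_le_mul_right _ hle
    nlinarith
  have hbig : 3000 * (4 * C) ^ 4 ≤ (p ^ u) ^ K := by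
    have h1 : C ≤ (H * P) ^ 2 := (Nat.le_mul_of_pos_left _ hA').trans hAC'
    calc 3000 * (4 * C) ^ 4 ≤ 3000 * (4 * (H * P) ^ 2) ^ 4 := by gcongr
      _ = 768000 * H ^ 8 * P ^ 8 := by ring
      _ ≤ 3 ^ 13 * p ^ u * P ^ 8 := by gcongr; norm_num
      _ ≤ p ^ 13 * p ^ u * P ^ 8 := by gcongr
      _ = p ^ (13 + u + 32 * n) := by rw [hP, ← pow_mul, ← pow_add, ← pow_add]; congr 1; ring
      _ ≤ p ^ (u * K) := Nat.pow_le_pow_right F.prime.pos (by linarith [mul_comm K u])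
      _ = (p ^ u) ^ K := pow_mul _ _ _
  have hmain := hCst (p ^ u) A B C p n hN1 F hn (by exact_mod_cast hAP)
    (by exact_mod_cast huC') (by exact_mod_cast hbig) ![2 * A, 4 * (H * P), 3 * C, 4 * (H * P)]
    (by simp) (by simp; exact_mod_cast (by nlinarith : 16 * (A * C) ≤ (4 * (H * P)) ^ 2))
    (by simp) (by simp; exact_mod_cast (by nlinarith : 16 * (A * C) ≤ (4 * (H * P)) ^ 2)) S hS h0
  have hprod : (∏ i, (2 * ((![2 * A, 4 * (H * P), 3 * C, 4 * (H * P)] : Fin 4 → ℕ) i / P) + 2)) *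
      (512 * A) ≤ 663552 * H ^ 4 * P := by
    have e1 : 2 * A / P = 0 := Nat.div_eq_of_lt (by omega)
    have e2 : 4 * (H * P) / P = 4 * H := by rw [← mul_assoc]; exact Nat.mul_div_cancel _ hPpos
    have e3 : (2 * (3 * C / P) + 2) * A ≤ 8 * H ^ 2 * P := by
      refine Nat.le_of_mul_le_mul_right ?_ hPpos
      have h1 : 3 * C / P * P ≤ 3 * C := Nat.div_mul_le_self _ _
      calc (2 * (3 * C / P) + 2) * A * P = (2 * (3 * C / P * P) + 2 * P) * A := by ring
        _ ≤ (2 * (3 * C) + 2 * C) * A := by gcongr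
        _ = 8 * (A * C) := by ring
        _ ≤ 8 * (H * P) ^ 2 := by gcongr
        _ = 8 * H ^ 2 * P * P := by ring
    simp only [Fin.prod_univ_four]
    simp only [Matrix.cons_val_zero, Matrix.cons_val_one, Matrix.cons_val]
    rw [e1, e2]
    calc (2 * 0 + 2) * (2 * (4 * H) + 2) * (2 * (3 * C / P) + 2) * (2 * (4 * H) + 2) * (512 * A)
        = 1024 * (8 * H + 2) ^ 2 * ((2 * (3 * C / P) + 2) * A) := by ring
      _ ≤ 1024 * (9 * H) ^ 2 * (8 * H ^ 2 * P) := by gcongr; omega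
      _ = 663552 * H ^ 4 * P := by ring
  have hy : ((H : ℝ) ^ 4) ^ (2 * K + 2 + 1) ≤ ((p ^ u : ℕ) : ℝ) := by
    rw [← pow_mul]
    exact_mod_cast hHu
  have hfin := mul_le_of_mul_le_rpow (X := 663552 * (H : ℝ) ^ 4 * P * Cst) (L := 2 * K + 2)
    (Nat.cast_nonneg S.card) (by exact_mod_cast hN1) (by positivity) hy ?_
  · have hH0 : (0 : ℝ) < (H : ℝ) ^ 4 := by positivity
    rw [show 663552 * (H : ℝ) ^ 4 * P * Cst = (663552 * Cst * P) * (H : ℝ) ^ 4 by ring] at hfin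
    have := le_of_mul_le_mul_right hfin hH0
    rw [hP] at this
    push_cast at this
    exact this
  · refine hmain.trans ?_
    rw [← mul_assoc]
    refine mul_le_mul_of_nonneg_right (mul_le_mul_of_nonneg_right ?_ hC0.le) (by positivity)
    have := (Nat.cast_le (α := ℝ)).mpr hprod
    rw [Nat.cast_mul] at this
    refine le_trans (le_of_eq ?_) (this.trans (le_of_eq ?_))
    · rw [Nat.cast_mul 512 A, Int.cast_natCast, Nat.cast_ofNat]
    · push_cast
      ring

lemma div_pow_le_mul_pow {C p a b c k : ℕ} (hp : 0 < p) (h : C ≤ p ^ a) (hab : a ≤ b + c) :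
    k * C / p ^ b ≤ k * p ^ c := by
  refine Nat.div_le_of_le_mul ?_
  calc k * C ≤ k * p ^ (b + c) :=
        Nat.mul_le_mul_left _ (h.trans (Nat.pow_le_pow_right hp hab))
    _ = p ^ b * (k * p ^ c) := by rw [pow_add]; ring

/-- Balanced forms. -/
lemma card_balanced_le (δ : ℤ) (hδ : 0 < δ) :
    ∃ Cst : ℝ, 0 < Cst ∧ ∀ (A B C : ℤ) (p n u : ℕ), ReducedForm A B C p → 100000 ≤ n →
      10000000 * u ≤ n → (p : ℤ) ^ (4 * n) ≤ C → C ≤ (p : ℤ) ^ (u + 4 * n) →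
      ∀ S : Finset Vec, (∀ x ∈ S, Sol A B C δ ((p : ℤ) ^ (4 * n)) x) →
      (S.card : ℝ) ≤ Cst * (p : ℝ) ^ (4 * n) := by
  classical
  obtain ⟨Cst, hC0, hCst⟩ := card_nondegenerate_le 4800 δ hδ
  refine ⟨100 + 8738560 + 82944 * Cst, by positivity, fun A B C p n u F hn hu hPC hCP S hS => ?_⟩
  have hp := F.prime.pos
  have hp3 := three_le_of_prime F.prime F.ne_two
  have hAC : A * C ≤ C ^ 2 := by
    rw [sq]; exact mul_le_mul_of_nonneg_right F.le F.C_pos.le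
  have hC := F.C_pos
  obtain ⟨c, hc⟩ : ∃ c : ℕ, C = c := ⟨C.toNat, (Int.toNat_of_nonneg hC.le).symm⟩
  have hcP : c ≤ p ^ (u + 4 * n) := by rw [hc] at hCP; exact_mod_cast hCP
  set i := n / 200 with hi
  set e := 3 * i + 1 with he
  have hi1 : 200 * i ≤ n ∧ n < 200 * i + 200 := by omega
  obtain ⟨V, hV⟩ := F.exists_isDirection (e := e) (j := 4 * i) (by omega) (by omega)
  have hpow : ∀ {a b : ℕ}, a ≤ b → p ^ a ≤ p ^ b := fun h => Nat.pow_le_pow_right hp h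
  have hpos : ∀ a : ℕ, 1 ≤ p ^ a := fun a => Nat.one_le_pow _ _ hp
  set W : Vec → Vec := fun x => (p : ℤ) ^ (4 * n - 4 * i) • V (F.residue ((p : ℤ) ^ (4 * i)) x)
  set S1 := S.filter fun x => rf A B C x = 0
  set S2 := S.filter fun x => rf A B C x ≠ 0 ∧ Degenerate A B C δ x (W x)
  set S3 := S.filter fun x => ¬ Degenerate A B C δ x (W x)
  have hsub : S ⊆ S1 ∪ S2 ∪ S3 := by
    intro x hx
    simp only [S1, S2, S3, Finset.mem_union, Finset.mem_filter]
    tauto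
  have h1 : S1.card ≤ 100 * p ^ (4 * n) := by
    have := F.card_rf_eq_zero_le (s := 2 * n) (M := 4 * c) S1
      (fun x hx => by
        rw [← two_mul, ← mul_assoc]
        exact (hS x (Finset.mem_filter.1 hx).1).adm)
      (fun x hx => (Finset.mem_filter.1 hx).2)
      (fun x hx => (hS x (Finset.mem_filter.1 hx).1).b0)
      (fun x hx => by
        have := (hS x (Finset.mem_filter.1 hx).1).abs_le F 3
        rw [hc] at this
        exact_mod_cast this)
    refine this.trans ?_
    have h4 := div_pow_le_mul_pow (k := 4) (b := 2 * n) (c := 4 * n) hp hcP (by omega)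
    have := hpos (4 * n)
    omega
  have h2 : S2.card ≤ 8738560 * p ^ (4 * n) := by
    have := card_degenerate_le F hδ (n := n) (e := e) (k := 4 * n - 4 * i) (j := 4 * i)
      (M := 4 * c) (S₀ := 11 * p ^ (u + 2 * n)) (by omega) (by omega) (by omega)
      (by rw [hc]; push_cast; rfl) (by
        have h5 : C ^ 2 ≤ ((p : ℤ) ^ (u + 4 * n)) ^ 2 := by gcongr
        have h6 : ((p : ℤ) ^ (u + 4 * n)) ^ 2 = ((p : ℤ) ^ (u + 2 * n)) ^ 2 * (p : ℤ) ^ (4 * n) := by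
          ring
        push_cast
        nlinarith [sq_nonneg B]) hV S2
      (fun x hx => hS x (Finset.mem_filter.1 hx).1)
      (fun x hx => (Finset.mem_filter.1 hx).2.1)
      (fun x hx => (Finset.mem_filter.1 hx).2.2)
    refine this.trans ?_
    have h4 := div_pow_le_mul_pow (k := 4) (b := 4 * n) (c := u) hp hcP (by omega)
    have h5 := div_pow_le_mul_pow (k := 4) (b := 3 * n - (2 * e + 1)) (c := u + n + 2 * e + 1) hp
      hcP (by omega)
    have hu1 := hpos u
    have hu2 := hpos (u + n + 2 * e + 1)
    rw [show 4 * n - (n - (3 * e + 1)) = 3 * n + (3 * e + 1) by omega]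
    calc _ ≤ ((10 * p ^ u) ^ 4 * (32 * p ^ (3 * n + (3 * e + 1))) +
          (20 * p ^ (u + n + 2 * e + 1)) * 2 * (514 * (11 * p ^ (u + 2 * n)) * p ^ e)) *
            (2 * p ^ e) ^ 4 := by
          gcongr
          · omega
          · omega
      _ = 5120000 * p ^ (4 * u + 3 * n + 7 * e + 1) + 3618560 * p ^ (2 * u + 3 * n + 7 * e + 1) := by
          ring
      _ ≤ 5120000 * p ^ (4 * n) + 3618560 * p ^ (4 * n) :=
          Nat.add_le_add (Nat.mul_le_mul_left _ (hpow (by omega)))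
            (Nat.mul_le_mul_left _ (hpow (by omega)))
      _ = _ := by ring
  have h3 : (S3.card : ℝ) ≤ 82944 * Cst * (p : ℝ) ^ (4 * n) := by
    have := hCst (p ^ (i - 1)) A B C p e (4 * n - 4 * i) (4 * i) (4 * n) (5 * c) (hpos _) F
      (by omega) (by omega) (by omega) (by
        push_cast
        rw [← pow_add, ← pow_add, show i - 1 + (4 * n - 4 * i) + e = 4 * n by omega]
        exact hPC) (by
        have : 3000 * (5 * c) ^ 4 ≤ (p ^ (i - 1)) ^ 4800 := by
          calc 3000 * (5 * c) ^ 4 ≤ 3000 * (5 * p ^ (u + 4 * n)) ^ 4 := by gcongr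
            _ = 1875000 * p ^ ((u + 4 * n) * 4) := by rw [pow_mul]; ring
            _ ≤ 3 ^ 14 * p ^ ((u + 4 * n) * 4) := by gcongr; norm_num
            _ ≤ p ^ 14 * p ^ ((u + 4 * n) * 4) := by gcongr
            _ = p ^ (14 + (u + 4 * n) * 4) := (pow_add _ _ _).symm
            _ ≤ p ^ ((i - 1) * 4800) := hpow (by omega)
            _ = _ := pow_mul _ _ _
        rw [hc]
        exact_mod_cast this) (by rw [hc]; push_cast; rfl) V hV S3
      (fun x hx => hS x (Finset.mem_filter.1 hx).1) (fun x hx => (Finset.mem_filter.1 hx).2)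
    have h4 := div_pow_le_mul_pow (k := 5) (b := 4 * n) (c := u) hp hcP (by omega)
    have hu1 := hpos u
    have h6 : (2 * (5 * c / p ^ (4 * n)) + 2) ^ 4 * (4 * p ^ (4 * n)) ≤
        82944 * (p ^ u) ^ 4 * p ^ (4 * n) := by
      calc _ ≤ (12 * p ^ u) ^ 4 * (4 * p ^ (4 * n)) := by gcongr; omega
        _ = _ := by ring
    have hy : (((p ^ u : ℕ) : ℝ) ^ 4) ^ (2 * 4800 + 2 + 1) ≤ ((p ^ (i - 1) : ℕ) : ℝ) := by
      rw [← pow_mul]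
      have : (p ^ u) ^ (4 * (2 * 4800 + 2 + 1)) ≤ p ^ (i - 1) := by
        rw [← pow_mul]
        exact hpow (by omega)
      exact_mod_cast this
    have hfin := mul_le_of_mul_le_rpow
      (X := ((82944 * (p ^ u) ^ 4 * p ^ (4 * n) : ℕ) : ℝ) * Cst) (L := 2 * 4800 + 2)
      (Nat.cast_nonneg S3.card) (by exact_mod_cast hpos _) (by positivity) hy ?_
    · have hH0 : (0 : ℝ) < ((p ^ u : ℕ) : ℝ) ^ 4 := by
        have : (0 : ℝ) < ((p ^ u : ℕ) : ℝ) := by exact_mod_cast hpos u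
        positivity
      refine le_of_mul_le_mul_right (hfin.trans (le_of_eq ?_)) hH0
      push_cast
      ring
    · refine this.trans ?_
      rw [← mul_assoc]
      exact mul_le_mul_of_nonneg_right (mul_le_mul_of_nonneg_right (Nat.cast_le.2 h6) hC0.le)
        (by positivity)
  have hcard : S.card ≤ S1.card + S2.card + S3.card :=
    (Finset.card_le_card hsub).trans ((Finset.card_union_le _ _).trans
      (Nat.add_le_add_right (Finset.card_union_le _ _) _))
  have hcard' : (S.card : ℝ) ≤ S1.card + S2.card + S3.card := by exact_mod_cast hcard
  have h1' : (S1.card : ℝ) ≤ 100 * (p : ℝ) ^ (4 * n) := by exact_mod_cast h1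
  have h2' : (S2.card : ℝ) ≤ 8738560 * (p : ℝ) ^ (4 * n) := by exact_mod_cast h2
  linarith

lemma card_le_of_abs_le (S : Finset Vec) {c : ℕ} (h : ∀ x ∈ S, ∀ i, |x i| ≤ (c : ℤ)) :
    S.card ≤ (2 * c + 1) ^ 4 := by
  have hsub : S ⊆ Fintype.piFinset fun _ => Finset.Icc (-(c : ℤ)) c := by
    intro x hx
    rw [Fintype.mem_piFinset]
    intro i
    have := _root_.abs_le.1 (h x hx i)
    exact Finset.mem_Icc.2 this
  refine (Finset.card_le_card hsub).trans (le_of_eq ?_)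
  rw [Fintype.card_piFinset_const, Int.card_Icc]
  congr 1
  omega

/-- The counting estimate for large `n`; `H = 8 + n / (4TG)` measures how much `AC` may exceed
`p ^ (8n)`. -/
lemma card_sol_le_of_large {T : ℕ} (hT : 10000000 ≤ T) (δ : ℤ) (hδ : 0 < δ) :
    ∃ Cst : ℝ, 0 < Cst ∧ ∀ (A B C : ℤ) (p n m : ℕ), ReducedForm A B C p →
      32 * T * (4 * (2 * (50 * T) + 3)) ≤ n → (p : ℤ) ^ (4 * n) ≤ C →
      A * C ≤ ((p : ℤ) ^ (8 + n / (4 * T * (4 * (2 * (50 * T) + 3)))) * (p : ℤ) ^ (4 * n)) ^ 2 →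
      C ≤ m * ((p : ℤ) ^ (4 * n)) ^ 2 →
      ∀ S : Finset Vec, (∀ x ∈ S, Sol A B C δ ((p : ℤ) ^ (4 * n)) x) →
      (S.card : ℝ) ≤ (Cst + 16 * m + 8) * (p : ℝ) ^ (4 * n) := by
  classical
  obtain ⟨C1, hC1, h1⟩ := card_unbalanced_le (50 * T) δ hδ
  obtain ⟨C2, hC2, h2⟩ := card_balanced_le δ hδ
  refine ⟨C1 + C2, by positivity, fun A B C p n m F hn hPC hAC hm S hS => ?_⟩
  set G := 4 * (2 * (50 * T) + 3) with hG
  have hp := F.prime.pos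
  have hp2 := F.prime.two_le
  have hT0 : 0 < T := by omega
  have hTu : T * (n / T) ≤ n ∧ n < T * (n / T) + T :=
    ⟨Nat.mul_div_le _ _, by have := Nat.lt_mul_div_succ n hT0; linarith⟩
  have hTG : T ≤ T * G := Nat.le_mul_of_pos_right _ (by omega)
  have hTn : 32 * T ≤ n := by
    refine le_trans ?_ hn
    rw [mul_assoc 32]
    exact Nat.mul_le_mul_left _ hTG
  have hP0 : (0 : ℝ) ≤ (p : ℝ) ^ (4 * n) := by positivity
  by_cases hu : (p : ℤ) ^ (n / T) * (p : ℤ) ^ (4 * n) ≤ C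
  · set S1 := S.filter fun x => |x 0| = 2 * A
    set S2 := S.filter fun x => |x 0| ≠ 2 * A
    have hcard : S1.card + S2.card = S.card := Finset.card_filter_add_card_filter_not _
    have hS2 : (S2.card : ℝ) ≤ C1 * (p : ℝ) ^ (4 * n) := by
      refine h1 A B C p n (n / T) (p ^ (8 + n / (4 * T * G))) F (by omega) ?_ ?_ hu
        (by push_cast; exact hAC) ?_ S2 (fun x hx => hS x (Finset.mem_filter.1 hx).1)
        (fun x hx => (Finset.mem_filter.1 hx).2)
      · exact hp2.trans (Nat.le_self_pow (by positivity) _)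
      · rw [← pow_mul]
        refine Nat.pow_le_pow_right hp ?_
        rw [Nat.le_div_iff_mul_le hT0]
        have := Nat.div_mul_le_self n (4 * T * G)
        nlinarith
      · nlinarith [hTu.2]
    have hS1 : S1.card ≤ (16 * m + 8) * p ^ (4 * n) := by
      have hC := F.C_pos
      obtain ⟨c, rfl⟩ : ∃ c : ℕ, C = c := ⟨C.toNat, (Int.toNat_of_nonneg hC.le).symm⟩
      have h3 := F.card_boundary_le (m := 4 * n) (M := 2 * c) (by push_cast; rfl) S1
        (fun x hx => hS x (Finset.mem_filter.1 hx).1) (fun x hx => (Finset.mem_filter.1 hx).2)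
      have h4 : 2 * c / p ^ (4 * n) ≤ 2 * m * p ^ (4 * n) := by
        refine Nat.div_le_of_le_mul ?_
        have : c ≤ m * (p ^ (4 * n)) ^ 2 := by exact_mod_cast hm
        nlinarith
      have h5 : 1 ≤ p ^ (4 * n) := Nat.one_le_pow _ _ hp
      nlinarith
    have hS1' : (S1.card : ℝ) ≤ (16 * m + 8) * (p : ℝ) ^ (4 * n) := by exact_mod_cast hS1
    have hcard' : (S.card : ℝ) = S1.card + S2.card := by exact_mod_cast hcard.symm
    rw [hcard']
    nlinarith [mul_nonneg hC2.le hP0]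
  · have := h2 A B C p n (n / T) F (by omega)
      ((Nat.mul_le_mul_right _ hT).trans hTu.1) hPC (by rw [pow_add]; exact (not_le.1 hu).le) S hS
    nlinarith [mul_nonneg hC1.le hP0, mul_nonneg (Nat.cast_nonneg (α := ℝ) m) hP0]

lemma le_pow_of_rpow_lt {D η q : ℝ} {n R : ℕ} (hD : 1 ≤ D) (hη : 0 < η) (hη4 : η ≤ 1 / 4)
    (hR : 16 * R * η ≤ 1) (hR0 : 0 < R) (hq : 1 ≤ q)
    (h : D ^ ((1 : ℝ) / 2 - η) < q ^ (4 * (n + 1))) :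
    D ≤ q ^ (8 * (n + 1) + 2 * (n / R + 1)) := by
  have hD0 : 0 < D := by linarith
  have hq0 : 0 ≤ q := by linarith
  have h1 : D ≤ q ^ (16 * (n + 1)) := by
    calc D = D ^ (1 : ℝ) := (Real.rpow_one D).symm
      _ ≤ D ^ (((1 : ℝ) / 2 - η) * (4 : ℕ)) :=
          Real.rpow_le_rpow_of_exponent_le hD (by push_cast; linarith)
      _ = (D ^ ((1 : ℝ) / 2 - η)) ^ 4 := by rw [Real.rpow_mul hD0.le, Real.rpow_natCast]
      _ ≤ (q ^ (4 * (n + 1))) ^ 4 := by gcongr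
      _ = _ := by rw [← pow_mul]; congr 1; ring
  have h2 : D ^ (2 * η) ≤ q ^ (2 * (n / R + 1)) := by
    calc D ^ (2 * η) ≤ (q ^ (16 * (n + 1))) ^ (2 * η) :=
          Real.rpow_le_rpow hD0.le h1 (by linarith)
      _ = q ^ (((16 * (n + 1) : ℕ) : ℝ) * (2 * η)) := by
          rw [Real.rpow_mul hq0, Real.rpow_natCast]
      _ ≤ q ^ ((2 * (n / R + 1) : ℕ) : ℝ) := by
          refine Real.rpow_le_rpow_of_exponent_le hq ?_
          have h3 : ((n + 1 : ℕ) : ℝ) ≤ ((R * (n / R + 1) : ℕ) : ℝ) :=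
            Nat.cast_le.2 (Nat.lt_mul_div_succ n hR0)
          push_cast at h3 ⊢
          have h4 : (0 : ℝ) ≤ ((n / R : ℕ) : ℝ) + 1 := by positivity
          calc 16 * ((n : ℝ) + 1) * (2 * η) = 32 * η * (n + 1) := by ring
            _ ≤ 32 * η * (R * (((n / R : ℕ) : ℝ) + 1)) := by gcongr
            _ = 2 * (16 * R * η) * (((n / R : ℕ) : ℝ) + 1) := by ring
            _ ≤ 2 * 1 * (((n / R : ℕ) : ℝ) + 1) := by gcongr
            _ = _ := by ring
      _ = _ := Real.rpow_natCast _ _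
  calc D = D ^ (((1 : ℝ) / 2 - η) * (2 : ℕ) + 2 * η) := by
        rw [show ((1 : ℝ) / 2 - η) * (2 : ℕ) + 2 * η = 1 by push_cast; ring, Real.rpow_one]
    _ = (D ^ ((1 : ℝ) / 2 - η)) ^ 2 * D ^ (2 * η) := by
        rw [Real.rpow_add hD0, Real.rpow_mul hD0.le, Real.rpow_natCast]
    _ ≤ (q ^ (4 * (n + 1))) ^ 2 * q ^ (2 * (n / R + 1)) := by gcongr
    _ = _ := by rw [← pow_mul, ← pow_add]; congr 1; ring

/-- The counting estimate in integral coordinates. -/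
lemma exists_card_sol_le (δ0 : ℝ) (hδ0 : δ0 ∈ Set.Ioo (0 : ℝ) (1 / 2)) :
    ∃ η ∈ Set.Ioo (0 : ℝ) (1 / 4), ∀ c0 : ℝ, 0 < c0 → ∀ δ : ℤ, 0 < δ → ∀ p : ℕ, p.Prime →
      ∃ κ : ℝ, 0 ≤ κ ∧ ∀ (A B C : ℤ) (D : ℝ), ReducedForm A B C p →
        4 * D = ((4 * A * C - B ^ 2 : ℤ) : ℝ) → 1 ≤ D → c0 * D ^ δ0 ≤ (A : ℝ) → ∀ n : ℕ,
        (p : ℝ) ^ (4 * n) ≤ D ^ ((1 : ℝ) / 2 - η) →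
        D ^ ((1 : ℝ) / 2 - η) < (p : ℝ) ^ (4 * (n + 1)) → ∀ S : Finset Vec,
        (∀ x ∈ S, Sol A B C δ ((p : ℤ) ^ (4 * n)) x) →
        (S.card : ℝ) ≤ κ * (p : ℝ) ^ (4 * n) := by
  obtain ⟨T, hT⟩ : ∃ T : ℕ, 10000000 ≤ T := ⟨_, le_rfl⟩
  obtain ⟨R, hR⟩ : ∃ R : ℕ, R = 4 * T * (4 * (2 * (50 * T) + 3)) := ⟨_, rfl⟩
  have hR0 : 0 < R := by rw [hR]; positivity
  have hR1 : (1 : ℝ) ≤ R := by exact_mod_cast hR0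
  set η : ℝ := min (δ0 / 4) (1 / (16 * R)) with hη
  have hη0 : 0 < η := lt_min (by linarith [hδ0.1]) (by positivity)
  have hη1 : η ≤ δ0 / 4 := min_le_left _ _
  have hη2 : 16 * R * η ≤ 1 := by
    have : η ≤ 1 / (16 * R) := min_le_right _ _
    rw [le_div_iff₀ (by positivity)] at this
    linarith
  have hη8 : η < 1 / 8 := by linarith [hδ0.2]
  refine ⟨η, ⟨hη0, by linarith⟩, fun c0 hc0 δ hδ p hp => ?_⟩
  obtain ⟨Cst, hC0, hCst⟩ := card_sol_le_of_large hT δ hδ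
  obtain ⟨n₀, hn₀⟩ : ∃ n₀ : ℕ, n₀ = 32 * T * (4 * (2 * (50 * T) + 3)) := ⟨_, rfl⟩
  set m : ℕ := ⌈2 / c0 * (p : ℝ) ^ 8⌉₊ with hm
  refine ⟨(Cst + 16 * m + 8) + ((9 * p ^ (10 * n₀ + 11)) ^ 4 : ℕ), by positivity,
    fun A B C D F hD hD1 hA n hn1 hn2 S hS => ?_⟩
  have hp1 : (1 : ℝ) ≤ p := by exact_mod_cast hp.one_le
  have hp2 : (2 : ℝ) ≤ p := by exact_mod_cast hp.two_le
  have hD0 : 0 < D := by linarith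
  have hA0 : (0 : ℝ) < A := by exact_mod_cast F.pos
  have hAC : (A : ℝ) * C ≤ 2 * D := by
    have h1 : B ^ 2 ≤ A * C := by
      have := F.abs_le
      have h2 : B ^ 2 ≤ A ^ 2 := sq_le_sq' (by linarith [neg_abs_le B]) ((le_abs_self B).trans this)
      nlinarith [F.le, F.pos]
    have h3 : (B : ℝ) ^ 2 ≤ A * C := by exact_mod_cast h1
    push_cast at hD
    nlinarith
  have hC0' : (0 : ℝ) < C := by exact_mod_cast F.C_pos
  have hACC : (C : ℝ) ≤ A * C := by
    have : (1 : ℝ) ≤ A := by exact_mod_cast F.pos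
    nlinarith
  have hP0 : (0 : ℝ) ≤ (p : ℝ) ^ (4 * n) := by positivity
  have hP1 : (1 : ℝ) ≤ (p : ℝ) ^ (4 * n) := one_le_pow₀ hp1
  have hDle := le_pow_of_rpow_lt hD1 hη0 (by linarith) hη2 hR0 hp1 hn2
  have hACle : (A : ℝ) * C ≤ (p : ℝ) ^ (8 * (n + 1) + 2 * (n / R + 1) + 1) := by
    rw [pow_succ]
    nlinarith
  rcases lt_or_ge n n₀ with hlt | hge
  · have hC : C ≤ ((p ^ (10 * n₀ + 11) : ℕ) : ℤ) := by
      have : (C : ℝ) ≤ (p : ℝ) ^ (10 * n₀ + 11) := by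
        refine (hACC.trans hACle).trans (pow_le_pow_right₀ hp1 ?_)
        have := Nat.div_le_self n R
        omega
      exact_mod_cast this
    have hcard := card_le_of_abs_le S (c := 4 * p ^ (10 * n₀ + 11)) fun x hx i => by
      have := (hS x hx).abs_le F i
      push_cast at hC ⊢
      linarith
    have h1 : 1 ≤ p ^ (10 * n₀ + 11) := Nat.one_le_pow _ _ hp.pos
    have h2 : S.card ≤ (9 * p ^ (10 * n₀ + 11)) ^ 4 :=
      hcard.trans (Nat.pow_le_pow_left (by omega) 4)
    calc (S.card : ℝ) ≤ ((9 * p ^ (10 * n₀ + 11)) ^ 4 : ℕ) := by exact_mod_cast h2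
      _ ≤ ((9 * p ^ (10 * n₀ + 11)) ^ 4 : ℕ) * (p : ℝ) ^ (4 * n) :=
          le_mul_of_one_le_right (by positivity) hP1
      _ ≤ _ := by
          gcongr
          exact le_add_of_nonneg_left (by positivity)
  · have hsq : (D ^ ((1 : ℝ) / 2 - η)) ^ 2 = D ^ (1 - 2 * η) := by
      rw [← Real.rpow_natCast, ← Real.rpow_mul hD0.le]
      congr 1
      push_cast
      ring
    have hPC : (p : ℤ) ^ (4 * n) ≤ C := by
      have h1 : ((p : ℝ) ^ (4 * n)) ^ 2 ≤ D := by
        calc ((p : ℝ) ^ (4 * n)) ^ 2 ≤ (D ^ ((1 : ℝ) / 2 - η)) ^ 2 := by gcongr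
          _ = D ^ (1 - 2 * η) := hsq
          _ ≤ D ^ (1 : ℝ) := Real.rpow_le_rpow_of_exponent_le hD1 (by linarith)
          _ = D := Real.rpow_one D
      have h2 : D ≤ (C : ℝ) ^ 2 := by
        have hle : (A : ℝ) ≤ C := by exact_mod_cast F.le
        push_cast at hD
        nlinarith [sq_nonneg (B : ℝ)]
      have h3 : (p : ℝ) ^ (4 * n) ≤ C := (pow_le_pow_iff_left₀ hP0 hC0'.le two_ne_zero).1 (h1.trans h2)
      exact_mod_cast h3
    have hAC' : A * C ≤ ((p : ℤ) ^ (8 + n / R) * (p : ℤ) ^ (4 * n)) ^ 2 := by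
      have : (A : ℝ) * C ≤ ((p : ℝ) ^ (8 + n / R) * (p : ℝ) ^ (4 * n)) ^ 2 := by
        refine hACle.trans ?_
        rw [← pow_add, ← pow_mul]
        exact pow_le_pow_right₀ hp1 (by omega)
      exact_mod_cast this
    have hCm : C ≤ m * ((p : ℤ) ^ (4 * n)) ^ 2 := by
      have h1 : c0 * D ^ δ0 * C ≤ 2 * (D ^ δ0 * D ^ (1 - δ0)) := by
        rw [← Real.rpow_add hD0, add_sub_cancel, Real.rpow_one]
        exact (mul_le_mul_of_nonneg_right hA hC0'.le).trans hAC
      have h2 : (0 : ℝ) < D ^ δ0 := by positivity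
      have h3 : c0 * C ≤ 2 * D ^ (1 - δ0) := by
        refine le_of_mul_le_mul_left ?_ h2
        linarith
      have h4 : D ^ (1 - δ0) ≤ ((p : ℝ) ^ (4 * (n + 1))) ^ 2 := by
        calc D ^ (1 - δ0) ≤ D ^ (1 - 2 * η) :=
              Real.rpow_le_rpow_of_exponent_le hD1 (by linarith [hδ0.1])
          _ = (D ^ ((1 : ℝ) / 2 - η)) ^ 2 := hsq.symm
          _ ≤ _ := by gcongr
      have h5 : (C : ℝ) ≤ (2 / c0 * (p : ℝ) ^ 8) * ((p : ℝ) ^ (4 * n)) ^ 2 := by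
        rw [div_mul_eq_mul_div, div_mul_eq_mul_div, le_div_iff₀ hc0]
        calc (C : ℝ) * c0 ≤ 2 * ((p : ℝ) ^ (4 * (n + 1))) ^ 2 := by linarith
          _ = _ := by ring
      have h6 : (C : ℝ) ≤ m * ((p : ℝ) ^ (4 * n)) ^ 2 :=
        h5.trans (mul_le_mul_of_nonneg_right (Nat.le_ceil _) (by positivity))
      exact_mod_cast h6
    refine (hCst A B C p n m F (hn₀ ▸ hge) hPC (hR ▸ hAC') hCm S hS).trans ?_
    exact mul_le_mul_of_nonneg_right (le_add_of_nonneg_right (by positivity)) hP0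

lemma padicValRat_two_pow {p : ℕ} (hp : p.Prime) (hp2 : p ≠ 2) (e : ℕ) :
    padicValRat p ((2 : ℚ) ^ e) = 0 := by
  have := Fact.mk hp
  have := Fact.mk Nat.prime_two
  have h : padicValNat p (2 ^ e) = 0 := padicValNat_prime_prime_pow e hp2
  have h2 := padicValRat.of_nat (p := p) (n := 2 ^ e)
  rw [h] at h2
  exact_mod_cast h2

lemma PCong.dvd {p k : ℕ} {a b : ℚ} (h : PCong p k a b) (hp : p.Prime) (hp2 : p ≠ 2) {e : ℕ}
    {m : ℤ} (hm : (2 : ℚ) ^ e * (a - b) = m) : (p : ℤ) ^ k ∣ m := by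
  have := Fact.mk hp
  rcases h with rfl | h
  · rw [sub_self, mul_zero] at hm
    have : m = 0 := by exact_mod_cast hm.symm
    simp [this]
  · by_cases h0 : a - b = 0
    · rw [h0, mul_zero] at hm
      have : m = 0 := by exact_mod_cast hm.symm
      simp [this]
    · rw [padicValInt_dvd_iff]
      right
      have h1 : padicValRat p (m : ℚ) = padicValRat p (a - b) := by
        rw [← hm, padicValRat.mul (by positivity) h0, padicValRat_two_pow hp hp2, zero_add]
      rw [padicValRat.of_int] at h1
      rw [← h1] at h
      exact_mod_cast h

lemma IsIntegralPosDefForm.det_pos {n : ℕ} {M : Matrix (Fin n) (Fin n) ℚ}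
    (h : IsIntegralPosDefForm M) : 0 < M.det := by
  obtain ⟨hs, -, -, hpos⟩ := h
  have hne : M.det ≠ 0 := by
    intro h0
    obtain ⟨v, hv, hv0⟩ := Matrix.exists_mulVec_eq_zero_iff.2 h0
    have := hpos v hv
    rw [hv0, dotProduct_zero] at this
    exact lt_irrefl _ this
  have hpsd : (M.map ((↑) : ℚ → ℝ)).PosSemidef := by
    refine Matrix.PosSemidef.of_dotProduct_mulVec_nonneg ?_ fun v => ?_
    · ext i j
      simp [hs.apply i j]
    · rw [star_trivial]
      have hd : DenseRange (Pi.map fun _ : Fin n => ((↑) : ℚ → ℝ)) :=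
        DenseRange.piMap fun _ => Rat.denseRange_cast
      refine hd.induction_on (p := fun v : Fin n → ℝ => 0 ≤ v ⬝ᵥ (M.map ((↑) : ℚ → ℝ)) *ᵥ v) v ?_ ?_
      · refine isClosed_le continuous_const ?_
        simp only [dotProduct, mulVec]
        fun_prop
      · intro w
        have hw : 0 ≤ w ⬝ᵥ M *ᵥ w := by
          rcases eq_or_ne w 0 with rfl | hw
          · simp
          · exact (hpos w hw).le
        have : ((w ⬝ᵥ M *ᵥ w : ℚ) : ℝ) = (Pi.map fun _ : Fin n => ((↑) : ℚ → ℝ)) w ⬝ᵥ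
            (M.map ((↑) : ℚ → ℝ)) *ᵥ (Pi.map fun _ : Fin n => ((↑) : ℚ → ℝ)) w := by
          simp [dotProduct, mulVec]
        rw [← this]
        exact_mod_cast hw
  have h0 : (0 : ℝ) ≤ (M.det : ℝ) := by
    have h1 := hpsd.det_nonneg
    have h2 : (M.map ((↑) : ℚ → ℝ)).det = (M.det : ℝ) := ((Rat.castHom ℝ).map_det M).symm
    rwa [h2] at h1
  exact lt_of_le_of_ne (by exact_mod_cast h0) hne.symm

lemma IsIntegralPosDefForm.exists_det_eq {M : Matrix (Fin 4) (Fin 4) ℚ}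
    (h : IsIntegralPosDefForm M) : ∃ δ : ℤ, 0 < δ ∧ (δ : ℚ) = 16 * M.det := by
  choose N hN using h.2.2.1
  have h1 : ((Matrix.of N).map (Int.castRingHom ℚ)) = (2 : ℚ) • M := by
    ext i j
    simp [hN]
  have h2 : ((Matrix.of N).det : ℚ) = 16 * M.det := by
    have := (Int.castRingHom ℚ).map_det (Matrix.of N)
    rw [RingHom.mapMatrix_apply, h1, Matrix.det_smul] at this
    rw [eq_intCast] at this
    rw [this, Fintype.card_fin]
    norm_num
  refine ⟨_, ?_, h2⟩
  have := h.det_pos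
  have h3 : (0 : ℚ) < ((Matrix.of N).det : ℚ) := by rw [h2]; positivity
  exact_mod_cast h3

lemma reducedForm_of {A B C : ℤ} {p : ℕ} (hp : p.Prime) (hp2 : p ≠ 2) (hA : 0 < A) (hB : |B| ≤ A)
    (hC : A ≤ C) (hD : (1 : ℚ) ≤ (A : ℚ) * C - (B : ℚ) ^ 2 / 4)
    (hg : Int.gcd (Int.gcd A B) C = 1)
    (hv : padicValRat p ((A : ℚ) * C - (B : ℚ) ^ 2 / 4) = 0) : ReducedForm A B C p where
  pos := hA
  abs_le := hB
  le := hC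
  primitive := by
    obtain ⟨a, c, h⟩ := Int.isCoprime_iff_gcd_eq_one.2 hg
    rw [Int.gcd_eq_gcd_ab A B] at h
    exact ⟨a * A.gcdA B, a * A.gcdB B, c, by linear_combination h⟩
  prime := hp
  ne_two := hp2
  not_dvd h := by
    have := Fact.mk hp
    have h1 : padicValRat p ((4 * A * C - B ^ 2 : ℤ) : ℚ) = 0 := by
      rw [show ((4 * A * C - B ^ 2 : ℤ) : ℚ) = 2 ^ 2 * ((A : ℚ) * C - (B : ℚ) ^ 2 / 4) by
        push_cast; ring, padicValRat.mul (by positivity) (by positivity),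
        padicValRat_two_pow hp hp2, hv, add_zero]
    rw [padicValRat.of_int] at h1
    have h2 := (padicValInt_dvd_iff 1 (4 * A * C - B ^ 2)).1 (by rwa [pow_one])
    rcases h2 with h2 | h2
    · have h3 : ((4 * A * C - B ^ 2 : ℤ) : ℚ) = 0 := by exact_mod_cast h2
      push_cast at h3
      linarith
    · omega

/-- Integral coordinates of a point of `𝒮(n)`. -/
def toVec (x : Fin 5 → ℚ) : Vec :=
  ![⌊2 * x 1⌋, ⌊2 * (x 2 + x 3)⌋, ⌊2 * x 4⌋, ⌊2 * (x 2 - x 3)⌋]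

lemma toVec_spec {MQ : Matrix (Fin 4) (Fin 4) ℚ} {A B C : ℤ} {p n : ℕ} {x : Fin 5 → ℚ}
    (hx : x ∈ SSetQ MQ A B C p n) :
    (toVec x 0 : ℚ) = 2 * x 1 ∧ (toVec x 1 : ℚ) = 2 * (x 2 + x 3) ∧ (toVec x 2 : ℚ) = 2 * x 4 ∧
      (toVec x 3 : ℚ) = 2 * (x 2 - x 3) := by
  obtain ⟨-, ⟨a1, h1⟩, ⟨a2, h2⟩, ⟨a3, h3⟩, ⟨a4, h4⟩, -⟩ := hx
  have h5 : 2 * (x 2 + x 3) = ((a2 + a3 : ℤ) : ℚ) := by push_cast; linarith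
  have h6 : 2 * (x 2 - x 3) = ((a2 - a3 : ℤ) : ℚ) := by push_cast; linarith
  refine ⟨?_, ?_, ?_, ?_⟩ <;> simp only [toVec, Matrix.cons_val_zero, Matrix.cons_val_one,
    Matrix.cons_val]
  · rw [h1, Int.floor_intCast]
  · rw [h5, Int.floor_intCast]
  · rw [h4, Int.floor_intCast]
  · rw [h6, Int.floor_intCast]

lemma sol_toVec {MQ : Matrix (Fin 4) (Fin 4) ℚ} {A B C δ : ℤ} {p n : ℕ} (hp : p.Prime)
    (hp2 : p ≠ 2) (hδ : (δ : ℚ) = 16 * MQ.det) {x : Fin 5 → ℚ}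
    (hx : x ∈ SSetQ MQ A B C p n) : Sol A B C δ ((p : ℤ) ^ (4 * n)) (toVec x) := by
  obtain ⟨e0, e1, e2, e3⟩ := toVec_spec hx
  obtain ⟨⟨a0, h0⟩, -, -, -, -, hE, b1, b4, b2, b3, c1, c2, c3, c4, d1, d2⟩ := hx
  refine ⟨⟨?_, ?_, ?_, ?_⟩, ?_, ?_, ?_, ?_, ?_, ?_⟩
  · refine c2.dvd hp hp2 (e := 1) ?_
    push_cast
    rw [e0, e2]
    ring
  · refine (dvd_neg.1 (c4.dvd hp hp2 (e := 1) ?_))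
    push_cast
    rw [e0, e1]
    ring
  · refine (dvd_neg.1 (c3.dvd hp hp2 (e := 1) ?_))
    push_cast
    rw [e1, e2]
    ring
  · refine c1.dvd hp hp2 (e := 4) ?_
    simp only [nf]
    push_cast
    rw [e0, e1, e2, e3]
    ring
  · have : |(toVec x 0 : ℚ)| ≤ 2 * A := by
      rw [e0, abs_mul, abs_two]
      linarith
    exact_mod_cast this
  · have : (toVec x 1 : ℚ) ^ 2 ≤ 16 * (A * C) := by
      rw [e1]
      nlinarith [sq_nonneg (x 2 - x 3)]
    exact_mod_cast this
  · have : |(toVec x 2 : ℚ)| ≤ 2 * C := by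
      rw [e2, abs_mul, abs_two]
      linarith
    exact_mod_cast this
  · have : (toVec x 3 : ℚ) ^ 2 ≤ 16 * (A * C) := by
      rw [e3]
      nlinarith [sq_nonneg (x 2 + x 3)]
    exact_mod_cast this
  · refine ⟨2 * a0, ?_⟩
    have : (δ : ℚ) * (2 * a0) ^ 2 = ((nf (toVec x) - 4 * (4 * A * C - B ^ 2)) ^ 2 -
        64 * rf A B C (toVec x) : ℤ) := by
      rw [hδ, ← h0]
      simp only [nf, rf]
      push_cast
      rw [e0, e1, e2, e3]
      linear_combination 256 * hE
    exact_mod_cast this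
  · intro h
    have h1 : |x 1| = A := by
      have : |(toVec x 0 : ℚ)| = 2 * A := by exact_mod_cast h
      rw [e0, abs_mul, abs_two] at this
      linarith
    have key : (toVec x 1 : ℚ) ^ 2 = (2 * B) ^ 2 ∧ (toVec x 3 : ℚ) = 0 := by
      rw [e1, e3]
      rcases eq_or_eq_neg_of_abs_eq h1 with h1 | h1
      · obtain ⟨-, h2, h3⟩ := d1 (.inl h1)
        rw [h2, h3]
        constructor <;> ring
      · obtain ⟨-, h2, h3⟩ := d2 (.inl h1)
        rw [h2, h3]
        constructor <;> ring
    exact_mod_cast key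

lemma injOn_toVec {MQ : Matrix (Fin 4) (Fin 4) ℚ} {A B C : ℤ} {p n : ℕ} (hdet : 0 < MQ.det) :
    Set.InjOn (fun x => (toVec x, decide (0 ≤ x 0))) (SSetQ MQ A B C p n) := by
  intro x hx y hy hxy
  obtain ⟨hv, hs⟩ := Prod.ext_iff.1 hxy
  simp only [decide_eq_decide] at hv hs
  obtain ⟨e0, e1, e2, e3⟩ := toVec_spec hx
  obtain ⟨f0, f1, f2, f3⟩ := toVec_spec hy
  rw [hv] at e0 e1 e2 e3
  have g1 : x 1 = y 1 := by linarith
  have g2 : x 2 = y 2 := by linarith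
  have g3 : x 3 = y 3 := by linarith
  have g4 : x 4 = y 4 := by linarith
  obtain ⟨-, -, -, -, -, hE, -⟩ := hx
  obtain ⟨-, -, -, -, -, hE', -⟩ := hy
  rw [g1, g2, g3, g4, ← hE'] at hE
  have hsq := mul_left_cancel₀ hdet.ne' hE
  have g0 : x 0 = y 0 := by
    rcases sq_eq_sq_iff_eq_or_eq_neg.1 hsq with h | h
    · exact h
    · rcases le_total 0 (x 0) with h0 | h0
      · linarith [hs.1 h0]
      · rcases le_total 0 (y 0) with h1 | h1
        · linarith [hs.2 h1]
        · linarith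
  funext i
  fin_cases i <;> assumption

/-- Fix `c0 ∈ (0, 1/4)` and `δ0 ∈ (0, 1/2)`.  There is
`η ∈ (0, 1/4)`, depending only on `δ0`, such that for every positive definite integral
quaternary form `Q`, every odd prime `p` and every `ε > 0` there is a constant `κ`
(depending only on `Q`, `p`, `ε`, `c0`, `δ0`) with: for every primitive Minkowski-reduced
positive definite integral binary form `q = ⟨A,B,C⟩` of discriminant `D ≥ 1` with
`v_p(D) = 0` and `A ≥ c0·D^δ0`, and for `n` maximal with `p^(4n) ≤ D^(1/2−η)`,
`#𝒮(n) ≤ κ·D^(1/2+ε−η)`. -/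
theorem main_counting_estimate (δ0 : ℝ) (hδ0 : δ0 ∈ Set.Ioo (0 : ℝ) (1 / 2)) :
    ∃ η ∈ Set.Ioo (0 : ℝ) (1 / 4), ∀ c0 ∈ Set.Ioo (0 : ℝ) (1 / 4),
      ∀ MQ : Matrix (Fin 4) (Fin 4) ℚ, IsIntegralPosDefForm MQ →
        ∀ p : ℕ, p.Prime → p ≠ 2 → ∀ ε : ℝ, 0 < ε →
          ∃ κ : ℝ, ∀ A B C : ℤ, 0 < A → |B| ≤ A → A ≤ C →
            (1 : ℚ) ≤ (A : ℚ) * C - (B : ℚ) ^ 2 / 4 →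
            Int.gcd (Int.gcd A B) C = 1 →
            padicValRat p ((A : ℚ) * C - (B : ℚ) ^ 2 / 4) = 0 →
            c0 * (((A : ℚ) * C - (B : ℚ) ^ 2 / 4 : ℚ) : ℝ) ^ δ0 ≤ (A : ℝ) →
            ∀ n : ℕ,
              (p : ℝ) ^ (4 * n) ≤
                  (((A : ℚ) * C - (B : ℚ) ^ 2 / 4 : ℚ) : ℝ) ^ ((1 : ℝ) / 2 - η) →
              (((A : ℚ) * C - (B : ℚ) ^ 2 / 4 : ℚ) : ℝ) ^ ((1 : ℝ) / 2 - η) <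
                  (p : ℝ) ^ (4 * (n + 1)) →
              ((SSetQ MQ A B C p n).ncard : ℝ) ≤
                κ * (((A : ℚ) * C - (B : ℚ) ^ 2 / 4 : ℚ) : ℝ) ^ ((1 : ℝ) / 2 + ε - η) := by
  classical
  obtain ⟨η, hη, H⟩ := exists_card_sol_le δ0 hδ0
  refine ⟨η, hη, fun c0 hc0 MQ hMQ p hp hp2 ε hε => ?_⟩
  obtain ⟨δ, hδ, hdet⟩ := hMQ.exists_det_eq
  obtain ⟨κ, hκ, hcount⟩ := H c0 hc0.1 δ hδ p hp
  refine ⟨2 * κ, fun A B C hA hB hC hD hg hv hAc n hn1 hn2 => ?_⟩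
  have F := reducedForm_of hp hp2 hA hB hC hD hg hv
  set D : ℝ := (((A : ℚ) * C - (B : ℚ) ^ 2 / 4 : ℚ) : ℝ) with hDdef
  have hD1 : 1 ≤ D := by
    rw [hDdef, ← Rat.cast_one]
    exact Rat.cast_le.2 hD
  have hD4 : 4 * D = ((4 * A * C - B ^ 2 : ℤ) : ℝ) := by
    rw [hDdef]; push_cast; ring
  set s := SSetQ MQ A B C p n
  have hbox : (toVec '' s).Finite := by
    refine (Set.finite_Icc (fun _ => -(4 * C) : Vec) (fun _ => 4 * C)).subset ?_
    rintro _ ⟨x, hx, rfl⟩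
    have h := fun i => _root_.abs_le.1 ((sol_toVec hp hp2 hdet hx).abs_le F i)
    exact ⟨fun i => (h i).1, fun i => (h i).2⟩
  have hS := hcount A B C D F hD4 hD1 hAc n hn1 hn2 hbox.toFinset (fun v hv => by
    obtain ⟨x, hx, rfl⟩ := hbox.mem_toFinset.1 hv
    exact sol_toVec hp hp2 hdet hx)
  have hle : s.ncard ≤ hbox.toFinset.card * 2 := by
    have h1 := Set.ncard_le_ncard_of_injOn (t := (hbox.toFinset ×ˢ (Finset.univ : Finset Bool) :
      Finset (Vec × Bool))) (fun x => (toVec x, decide (0 ≤ x 0))) (fun x hx => by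
        simpa using ⟨⟨x, hx, rfl⟩, le_or_gt 0 (x 0)⟩) (injOn_toVec hMQ.det_pos) (Finset.finite_toSet _)
    rwa [Set.ncard_coe_finset, Finset.card_product, Finset.card_univ, Fintype.card_bool] at h1
  calc (s.ncard : ℝ) ≤ hbox.toFinset.card * 2 := by exact_mod_cast hle
    _ ≤ κ * (p : ℝ) ^ (4 * n) * 2 := by gcongr
    _ ≤ κ * D ^ ((1 : ℝ) / 2 + ε - η) * 2 := by
        gcongr
        exact hn1.trans (Real.rpow_le_rpow_of_exponent_le hD1 (by linarith))
    _ = _ := by ring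
end
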